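/- Let p = 3 or p = 5 and let n ≥ 2. Then the ℚ-dimension of the group cohomology H^{n(n−1)/2 − 1}(Γ_n(p); ℚ) with trivial coefficients ℚ is at least p^{binom(n−2,2)} · g · ((p−1)/2)^{n−2}, where g denotes the number of 2-dimensional F_p-linear subspaces of F_p^n. -/

import Mathlib

/-- The level-`p` principal congruence subgroup `Γ_n(p)` of `SL_n(ℤ)`:
the kernel of the mod-`p` reduction homomorphism `SL_n(ℤ) → SL_n(ℤ/p)`. -/
def congruenceSubgroup (n p : ℕ) : Subgroup (Matrix.SpecialLinearGroup (Fin n) ℤ) :=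
  MonoidHom.ker (Matrix.SpecialLinearGroup.map (Int.castRingHom (ZMod p)))

namespace ListCochain

variable {X Y : Type*}

/-- The simplicial coboundary of a rational function on lists. -/
def d : (List Y → ℚ) → List Y → ℚ
  | _, [] => 0
  | f, a :: l => f l - d (fun l' => f (a :: l')) l

@[simp] lemma d_nil (f : List Y → ℚ) : d f [] = 0 := rfl

lemma d_cons (f : List Y → ℚ) (a : Y) (l : List Y) :
    d f (a :: l) = f l - d (fun l' => f (a :: l')) l := rfl

lemma d_congr {f g : List Y → ℚ} {l : List Y}
    (h : ∀ l' : List Y, l'.Sublist l → l'.length + 1 = l.length → f l' = g l') : d f l = d g l := by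
  induction l generalizing f g with
  | nil => rfl
  | cons a l ih =>
    rw [d_cons, d_cons, h l (List.sublist_cons_self a l) rfl, ih]
    intro l' hl' hlen
    exact h _ (hl'.cons_cons a) (by simp [hlen])

lemma d_sub (f g : List Y → ℚ) (l : List Y) : d (fun l' => f l' - g l') l = d f l - d g l := by
  induction l generalizing f g with
  | nil => simp
  | cons a l ih => simp only [d_cons, ih]; ring

lemma d_zero (l : List Y) : d (fun _ : List Y => 0) l = 0 := by
  induction l with
  | nil => rfl
  | cons a l ih => simp [d_cons, ih]

lemma d_smul (c : ℚ) (f : List Y → ℚ) (l : List Y) : d (fun l' => c * f l') l = c * d f l := by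
  induction l generalizing f with
  | nil => simp
  | cons a l ih => simp only [d_cons, ih]; ring

lemma d_add (f g : List Y → ℚ) (l : List Y) : d (fun l' => f l' + g l') l = d f l + d g l := by
  induction l generalizing f g with
  | nil => simp
  | cons a l ih => simp only [d_cons, ih]; ring

lemma d_sum {ι : Type*} (s : Finset ι) (f : ι → List Y → ℚ) (l : List Y) :
    d (fun l' => ∑ i ∈ s, f i l') l = ∑ i ∈ s, d (f i) l := by
  classical
  induction s using Finset.induction_on with
  | empty => simp [d_zero]
  | insert i s hi ih => simp only [Finset.sum_insert hi, d_add, ih]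

lemma d_d (f : List Y → ℚ) (l : List Y) : d (d f) l = 0 := by
  induction l generalizing f with
  | nil => rfl
  | cons a l ih =>
    rw [d_cons]
    have : (fun l' => d f (a :: l')) = fun l' => f l' - d (fun l'' => f (a :: l'')) l' := rfl
    rw [this, d_sub, ih]; ring

lemma d_map (φ : X → Y) (f : List Y → ℚ) (l : List X) :
    d (fun l' => f (l'.map φ)) l = d f (l.map φ) := by
  induction l generalizing f with
  | nil => rfl
  | cons a l ih => simp only [d_cons, List.map_cons]; rw [← ih]

lemma d_eq_sum (f : List Y → ℚ) (l : List Y) :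
    d f l = ∑ j ∈ Finset.range l.length, (-1) ^ j * f (l.eraseIdx j) := by
  induction l generalizing f with
  | nil => rfl
  | cons a l ih =>
    rw [d_cons, ih, List.length_cons, Finset.sum_range_succ']
    simp only [pow_succ, List.eraseIdx_cons_succ, List.eraseIdx_zero, List.tail_cons]
    simp only [mul_neg, mul_one, neg_mul, Finset.sum_neg_distrib, pow_zero, one_mul]
    ring

/-- The front-face back-face product, with a first factor of degree `a`. -/
def cup (a : ℕ) (f g : List Y → ℚ) (l : List Y) : ℚ := f (l.take (a + 1)) * g (l.drop a)

lemma d_cup (a : ℕ) (f g : List Y → ℚ) (l : List Y) (hl : a + 2 ≤ l.length) :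
    d (cup a f g) l = d f (l.take (a + 2)) * g (l.drop (a + 1)) +
      (-1) ^ a * f (l.take (a + 1)) * d g (l.drop a) := by
  induction a generalizing f l with
  | zero =>
    match l, hl with
    | x :: y :: l, _ =>
      simp only [d_cons, cup, zero_add, List.take_succ_cons, List.take_zero, List.drop_succ_cons,
        List.drop_zero, d_nil, pow_zero, d_smul]
      ring
  | succ a ih =>
    match l, hl with
    | x :: l, hl =>
      have hl' : a + 2 ≤ l.length := by simpa using hl
      have e : (fun l' => cup (a + 1) f g (x :: l')) = cup a (fun l' => f (x :: l')) g := by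
        funext l'; simp [cup]
      rw [d_cons, e, ih _ _ hl']
      simp only [cup, List.take_succ_cons, List.drop_succ_cons, d_cons]
      match l, hl' with
      | y :: l, _ =>
        simp only [pow_succ]
        ring

/-- The prism operator between the chain maps induced by two maps of vertices. -/
def prism (r s : X → Y) : (List Y → ℚ) → List X → ℚ
  | _, [] => 0
  | f, a :: l => f (r a :: s a :: l.map s) - prism r s (fun l' => f (r a :: l')) l

lemma prism_sub (r s : X → Y) (f g : List Y → ℚ) (l : List X) :
    prism r s (fun l' => f l' - g l') l = prism r s f l - prism r s g l := by
  induction l generalizing f g with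
  | nil => simp [prism]
  | cons a l ih => simp only [prism, ih]; ring

lemma prism_congr (r s : X → Y) {f g : List Y → ℚ} {l : List X}
    (h : ∀ l' : List Y, l'.length = l.length + 1 → f l' = g l') :
    prism r s f l = prism r s g l := by
  induction l generalizing f g with
  | nil => rfl
  | cons a l ih =>
    simp only [prism]
    rw [h _ (by simp), ih]
    intro l' hl'
    exact h _ (by simp [hl'])

lemma prism_zero (r s : X → Y) (l : List X) : prism r s (fun _ => 0) l = 0 := by
  induction l with
  | nil => rfl
  | cons a l ih => simp [prism, ih]

lemma d_prism (r s : X → Y) (f : List Y → ℚ) (l : List X) (hl : l ≠ []) :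
    d (prism r s f) l = f (l.map s) - f (l.map r) - prism r s (d f) l := by
  induction l generalizing f with
  | nil => exact absurd rfl hl
  | cons a l ih =>
    have e : (fun l' => prism r s f (a :: l')) =
        fun l' => f (r a :: s a :: l'.map s) - prism r s (fun l'' => f (r a :: l'')) l' := rfl
    rw [d_cons, e, d_sub]
    have e1 : d (fun l' => f (r a :: s a :: l'.map s)) l =
        d (fun l' => f (r a :: s a :: l')) (l.map s) :=
      d_map s (fun l' => f (r a :: s a :: l')) l
    rw [e1]
    simp only [prism, prism_sub, d_cons, List.map_cons]
    by_cases h : l = []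
    · subst h; simp [prism]
    · rw [ih _ h]; ring

end ListCochain

namespace ListCochain

variable {U : Type*} [Group U]

/-- Invariance of a cochain under left translation by a subgroup. -/
def Inv (H : Subgroup U) (f : List U → ℚ) : Prop :=
  ∀ h ∈ H, ∀ l : List U, f (l.map (h * ·)) = f l

/-- The cochain `f` is, in degree `r`, the coboundary of an `H`-invariant cochain. -/
def Cob (H : Subgroup U) (r : ℕ) (f : List U → ℚ) : Prop :=
  ∃ b : List U → ℚ, Inv H b ∧ b [] = 0 ∧ ∀ l, l.length = r + 1 → f l = d b l

/-- `f` is a cocycle in degree `r`. -/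
def Coc (r : ℕ) (f : List U → ℚ) : Prop := ∀ l : List U, l.length = r + 2 → d f l = 0

/-- The cohomology of `H` vanishes above degree `r`, and `U` acts trivially on it in
degree `r`. -/
def Van (r : ℕ) (H : Subgroup U) : Prop :=
  (∀ j, r < j → ∀ f, Inv H f → Coc j f → Cob H j f) ∧
  ∀ θ : U, ∀ a, Inv H a → Coc r a → Cob H r (fun l => a (l.map (θ * ·)) - a l)

/-- The elements translating `f` to itself. -/
def stab (f : List U → ℚ) : Subgroup U where
  carrier := {g | ∀ l : List U, f (l.map (g * ·)) = f l}
  one_mem' := by intro l; simp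
  mul_mem' := by
    intro a b ha hb l
    have : l.map ((a * b) * ·) = (l.map (b * ·)).map (a * ·) := by
      simp [List.map_map, Function.comp_def, mul_assoc]
    rw [this, ha, hb]
  inv_mem' := by
    intro a ha l
    rw [← ha]
    simp [List.map_map, Function.comp_def]

lemma inv_iff (H : Subgroup U) (f : List U → ℚ) : Inv H f ↔ H ≤ stab f := Iff.rfl

lemma map_mul_map_mul (a b : U) (l : List U) :
    (l.map (b * ·)).map (a * ·) = l.map ((a * b) * ·) := by
  simp [List.map_map, Function.comp_def, mul_assoc]

lemma Inv.sub {H : Subgroup U} {f g : List U → ℚ} (hf : Inv H f) (hg : Inv H g) :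
    Inv H (fun l => f l - g l) := fun h hh l => by simp only [hf h hh, hg h hh]

lemma Inv.add {H : Subgroup U} {f g : List U → ℚ} (hf : Inv H f) (hg : Inv H g) :
    Inv H (fun l => f l + g l) := fun h hh l => by simp only [hf h hh, hg h hh]

lemma Inv.smul {H : Subgroup U} (c : ℚ) {f : List U → ℚ} (hf : Inv H f) :
    Inv H (fun l => c * f l) := fun h hh l => by simp only [hf h hh]

lemma Inv.d {H : Subgroup U} {f : List U → ℚ} (hf : Inv H f) : Inv H (d f) := fun h hh l => by
  rw [← d_map]
  exact congrFun (congrArg ListCochain.d (funext fun l' => hf h hh l')) l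

lemma Inv.translate {H : Subgroup U} [H.Normal] {f : List U → ℚ} (hf : Inv H f) (θ : U) :
    Inv H (fun l => f (l.map (θ * ·))) := fun h hh l => by
  simp only [map_mul_map_mul]
  have := hf (θ * h * θ⁻¹) (Subgroup.Normal.conj_mem ‹_› h hh θ) (l.map (θ * ·))
  rw [map_mul_map_mul] at this
  simpa [mul_assoc] using this

/-- Truncation to lists of one length. -/
def trunc (k : ℕ) (f : List U → ℚ) (l : List U) : ℚ := if l.length = k then f l else 0

omit [Group U] in
lemma d_trunc (k : ℕ) (f : List U → ℚ) (l : List U) (hl : l.length = k + 1) :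
    d (trunc k f) l = d f l := d_congr fun l' _ h' => by
  rw [trunc, if_pos (by omega)]

lemma exists_int_sum (φ : ℤ → ℚ) : ∃ S : ℤ → ℚ, ∀ z, S (z + 1) = S z + φ z := by
  refine ⟨fun z => ∑ i ∈ Finset.Ico 0 z, φ i - ∑ i ∈ Finset.Ico z 0, φ i, fun z => ?_⟩
  rcases le_or_gt 0 z with h | h
  · have e : Finset.Ico 0 (z + 1) = insert z (Finset.Ico 0 z) := by
      ext i; simp only [Finset.mem_Ico, Finset.mem_insert]; omega
    beta_reduce
    rw [e, Finset.sum_insert (by simp), Finset.Ico_eq_empty (by omega : ¬ z + 1 < 0),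
      Finset.Ico_eq_empty (by omega : ¬ z < 0)]
    simp [add_comm]
  · have e : Finset.Ico z 0 = insert z (Finset.Ico (z + 1) 0) := by
      ext i; simp only [Finset.mem_Ico, Finset.mem_insert]; omega
    beta_reduce
    rw [e, Finset.sum_insert (by simp), Finset.Ico_eq_empty (by omega),
      Finset.Ico_eq_empty (by omega : ¬ 0 < z)]
    simp

/-- The difference equation for translation by `t` is solvable over a subgroup which is separated
from `t` by an integer-valued function. -/
lemma exists_translate_sub {H' : Subgroup U} [H'.Normal] (t : U) (ζ : U → ℤ)
    (h1 : ∀ h ∈ H', ∀ y, ζ (h * y) = ζ y) (h2 : ∀ y, ζ (t * y) = ζ y + 1)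
    (g : List U → ℚ) (hg : Inv H' g) (hg0 : g [] = 0) :
    ∃ e : List U → ℚ, Inv H' e ∧ e [] = 0 ∧ ∀ l, e (l.map (t * ·)) - e l = g l := by
  choose S hS using exists_int_sum
  refine ⟨fun l => match l with
    | [] => 0
    | y :: l => S (fun i => g ((y :: l).map ((t ^ i * t ^ (-ζ y)) * ·))) (ζ y), ?_, rfl, ?_⟩
  · intro h hh l
    match l with
    | [] => rfl
    | y :: l =>
      simp only [List.map_cons]
      rw [h1 h hh]
      congr 1
      funext i
      have hc := hg _ (Subgroup.Normal.conj_mem ‹_› h hh (t ^ i * t ^ (-ζ y)))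
        ((y :: l).map ((t ^ i * t ^ (-ζ y)) * ·))
      rw [map_mul_map_mul] at hc
      refine Eq.trans ?_ hc
      simp [mul_assoc, Function.comp_def]
  · intro l
    match l with
    | [] => simp [hg0]
    | y :: l =>
      simp only [List.map_cons]
      rw [h2]
      have e : (fun i : ℤ => g (t ^ i * t ^ (-(ζ y + 1)) * (t * y) ::
          (l.map (t * ·)).map (t ^ i * t ^ (-(ζ y + 1)) * ·))) =
          fun i : ℤ => g (t ^ i * t ^ (-ζ y) * y :: l.map (t ^ i * t ^ (-ζ y) * ·)) := by
        funext i
        have : ∀ x : U, t ^ i * t ^ (-(ζ y + 1)) * (t * x) = t ^ i * t ^ (-ζ y) * x := by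
          intro x
          rw [neg_add, zpow_add]
          group
        rw [this, List.map_map]
        congr 2
        exact List.map_congr_left fun x _ => this x
      rw [e, hS]
      simp

/-- The data relating consecutive subgroups of a polycyclic chain. -/
structure Step (H' H : Subgroup U) (t : U) (ζ : U → ℤ) : Prop where
  normal : H'.Normal
  le : H' ≤ H
  mem : t ∈ H
  le_sup : H ≤ H' ⊔ Subgroup.zpowers t
  comm : ∀ θ : U, θ * t * θ⁻¹ * t⁻¹ ∈ H'
  left : ∀ h ∈ H', ∀ y, ζ (h * y) = ζ y
  shift : ∀ y, ζ (t * y) = ζ y + 1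

lemma Step.inv {H' H : Subgroup U} {t : U} {ζ : U → ℤ} (s : Step H' H t ζ) {f : List U → ℚ}
    (hf : Inv H' f) (ht : ∀ l : List U, f (l.map (t * ·)) = f l) : Inv H f := by
  rw [inv_iff] at *
  refine s.le_sup.trans (sup_le hf ?_)
  rw [Subgroup.zpowers_le]
  exact ht

lemma Inv.mono {H' H : Subgroup U} (h : H' ≤ H) {f : List U → ℚ} (hf : Inv H f) : Inv H' f :=
  fun g hg => hf g (h hg)

lemma Inv.trunc {H : Subgroup U} {f : List U → ℚ} (hf : Inv H f) (k : ℕ) : Inv H (trunc k f) :=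
  fun h hh l => by simp only [ListCochain.trunc, List.length_map, hf h hh]

lemma d_translate (f : List U → ℚ) (t : U) (l : List U) :
    d (fun l => f (l.map (t * ·))) l = d f (l.map (t * ·)) := d_map _ _ _

/-- An `H'`-invariant primitive whose translation defect is a coboundary can be made
`H`-invariant. -/
lemma Step.cob {H' H : Subgroup U} {t : U} {ζ : U → ℤ} (s : Step H' H t ζ) {r : ℕ}
    {f b : List U → ℚ} (hb : Inv H' b)
    (hfb : ∀ l, l.length = r + 2 → f l = d b l)
    (hc : Cob H' r (fun l => b (l.map (t * ·)) - b l)) : Cob H (r + 1) f := by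
  have := s.normal
  obtain ⟨e', he', he0, hde⟩ := hc
  obtain ⟨e, he, he0', hte⟩ := exists_translate_sub t ζ s.left s.shift e' he' he0
  refine ⟨ListCochain.trunc (r + 1) (fun l => b l - d e l), s.inv ((hb.sub he.d).trunc _) ?_,
    by simp [ListCochain.trunc], ?_⟩
  · intro l
    simp only [ListCochain.trunc, List.length_map]
    split_ifs with h
    · have h1 := hde l h
      have h2 : d e (l.map (t * ·)) - d e l = d e' l := by
        rw [← d_translate, ← d_sub]
        exact congrFun (congrArg _ (funext hte)) l
      linarith
    · rfl
  · intro l hl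
    rw [d_trunc _ _ _ hl, d_sub]
    have : d (d e) l = 0 := d_d e l
    rw [show d (fun l => d e l) l = 0 from this, hfb l hl, sub_zero]

lemma Step.van {H' H : Subgroup U} {t : U} {ζ : U → ℤ} (s : Step H' H t ζ) {r : ℕ}
    (hv : Van r H') : Van (r + 1) H := by
  have := s.normal
  have key : ∀ {j : ℕ} {f b : List U → ℚ}, Inv H f → 
      (∀ l, l.length = j + 2 → f l = d b l) → Coc j (fun l => b (l.map (t * ·)) - b l) := by
    intro j f b hf hfb l hl
    rw [d_sub, d_translate, ← hfb _ (by simpa using hl), ← hfb _ hl, hf t s.mem, sub_self]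
  refine ⟨fun j hj f hf hcf => ?_, fun θ a ha hca => ?_⟩
  · obtain ⟨j, rfl⟩ : ∃ i, j = i + 1 := ⟨j - 1, by omega⟩
    obtain ⟨b, hb, -, hfb⟩ := hv.1 (j + 1) (by omega) f (hf.mono s.le) hcf
    exact s.cob hb hfb (hv.1 j (by omega) _ ((hb.translate t).sub hb) (key hf hfb))
  · obtain ⟨b, hb, -, hab⟩ := hv.1 (r + 1) (by omega) a (ha.mono s.le) hca
    refine s.cob (b := fun l => b (l.map (θ * ·)) - b l) ((hb.translate θ).sub hb) ?_ ?_
    · intro l hl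
      rw [d_sub, d_translate, hab _ (by simpa using hl), hab _ hl]
    · have h := hv.2 θ _ ((hb.translate t).sub hb) (key ha hab)
      convert h using 2 with l
      simp only [map_mul_map_mul]
      have h3 := hb _ (s.comm θ) (l.map ((t * θ) * ·))
      rw [map_mul_map_mul, show θ * t * θ⁻¹ * t⁻¹ * (t * θ) = θ * t by group] at h3
      rw [h3]
      ring

lemma van_bot : Van 0 (⊥ : Subgroup U) := by
  refine ⟨fun j hj f _ hcf => ⟨trunc j fun l => f (1 :: l), ?_, ?_, ?_⟩, fun θ a _ hca => ?_⟩
  · intro h hh l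
    rw [Subgroup.mem_bot] at hh
    simp [hh]
  · simp [trunc]; omega
  · intro l hl
    rw [d_trunc _ _ _ hl]
    have := hcf (1 :: l) (by simp [hl])
    rw [d_cons] at this
    linarith
  · refine ⟨fun _ => 0, fun _ _ _ => rfl, rfl, fun l hl => ?_⟩
    obtain ⟨x, rfl⟩ := List.length_eq_one_iff.1 hl
    have := hca [x, θ * x] rfl
    simp only [d_cons, d_nil] at this
    rw [d_zero]
    simp only [List.map_cons, List.map_nil]
    linarith

/-- Nonvanishing propagates along a step. -/
lemma Step.not_cob {H' H : Subgroup U} {t : U} {ζ : U → ℤ} (s : Step H' H t ζ) {r : ℕ}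
    (hv : Van r H') {c b c' : List U → ℚ} (hb : Inv H' b)
    (hcb : ∀ l, l.length = r + 2 → c l = d b l) (ε : ℚ) (hε : ε ≠ 0)
    (hbc : ∀ l, l.length = r + 1 → b (l.map (t * ·)) - b l = ε * c' l) (hc' : ¬ Cob H' r c') :
    ¬ Cob H (r + 1) c := by
  rintro ⟨a, ha, -, hca⟩
  have h := hv.2 t (fun l => b l - a l) (hb.sub (ha.mono s.le)) fun l hl => by
    rw [d_sub, ← hcb l hl, ← hca l hl, sub_self]
  obtain ⟨e, he, he0, hde⟩ := h
  refine hc' ⟨fun l => ε⁻¹ * e l, he.smul _, by simp [he0], fun l hl => ?_⟩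
  have h1 := hde l hl
  have h2 := hbc l hl
  simp only [ha t s.mem] at h1
  rw [d_smul, ← h1]
  field_simp
  linarith

end ListCochain

open Matrix

namespace CodimOne

open Classical in
/-- `1` if all entries are positive, `-1` if all are negative, `0` otherwise. -/
noncomputable def signAll {ι : Type*} (v : ι → ℝ) : ℚ :=
  if ∀ i, 0 < v i then 1 else if ∀ i, v i < 0 then -1 else 0

lemma signAll_neg {ι : Type*} [Nonempty ι] (v : ι → ℝ) :
    signAll (fun i => -v i) = -signAll v := by
  have i0 : ι := Classical.arbitrary ι
  simp only [signAll, Left.neg_pos_iff, Left.neg_neg_iff]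
  by_cases h1 : ∀ i, 0 < v i <;> by_cases h2 : ∀ i, v i < 0 <;> simp [h1, h2]
  exact absurd (h1 i0) (not_lt.2 (h2 i0).le)

lemma sum_signAll_eq_zero {N : ℕ} (hN : 2 ≤ N) (ω : Fin N → Fin N → ℝ)
    (hs : ∀ i j, ω j i = -ω i j) (hne : ∀ i j, i ≠ j → ω i j ≠ 0)
    (hP : ∀ j a b c, ω j a * ω b c - ω j b * ω a c + ω a b * ω j c = 0) :
    ∑ j, signAll (fun k : {k // k ≠ j} => ω j k) = 0 := by
  have : Nontrivial (Fin N) := Fin.nontrivial_iff_two_le.2 hN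
  set P : Fin N → Prop := fun j => ∀ k, k ≠ j → 0 < ω j k with hPd
  set M : Fin N → Prop := fun j => ∀ k, k ≠ j → ω j k < 0 with hMd
  have step : ∀ (ω : Fin N → Fin N → ℝ), (∀ i j, ω j i = -ω i j) → (∀ i j, i ≠ j → ω i j ≠ 0) →
      (∀ j a b c, ω j a * ω b c - ω j b * ω a c + ω a b * ω j c = 0) →
      ∀ j, (∀ k, k ≠ j → 0 < ω j k) → ∃ i, ∀ k, k ≠ i → ω i k < 0 := by
    intro ω hs hne hP j hj
    obtain ⟨c, hc⟩ := exists_ne j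
    obtain ⟨i, hi, hmax⟩ := Finset.exists_max_image (Finset.univ.erase j)
      (fun a => ω c a / (ω j c * ω j a)) ⟨c, by simp [hc]⟩
    have hij : i ≠ j := by simpa using hi
    refine ⟨i, fun k hk => lt_of_le_of_ne ?_ (hne _ _ hk.symm)⟩
    by_cases hkj : k = j
    · rw [hkj, hs]; have := hj i hij; linarith
    · have h := hmax k (by simp [hkj])
      have p1 := hj c hc; have p2 := hj i hij; have p3 := hj k hkj
      rw [div_le_div_iff₀ (by positivity) (by positivity)] at h
      have h4 := hP j c i k
      have h5 : ω j c * (ω j c * ω i k) ≤ ω j c * 0 := by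
        have : ω j c * (ω j c * ω i k) = ω j c * (ω j i * ω c k - ω c i * ω j k) := by
          congr 1; linarith
        rw [this]; linarith
      have := le_of_mul_le_mul_left h5 p1
      by_contra hpos
      have := mul_pos p1 (not_le.1 hpos)
      linarith
  have ex : (∃ j, P j) ↔ ∃ j, M j := by
    constructor
    · rintro ⟨j, hj⟩
      exact step ω hs hne hP j hj
    · rintro ⟨j, hj⟩
      obtain ⟨i, hi⟩ := step (fun a b => -ω a b) (fun i j => by rw [hs])
        (fun i j h => neg_ne_zero.2 (hne i j h)) (fun j a b c => by have := hP j a b c; linarith) j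
        (fun k hk => by have := hj k hk; linarith)
      exact ⟨i, fun k hk => by have := hi k hk; linarith⟩
  have uP : ∀ i j, P i → P j → i = j := by
    intro i j hi hj
    by_contra h
    have h1 := hi j (Ne.symm h); have h2 := hj i h; rw [hs] at h2; linarith
  have uM : ∀ i j, M i → M j → i = j := by
    intro i j hi hj
    by_contra h
    have h1 := hi j (Ne.symm h); have h2 := hj i h; rw [hs] at h2; linarith
  have nPM : ∀ i, P i → ¬ M i := by
    intro i hi hm
    obtain ⟨k, hk⟩ := exists_ne i
    have := hi k hk; have := hm k hk; linarith
  classical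
  have e : ∀ j, signAll (fun k : {k // k ≠ j} => ω j k) =
      (if P j then 1 else 0) - (if M j then 1 else 0) := by
    intro j
    have e1 : (∀ k : {k // k ≠ j}, 0 < ω j k) ↔ P j := by simp [hPd]
    have e2 : (∀ k : {k // k ≠ j}, ω j k < 0) ↔ M j := by simp [hMd]
    simp only [signAll, e1, e2]
    by_cases h1 : P j
    · simp [h1, nPM j h1]
    · by_cases h2 : M j <;> simp [h1, h2]
  simp only [e, Finset.sum_sub_distrib]
  by_cases h : ∃ j, P j
  · obtain ⟨i, hi⟩ := h
    obtain ⟨j, hj⟩ := ex.1 ⟨i, hi⟩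
    have e1 : ∀ k, P k ↔ k = i := fun k => ⟨fun h => uP _ _ h hi, fun h => h ▸ hi⟩
    have e2 : ∀ k, M k ↔ k = j := fun k => ⟨fun h => uM _ _ h hj, fun h => h ▸ hj⟩
    simp [e1, e2]
  · have h2 : ¬ ∃ j, M j := fun h' => h (ex.2 h')
    push Not at h h2
    simp [h, h2]

/-- The coefficients of the tautological linear relation between `m + 1` vectors. -/
noncomputable def lam {m : ℕ} (x : Fin (m + 1) → Fin m → ℝ) (i : Fin (m + 1)) : ℝ :=
  (-1) ^ (i : ℕ) * det (of fun a => x (i.succAbove a))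

lemma sum_lam_mul {m : ℕ} (x : Fin (m + 1) → Fin m → ℝ) (c : Fin m) :
    ∑ i, lam x i * x i c = 0 := by
  have h := det_succ_column_zero (of fun i => (Fin.cons (x i c) (x i) : Fin (m + 1) → ℝ))
  rw [det_zero_of_column_eq (i := 0) (j := c.succ) (Fin.succ_ne_zero c).symm
    (fun k => by simp)] at h
  rw [h]
  refine Finset.sum_congr rfl fun i _ => ?_
  simp only [lam, of_apply, Fin.cons_zero]
  rw [mul_assoc, mul_comm (det _), ← mul_assoc]
  congr 1

lemma lam_mulVec {m : ℕ} (A : Matrix (Fin m) (Fin m) ℝ) (x : Fin (m + 1) → Fin m → ℝ)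
    (i : Fin (m + 1)) : lam (fun j => A *ᵥ x j) i = A.det * lam x i := by
  have : (of fun a => A *ᵥ x (i.succAbove a)) = (of fun a => x (i.succAbove a)) * Aᵀ := by
    ext a b
    simp [mul_apply, mulVec, dotProduct, mul_comm]
  simp only [lam]
  rw [this, det_mul, det_transpose]
  ring

/-- The signed complementary minors of `m + 2` vectors. -/
noncomputable def om {m : ℕ} (z : Fin (m + 2) → Fin m → ℝ) (j k : Fin (m + 2)) : ℝ :=
  det (of fun i => (Fin.cons (if i = j then 1 else 0) (Fin.cons (if i = k then 1 else 0) (z i)) :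
    Fin (m + 2) → ℝ))

lemma om_swap {m : ℕ} (z : Fin (m + 2) → Fin m → ℝ) (j k : Fin (m + 2)) :
    om z k j = -om z j k := by
  have h := det_permute' (Equiv.swap (0 : Fin (m + 2)) 1)
    (of fun i => (Fin.cons (if i = j then 1 else 0) (Fin.cons (if i = k then 1 else 0) (z i)) :
    Fin (m + 2) → ℝ))
  rw [Equiv.Perm.sign_swap (by simp)] at h
  simp only [Units.val_neg, Units.val_one, Int.cast_neg, Int.cast_one, neg_mul, one_mul] at h
  rw [om, om, ← h]
  congr 1
  ext i a
  refine Fin.cases ?_ (fun a => Fin.cases ?_ (fun a => ?_) a) a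
  · simp
  · have : (Fin.succ 0 : Fin (m + 2)) = 1 := rfl
    rw [this]
    simp
  · simp only [of_apply, Fin.cons_succ, submatrix_apply, id]
    rw [Equiv.swap_apply_of_ne_of_ne (by simp [Fin.ext_iff]) (by simp [Fin.ext_iff])]
    simp

lemma om_self {m : ℕ} (z : Fin (m + 2) → Fin m → ℝ) (j : Fin (m + 2)) : om z j j = 0 := by
  have := om_swap z j j; linarith

lemma om_succAbove {m : ℕ} (z : Fin (m + 2) → Fin m → ℝ) (j : Fin (m + 2)) (i : Fin (m + 1)) :
    om z j (j.succAbove i) = (-1) ^ (j : ℕ) * lam (fun a => z (j.succAbove a)) i := by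
  rw [om, det_succ_column_zero, Finset.sum_eq_single j]
  · rw [det_succ_column_zero, Finset.sum_eq_single i]
    · simp [lam, submatrix]
    · intro b _ hb
      have : j.succAbove b ≠ j.succAbove i := fun h => hb (Fin.succAbove_right_injective h)
      simp [this]
    · simp
  · intro b _ hb
    simp [hb]
  · simp

lemma sum_om_mul {m : ℕ} (z : Fin (m + 2) → Fin m → ℝ) (j : Fin (m + 2)) (c : Fin m) :
    ∑ k, om z j k * z k c = 0 := by
  rw [Fin.sum_univ_succAbove _ j, om_self, zero_mul, zero_add]
  simp only [om_succAbove, mul_assoc]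
  rw [← Finset.mul_sum, sum_lam_mul (fun a => z (j.succAbove a)) c, mul_zero]

lemma om_pluecker {m : ℕ} (z : Fin (m + 2) → Fin m → ℝ) (hz : ∀ i j, i ≠ j → om z i j ≠ 0)
    (j a b c : Fin (m + 2)) :
    om z j a * om z b c - om z j b * om z a c + om z a b * om z j c = 0 := by
  by_cases hab : a = b
  · subst hab; rw [om_self]; ring
  have h := eq_zero_of_vecMul_eq_zero (hz a b hab)
    (v := fun i => om z j a * om z b i - om z j b * om z a i + om z a b * om z j i) ?_
  · exact congrFun h c
  · ext x
    simp only [vecMul, dotProduct, of_apply, Pi.zero_apply]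
    refine Fin.cases ?_ (fun x => Fin.cases ?_ (fun x => ?_) x) x
    · simp [om_self, om_swap z a b]; rw [om_swap]; ring
    · simp [om_self]; ring
    · simp only [Fin.cons_succ]
      have : ∀ i, (om z j a * om z b i - om z j b * om z a i + om z a b * om z j i) * z i x =
        om z j a * (om z b i * z i x) - om z j b * (om z a i * z i x) +
          om z a b * (om z j i * z i x) := fun i => by ring
      simp only [this, Finset.sum_add_distrib, Finset.sum_sub_distrib, ← Finset.mul_sum,
        sum_om_mul]
      ring

lemma signAll_equiv {ι κ : Type*} (e : ι ≃ κ) (v : κ → ℝ) :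
    signAll (fun i => v (e i)) = signAll v := by
  have h1 : (∀ i, 0 < v (e i)) ↔ ∀ i, 0 < v i := e.forall_congr_right (q := fun i => 0 < v i)
  have h2 : (∀ i, v (e i) < 0) ↔ ∀ i, v i < 0 := e.forall_congr_right (q := fun i => v i < 0)
  simp only [signAll]
  by_cases a : ∀ i, 0 < v i
  · rw [if_pos (h1.2 a), if_pos a]
  · rw [if_neg (mt h1.1 a), if_neg a]
    by_cases b : ∀ i, v i < 0
    · rw [if_pos (h2.2 b), if_pos b]
    · rw [if_neg (mt h2.1 b), if_neg b]

lemma sum_signAll_lam {m : ℕ} (z : Fin (m + 2) → Fin m → ℝ) (hz : ∀ i j, i ≠ j → om z i j ≠ 0) :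
    ∑ j : Fin (m + 2), (-1) ^ (j : ℕ) * signAll (lam fun a => z (j.succAbove a)) = 0 := by
  rw [← sum_signAll_eq_zero (by omega) (om z) (om_swap z) hz (om_pluecker z hz)]
  refine Finset.sum_congr rfl fun j _ => ?_
  rw [← signAll_equiv (finSuccAboveEquiv j)]
  simp only [finSuccAboveEquiv_apply, om_succAbove]
  rcases neg_one_pow_eq_or ℝ (j : ℕ) with h | h
  · have h' : ((-1 : ℚ)) ^ (j : ℕ) = 1 := by
      rcases neg_one_pow_eq_or ℚ (j : ℕ) with h' | h'
      · exact h'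
      · rw [neg_one_pow_eq_one_iff_even (by norm_num)] at h
        exact h.neg_one_pow
    simp only [h, h', one_mul]
  · have h' : ((-1 : ℚ)) ^ (j : ℕ) = -1 := by
      rw [neg_one_pow_eq_neg_one_iff_odd (by norm_num)] at h
      exact h.neg_one_pow
    simp only [h, h', neg_mul, one_mul, signAll_neg]

/-- Vectors of which any `m` are linearly independent. -/
def GenPos {m : ℕ} (L : List (Fin m → ℝ)) : Prop :=
  ∀ l' : List (Fin m → ℝ), l'.Sublist L → l'.length ≤ m → LinearIndependent ℝ l'.get

open Classical in
/-- The simplex cocycle: the signed indicator that the simplex spanned by `m + 1` vectors in an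
`m`-dimensional space contains the origin. -/
noncomputable def simplexSign {m : ℕ} (L : List (Fin m → ℝ)) : ℚ :=
  if h : L.length = m + 1 then signAll (lam fun i => L.get (i.cast h.symm)) else 0

lemma GenPos.sublist {m : ℕ} {L L' : List (Fin m → ℝ)} (h : GenPos L) (h' : L'.Sublist L) :
    GenPos L' := fun l hl => h l (hl.trans h')

lemma GenPos.det_ne_zero {m : ℕ} {L : List (Fin m → ℝ)} (h : GenPos L)
    (e : Fin m ↪o Fin L.length) : det (of fun a => L.get (e a)) ≠ 0 := by
  have h1 := h (List.ofFn fun a => L.get (e a)) ?_ (by simp)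
  · have : LinearIndependent ℝ (fun a => L.get (e a)) := by
      have h2 := h1.comp (Fin.cast (by simp) : Fin m → _) (Fin.cast_injective _)
      convert h2 using 1
      ext a
      simp
    have := (linearIndependent_rows_iff_isUnit (A := of fun a => L.get (e a))).1 this
    exact ((isUnit_iff_isUnit_det _).1 this).ne_zero
  · rw [List.sublist_iff_exists_fin_orderEmbedding_get_eq]
    refine ⟨(Fin.castOrderIso (by simp)).toOrderEmbedding.trans e, fun ix => ?_⟩
    simp
    rfl

lemma d_simplexSign {m : ℕ} (L : List (Fin m → ℝ)) (h : GenPos L) :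
    ListCochain.d simplexSign L = 0 := by
  rw [ListCochain.d_eq_sum]
  by_cases hL : L.length = m + 2
  · rw [hL, Finset.sum_range]
    have := sum_signAll_lam (fun i => L.get (i.cast hL.symm)) ?_
    · rw [← this]
      refine Finset.sum_congr rfl fun j _ => ?_
      congr 1
      have hl : (L.eraseIdx j).length = m + 1 := by
        rw [List.length_eraseIdx_of_lt (by omega), hL]; rfl
      rw [simplexSign, dif_pos hl]
      congr 2
      ext i : 1
      have hv : ((j.succAbove i : Fin _) : ℕ) = if (i : ℕ) < j then (i : ℕ) else i + 1 := by
        simp only [Fin.succAbove, Fin.lt_def, Fin.val_castSucc]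
        split_ifs <;> rfl
      simp only [List.get_eq_getElem, Fin.val_cast, List.getElem_eraseIdx]
      split_ifs with hij
      · rw [if_pos hij] at hv
        exact congrArg L.get (Fin.ext (a := ⟨i, by omega⟩) (b := ⟨_, by omega⟩) hv.symm)
      · rw [if_neg hij] at hv
        exact congrArg L.get (Fin.ext (a := ⟨i + 1, by omega⟩) (b := ⟨_, by omega⟩) hv.symm)
    · intro i j hij
      obtain ⟨k, rfl⟩ := Fin.exists_succAbove_eq hij.symm
      rw [om_succAbove, lam]
      have := h.det_ne_zero (((Fin.succAboveOrderEmb k).trans (Fin.succAboveOrderEmb i)).trans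
        (Fin.castOrderIso hL.symm).toOrderEmbedding)
      simp at this
      simpa using this
  · refine Finset.sum_eq_zero fun j hj => ?_
    have hl : (L.eraseIdx j).length ≠ m + 1 := by
      rw [List.length_eraseIdx_of_lt (by simpa using hj)]
      have := Finset.mem_range.1 hj
      omega
    rw [simplexSign, dif_neg hl, mul_zero]

lemma exists_of_simplexSign_ne_zero {m : ℕ} {L : List (Fin m → ℝ)} (h : simplexSign L ≠ 0) :
    L.length = m + 1 ∧ ∃ α : Fin L.length → ℝ, (∀ i, 0 < α i) ∧
      ∀ c, ∑ i, α i * L.get i c = 0 := by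
  by_cases hL : L.length = m + 1
  · refine ⟨hL, ?_⟩
    rw [simplexSign, dif_pos hL] at h
    have hs := sum_lam_mul (fun i => L.get (i.cast hL.symm))
    have hs' : ∀ c, ∑ i : Fin L.length, lam (fun i => L.get (i.cast hL.symm)) (i.cast hL) *
        L.get i c = 0 := by
      intro c
      rw [← hs c]
      exact Fintype.sum_equiv (finCongr hL) _ _ fun i => by simp
    unfold signAll at h
    split_ifs at h with h1 h2
    · exact ⟨_, fun i => h1 (i.cast hL), hs'⟩
    · refine ⟨fun i => -lam (fun i => L.get (i.cast hL.symm)) (i.cast hL),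
        fun i => neg_pos.2 (h2 (i.cast hL)), fun c => ?_⟩
      simp only [neg_mul, Finset.sum_neg_distrib, hs', neg_zero]
    · exact absurd rfl h
  · rw [simplexSign, dif_neg hL] at h
    exact absurd rfl h

lemma simplexSign_map_mulVec {m : ℕ} (A : Matrix (Fin m) (Fin m) ℝ) (hA : A.det = 1)
    (L : List (Fin m → ℝ)) : simplexSign (L.map (A *ᵥ ·)) = simplexSign L := by
  by_cases hL : L.length = m + 1
  · rw [simplexSign, dif_pos (by simpa using hL), simplexSign, dif_pos hL]
    congr 1
    ext i
    simp only [List.get_eq_getElem, Fin.val_cast, List.getElem_map]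
    rw [lam_mulVec, hA, one_mul]
  · rw [simplexSign, dif_neg (by simpa using hL), simplexSign, dif_neg hL]

lemma signAll_fin_succ {m : ℕ} (v : Fin (m + 1) → ℝ) :
    signAll v = if 0 < v 0 ∧ ∀ i : Fin m, 0 < v i.succ then 1 else
      if v 0 < 0 ∧ ∀ i : Fin m, v i.succ < 0 then -1 else 0 := by
  simp only [signAll, Fin.forall_fin_succ]

lemma lam_cons_single {m : ℕ} (c : ℝ) (x : Fin (m + 1) → Fin (m + 1) → ℝ) (i : Fin (m + 1)) :
    lam (Fin.cons (Pi.single (Fin.last m) c) x) i.succ =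
      c * (-1) ^ (m + 1) * lam (fun j a => x j a.castSucc) i := by
  rw [lam, det_succ_row_zero, Finset.sum_eq_single (Fin.last m)]
  · simp only [lam, of_apply, Fin.succ_succAbove_zero, Fin.cons_zero, Pi.single_eq_same,
      Fin.val_last, Fin.val_succ]
    have : (of fun a => (Fin.cons (Pi.single (Fin.last m) c) x : Fin (m + 2) → Fin (m + 1) → ℝ)
        (i.succ.succAbove a)).submatrix Fin.succ (Fin.last m).succAbove =
        of fun a (b : Fin m) => x (i.succAbove a) b.castSucc := by
      ext a b
      simp [Fin.succ_succAbove_succ]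
    rw [this]
    ring
  · intro b _ hb
    simp [hb]
  · simp

lemma simplexSign_cons_single {m : ℕ} (L : List (Fin (m + 1) → ℝ)) (hL : GenPos L) :
    simplexSign (Pi.single (Fin.last m) 1 :: L) - simplexSign (Pi.single (Fin.last m) (-1) :: L) =
      (-1) ^ (m + 1) * simplexSign (L.map fun v (a : Fin m) => v a.castSucc) := by
  by_cases h : L.length = m + 1
  · have key : ∀ c : ℝ, simplexSign (Pi.single (Fin.last m) c :: L) =
        signAll (lam (Fin.cons (Pi.single (Fin.last m) c) fun i => L.get (i.cast h.symm))) := by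
      intro c
      rw [simplexSign, dif_pos (by simp [h])]
      congr 2
      ext i : 1
      refine Fin.cases ?_ (fun i => ?_) i <;> simp
    have k2 : simplexSign (L.map fun v (a : Fin m) => v a.castSucc) =
        signAll (lam fun i a => L.get (i.cast h.symm) a.castSucc) := by
      rw [simplexSign, dif_pos (by simp [h])]
      congr 2
      ext i : 1
      simp
    rw [key, key, k2]
    have hD := hL.det_ne_zero (Fin.castOrderIso h.symm).toOrderEmbedding
    have h0 : ∀ y : Fin (m + 1) → ℝ, lam (Fin.cons y fun i => L.get (i.cast h.symm)) 0 =
        det (of fun i : Fin (m + 1) => L.get (i.cast h.symm)) := by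
      intro y
      simp [lam]
    have hD' : det (of fun i : Fin (m + 1) => L.get (i.cast h.symm)) ≠ 0 := hD
    set μ := lam fun i a => L.get (i.cast h.symm) (Fin.castSucc a) with hμ
    have hpow : (((-1 : ℝ) ^ (m + 1) = 1 ∧ (-1 : ℚ) ^ (m + 1) = 1)) ∨
        ((-1 : ℝ) ^ (m + 1) = -1 ∧ (-1 : ℚ) ^ (m + 1) = -1) := by
      rcases Nat.even_or_odd (m + 1) with h | h
      · exact Or.inl ⟨h.neg_one_pow, h.neg_one_pow⟩
      · exact Or.inr ⟨h.neg_one_pow, h.neg_one_pow⟩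
    rw [signAll_fin_succ, signAll_fin_succ]
    simp only [lam_cons_single, h0]
    have hcontra : (∀ i, 0 < μ i) → (∀ i, μ i < 0) → False := fun h1 h2 =>
      absurd (h1 0) (not_lt.2 (h2 0).le)
    unfold signAll
    rcases hpow with ⟨e1, e2⟩ | ⟨e1, e2⟩ <;> rw [e1, e2] <;>
      rcases lt_or_gt_of_ne hD' with hd | hd <;>
      simp only [hd, not_lt.2 hd.le, true_and, false_and, if_false, neg_mul, one_mul, neg_neg,
        Left.neg_pos_iff, Left.neg_neg_iff, ← hμ, mul_one, mul_neg] <;>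
      by_cases q1 : ∀ i, 0 < μ i <;> by_cases q2 : ∀ i, μ i < 0 <;>
      simp [q1, q2] <;> exact hcontra q1 q2
  · rw [simplexSign, simplexSign, simplexSign, dif_neg (by simpa using h),
      dif_neg (by simpa using h), dif_neg (by simpa using h)]
    simp

lemma d_simplexSign_cons {m : ℕ} (y : Fin m → ℝ) (L : List (Fin m → ℝ)) (h : GenPos (y :: L)) :
    ListCochain.d (fun l => simplexSign (y :: l)) L = simplexSign L := by
  have := d_simplexSign _ h
  rw [ListCochain.d_cons] at this
  linarith

lemma simplexSign_dim_zero (L : List (Fin 0 → ℝ)) (h : L.length = 1) : simplexSign L = 1 := by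
  rw [simplexSign, dif_pos h]
  simp [signAll, lam]

end CodimOne

open Filter

namespace ListCochain

variable {Θ X Y : Type*}

lemma exists_lim (F : Filter Θ) [F.NeBot] :
    ∃ Lim : (Θ → ℚ) →ₗ[ℚ] ℚ, (∀ f, (∀ᶠ θ in F, f θ = 0) → Lim f = 0) ∧
      ∀ c, Lim (fun _ => c) = c := by
  let N : Submodule ℚ (Θ → ℚ) :=
    { carrier := {f | ∀ᶠ θ in F, f θ = 0}
      add_mem' := fun {f g} hf hg => by
        filter_upwards [hf, hg] with θ h1 h2
        simp [h1, h2]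
      zero_mem' := by simp
      smul_mem' := fun c f hf => by
        filter_upwards [hf] with θ h1
        simp [h1] }
  have h1 : N.mkQ (fun _ => 1) ≠ 0 := by
    intro h
    rw [Submodule.mkQ_apply, Submodule.Quotient.mk_eq_zero] at h
    obtain ⟨θ, hθ⟩ := (show ∀ᶠ θ in F, (1 : ℚ) = 0 from h).exists
    exact one_ne_zero hθ
  obtain ⟨g, hg⟩ := LinearMap.exists_leftInverse_of_injective
    (LinearMap.toSpanSingleton ℚ _ (N.mkQ (fun _ => 1)))
    (LinearMap.ker_toSpanSingleton ℚ h1)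
  have hg1 : g (N.mkQ (fun _ => 1)) = 1 := by
    simpa using LinearMap.congr_fun hg 1
  refine ⟨g ∘ₗ N.mkQ, fun f hf => ?_, fun c => ?_⟩
  · have : N.mkQ f = 0 := by
      rw [Submodule.mkQ_apply, Submodule.Quotient.mk_eq_zero]; exact hf
    simp [this]
  · have : (fun _ : Θ => c) = c • (fun _ => (1 : ℚ)) := by ext; simp
    rw [LinearMap.comp_apply, this, map_smul, map_smul, hg1, smul_eq_mul, mul_one]

section
variable (Lim : (Θ → ℚ) →ₗ[ℚ] ℚ) (Q : Y → Θ → X)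

/-- Iterated averaging of a cochain over perturbations of the vertices. -/
def avg : (List X → ℚ) → List Y → ℚ
  | f, [] => f []
  | f, y :: l => Lim fun θ => avg (fun L => f (Q y θ :: L)) l

lemma avg_sub (f g : List X → ℚ) (l : List Y) :
    avg Lim Q (fun L => f L - g L) l = avg Lim Q f l - avg Lim Q g l := by
  induction l generalizing f g with
  | nil => rfl
  | cons y l ih => simp only [avg, ih]; exact map_sub Lim _ _

lemma avg_smul (c : ℚ) (f : List X → ℚ) (l : List Y) :
    avg Lim Q (fun L => c * f L) l = c * avg Lim Q f l := by
  induction l generalizing f with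
  | nil => rfl
  | cons y l ih => simp only [avg, ih]; exact map_smul Lim c _

lemma avg_const (hL : ∀ c, Lim (fun _ => c) = c) (c : ℚ) (l : List Y) :
    avg Lim Q (fun _ => c) l = c := by
  induction l with
  | nil => rfl
  | cons y l ih => simp only [avg, ih, hL]

lemma d_lim (f : Θ → List Y → ℚ) (l : List Y) :
    d (fun l' => Lim fun θ => f θ l') l = Lim fun θ => d (f θ) l := by
  induction l generalizing f with
  | nil => simp only [d_nil]; exact (map_zero Lim).symm
  | cons y l ih =>
    simp only [d_cons]
    rw [ih (fun θ l' => f θ (y :: l'))]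
    exact (map_sub Lim _ _).symm

lemma avg_d (hL : ∀ c, Lim (fun _ => c) = c) (f : List X → ℚ) (l : List Y) :
    avg Lim Q (d f) l = d (avg Lim Q f) l := by
  induction l generalizing f with
  | nil => rfl
  | cons y l ih =>
    simp only [avg, d_cons, avg_sub, ih]
    rw [d_lim]
    have h := map_sub Lim (fun _ => avg Lim Q f l)
      (fun θ => d (avg Lim Q fun L => f (Q y θ :: L)) l)
    rw [hL] at h
    exact h

lemma avg_map {f : List X → ℚ} (γ : Y → Y) (φ : X → X) (h : ∀ y θ, Q (γ y) θ = φ (Q y θ))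
    (l : List Y) : avg Lim Q f (l.map γ) = avg Lim Q (fun L => f (L.map φ)) l := by
  induction l generalizing f with
  | nil => rfl
  | cons y l ih => simp only [avg, List.map_cons, h, ih]

/-- A property holding for almost every iterated perturbation. -/
def EvAll (F : Filter Θ) : (List X → Prop) → List Y → Prop
  | P, [] => P []
  | P, y :: l => ∀ᶠ θ in F, EvAll F (fun L => P (Q y θ :: L)) l

lemma avg_congr {F : Filter Θ} (hL : ∀ f, (∀ᶠ θ in F, f θ = 0) → Lim f = 0)
    {P : List X → Prop} {f g : List X → ℚ} {l : List Y} (hP : EvAll Q F P l)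
    (h : ∀ L, L.length = l.length → P L → f L = g L) : avg Lim Q f l = avg Lim Q g l := by
  induction l generalizing f g P with
  | nil => exact h [] rfl hP
  | cons y l ih =>
    simp only [avg]
    rw [← sub_eq_zero, ← map_sub]
    refine hL _ ?_
    have : ∀ᶠ θ in F, EvAll Q F (fun L => P (Q y θ :: L)) l := hP
    filter_upwards [this] with θ hθ
    rw [Pi.sub_apply, sub_eq_zero]
    exact ih hθ fun L hl hp => h _ (by simp [hl]) hp

end

end ListCochain

namespace CodimOne

/-! ### Quadratic forms and the action of `SL_n(ℤ)` -/

variable {n : ℕ}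

/-- The value of the bilinear form with Gram matrix `Q`. -/
def bil (Q : Matrix (Fin n) (Fin n) ℝ) (v w : Fin n → ℝ) : ℝ := v ⬝ᵥ Q *ᵥ w

/-- The real matrix underlying an element of `SL_n(ℤ)`. -/
def rl (σ : SpecialLinearGroup (Fin n) ℤ) : Matrix (Fin n) (Fin n) ℝ :=
  (σ : Matrix (Fin n) (Fin n) ℤ).map (Int.cast : ℤ → ℝ)

/-- The action of `SL_n(ℤ)` by change of variables. -/
def act (σ : SpecialLinearGroup (Fin n) ℤ) (Q : Matrix (Fin n) (Fin n) ℝ) :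
    Matrix (Fin n) (Fin n) ℝ := (rl σ)ᵀ * Q * rl σ

lemma rl_one : rl (1 : SpecialLinearGroup (Fin n) ℤ) = 1 := by
  simp [rl]

lemma rl_mul (σ τ : SpecialLinearGroup (Fin n) ℤ) : rl (σ * τ) = rl σ * rl τ := by
  exact Matrix.map_mul (f := Int.castRingHom ℝ)

lemma act_one (Q : Matrix (Fin n) (Fin n) ℝ) : act 1 Q = Q := by
  simp [act, rl_one]

lemma act_mul (σ τ : SpecialLinearGroup (Fin n) ℤ) (Q : Matrix (Fin n) (Fin n) ℝ) :
    act (σ * τ) Q = act τ (act σ Q) := by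
  simp only [act, rl_mul, transpose_mul, Matrix.mul_assoc]

lemma bil_act (σ : SpecialLinearGroup (Fin n) ℤ) (Q : Matrix (Fin n) (Fin n) ℝ)
    (v w : Fin n → ℝ) : bil (act σ Q) v w = bil Q (rl σ *ᵥ v) (rl σ *ᵥ w) := by
  simp only [bil, act, ← mulVec_mulVec]
  rw [dotProduct_mulVec, vecMul_transpose]

lemma bil_add_left (Q : Matrix (Fin n) (Fin n) ℝ) (u v w : Fin n → ℝ) :
    bil Q (u + v) w = bil Q u w + bil Q v w := by simp [bil, add_dotProduct]

lemma bil_add_right (Q : Matrix (Fin n) (Fin n) ℝ) (u v w : Fin n → ℝ) :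
    bil Q w (u + v) = bil Q w u + bil Q w v := by simp [bil, mulVec_add, dotProduct_add]

lemma bil_smul_left (Q : Matrix (Fin n) (Fin n) ℝ) (c : ℝ) (v w : Fin n → ℝ) :
    bil Q (c • v) w = c * bil Q v w := by simp [bil]

lemma bil_smul_right (Q : Matrix (Fin n) (Fin n) ℝ) (c : ℝ) (v w : Fin n → ℝ) :
    bil Q v (c • w) = c * bil Q v w := by simp [bil, mulVec_smul]

lemma bil_comm {Q : Matrix (Fin n) (Fin n) ℝ} (hQ : Qᵀ = Q) (v w : Fin n → ℝ) :
    bil Q v w = bil Q w v := by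
  rw [bil, dotProduct_mulVec, ← mulVec_transpose, hQ, dotProduct_comm]; rfl

lemma bil_single (Q : Matrix (Fin n) (Fin n) ℝ) (a b : Fin n) :
    bil Q (Pi.single a 1) (Pi.single b 1) = Q a b := by
  simp [bil]

lemma bil_sum {k : ℕ} (α : Fin k → ℝ) (Q : Fin k → Matrix (Fin n) (Fin n) ℝ) (v w : Fin n → ℝ) :
    bil (∑ i, α i • Q i) v w = ∑ i, α i * bil (Q i) v w := by
  simp [bil, sum_mulVec, dotProduct_sum, smul_mulVec]

lemma act_apply (σ : SpecialLinearGroup (Fin n) ℤ) (Q : Matrix (Fin n) (Fin n) ℝ) (a b : Fin n) :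
    act σ Q a b = bil Q (rl σ *ᵥ Pi.single a 1) (rl σ *ᵥ Pi.single b 1) := by
  rw [← bil_act, bil_single]

lemma transpose_act (σ : SpecialLinearGroup (Fin n) ℤ) {Q : Matrix (Fin n) (Fin n) ℝ}
    (hQ : Qᵀ = Q) : (act σ Q)ᵀ = act σ Q := by
  simp only [act, transpose_mul, transpose_transpose, hQ, Matrix.mul_assoc]

/-- Symmetric, bounded below by a positive multiple of the squared norm. -/
def Coer (Q : Matrix (Fin n) (Fin n) ℝ) : Prop :=
  Qᵀ = Q ∧ ∃ c : ℝ, 0 < c ∧ ∀ x : Fin n → ℝ, c * ‖x‖ ^ 2 ≤ bil Q x x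

lemma exists_norm_mulVec_le (A : Matrix (Fin n) (Fin n) ℝ) :
    ∃ C : ℝ, 0 < C ∧ ∀ x : Fin n → ℝ, ‖A *ᵥ x‖ ≤ C * ‖x‖ := by
  obtain ⟨C, hC, h⟩ := (LinearMap.toContinuousLinearMap (toLin' A)).bound
  exact ⟨C, hC, fun x => h x⟩

lemma Coer.act {Q : Matrix (Fin n) (Fin n) ℝ} (h : Coer Q)
    (σ : SpecialLinearGroup (Fin n) ℤ) : Coer (act σ Q) := by
  obtain ⟨hs, c, hc, hb⟩ := h
  obtain ⟨C, hC, hCb⟩ := exists_norm_mulVec_le (rl σ⁻¹)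
  refine ⟨transpose_act σ hs, c / C ^ 2, by positivity, fun x => ?_⟩
  rw [bil_act]
  refine le_trans ?_ (hb _)
  have h1 := hCb (rl σ *ᵥ x)
  rw [mulVec_mulVec, ← rl_mul, inv_mul_cancel, rl_one, one_mulVec] at h1
  rw [div_mul_eq_mul_div, div_le_iff₀ (by positivity), mul_assoc]
  refine mul_le_mul_of_nonneg_left ?_ hc.le
  calc ‖x‖ ^ 2 ≤ (C * ‖rl σ *ᵥ x‖) ^ 2 := pow_le_pow_left₀ (norm_nonneg _) h1 2
    _ = _ := by ring

/-- A scale-invariant quantitative form of positive definiteness. -/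
structure Pinch (K : ℝ) (Q : Matrix (Fin n) (Fin n) ℝ) : Prop where
  symm : Qᵀ = Q
  pos : ∀ x : Fin n → ℝ, x ≠ 0 → 0 < bil Q x x
  le : ∀ (x : Fin n → ℝ) (b : Fin n), |bil Q x (Pi.single b 1)| * ‖x‖ ≤ K * bil Q x x

lemma Coer.pinch {Q : Matrix (Fin n) (Fin n) ℝ} (h : Coer Q) : ∃ K, 0 ≤ K ∧ Pinch K Q := by
  obtain ⟨hs, c, hc, hb⟩ := h
  obtain ⟨C, hC, hCb⟩ := exists_norm_mulVec_le Q
  refine ⟨C / c, by positivity, hs, fun x hx => lt_of_lt_of_le ?_ (hb x), fun x b => ?_⟩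
  · have := norm_pos_iff.2 hx
    positivity
  · have e : bil Q x (Pi.single b 1) = (Q *ᵥ x) b := by
      rw [bil_comm hs]; simp [bil]
    have h1 : |bil Q x (Pi.single b 1)| ≤ C * ‖x‖ := by
      rw [e, ← Real.norm_eq_abs]
      exact (norm_le_pi_norm _ b).trans (hCb x)
    rw [div_mul_eq_mul_div, le_div_iff₀ hc]
    calc |bil Q x (Pi.single b 1)| * ‖x‖ * c ≤ (C * ‖x‖) * ‖x‖ * c := by gcongr
      _ = C * (c * ‖x‖ ^ 2) := by ring
      _ ≤ _ := by gcongr; exact hb x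

lemma Pinch.mono {K K' : ℝ} {Q : Matrix (Fin n) (Fin n) ℝ} (h : Pinch K Q) (hK : K ≤ K') :
    Pinch K' Q := by
  refine ⟨h.symm, h.pos, fun x b => (h.le x b).trans ?_⟩
  rcases eq_or_ne x 0 with rfl | hx
  · simp [bil]
  · exact mul_le_mul_of_nonneg_right hK (h.pos x hx).le

lemma exists_pinch (L : List (Matrix (Fin n) (Fin n) ℝ)) (h : ∀ Q ∈ L, Coer Q) :
    ∃ K, 0 ≤ K ∧ ∀ Q ∈ L, Pinch K Q := by
  induction L with
  | nil => exact ⟨0, le_rfl, by simp⟩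
  | cons Q L ih =>
    obtain ⟨K, hK, h1⟩ := ih fun Q hQ => h Q (List.mem_cons_of_mem _ hQ)
    obtain ⟨K', hK', h2⟩ := (h Q List.mem_cons_self).pinch
    refine ⟨max K K', le_max_of_le_left hK, fun R hR => ?_⟩
    rcases List.mem_cons.1 hR with rfl | hR
    · exact h2.mono (le_max_right _ _)
    · exact (h1 R hR).mono (le_max_left _ _)

lemma Pinch.sum {K : ℝ} {k : ℕ} [NeZero k] {α : Fin k → ℝ}
    {Q : Fin k → Matrix (Fin n) (Fin n) ℝ} (hα : ∀ i, 0 < α i) (h : ∀ i, Pinch K (Q i)) :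
    Pinch K (∑ i, α i • Q i) := by
  have : Nonempty (Fin k) := ⟨0⟩
  refine ⟨by simp [transpose_sum, (h _).symm], fun x hx => ?_, fun x b => ?_⟩
  · rw [bil_sum]
    exact Finset.sum_pos (fun i _ => mul_pos (hα i) ((h i).pos x hx)) Finset.univ_nonempty
  · rw [bil_sum, bil_sum, Finset.mul_sum]
    calc _ ≤ (∑ i, |α i * bil (Q i) x (Pi.single b 1)|) * ‖x‖ := by
          gcongr; exact Finset.abs_sum_le_sum_abs _ _
      _ = ∑ i, α i * (|bil (Q i) x (Pi.single b 1)| * ‖x‖) := by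
          rw [Finset.sum_mul]
          exact Finset.sum_congr rfl fun i _ => by rw [abs_mul, abs_of_pos (hα i), mul_assoc]
      _ ≤ ∑ i, α i * (K * bil (Q i) x x) :=
          Finset.sum_le_sum fun i _ => mul_le_mul_of_nonneg_left ((h i).le x b) (hα i).le
      _ = _ := Finset.sum_congr rfl fun i _ => by ring

/-! ### General position -/

lemma GenPos.concat {m : ℕ} {L : List (Fin m → ℝ)} (h : GenPos L) {z : Fin m → ℝ}
    (hz : ∀ l' : List (Fin m → ℝ), l'.Sublist L → l'.length < m →
      z ∉ Submodule.span ℝ (Set.range l'.get)) : GenPos (L ++ [z]) := by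
  intro l hl hlen
  obtain ⟨l1, l2, rfl, h1, h2⟩ := List.sublist_append_iff.1 hl
  rcases List.sublist_singleton.1 h2 with rfl | rfl
  · rw [List.append_nil] at hlen ⊢
    exact h _ h1 hlen
  · rw [List.length_append, List.length_singleton] at hlen
    have h3 := (linearIndependent_finSnoc (K := ℝ) (v := l1.get) (x := z)).2
      ⟨h _ h1 (by omega), hz _ h1 (by omega)⟩
    have h4 := h3.comp (Fin.cast (by simp) : Fin (l1 ++ [z]).length → Fin (l1.length + 1))
      (Fin.cast_injective _)
    have e : (l1 ++ [z]).get = Fin.snoc (α := fun _ => Fin m → ℝ) l1.get z ∘ Fin.cast (by simp) := by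
      ext i : 1
      simp only [List.get_eq_getElem, Function.comp_apply, Fin.snoc, Fin.val_cast]
      split_ifs with hi
      · rw [List.getElem_append_left hi]; rfl
      · have h5 : (l1 ++ [z]).length = l1.length + 1 := by simp
        have hi' : (i : ℕ) = l1.length := by have := i.2; omega
        simp [hi']
    rw [e]
    exact h4

variable [NeZero n]

/-- The off-diagonal part of a column of the translated form. -/
def psi (m ρ : ℕ) (σ : SpecialLinearGroup (Fin n) ℤ) (Q : Matrix (Fin n) (Fin n) ℝ) :
    Fin ρ → ℝ := fun a => act σ Q (Fin.ofNat n a) (Fin.ofNat n m)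

lemma psi_act (m ρ : ℕ) (σ τ : SpecialLinearGroup (Fin n) ℤ) (Q : Matrix (Fin n) (Fin n) ℝ) :
    psi m ρ σ (act τ Q) = psi m ρ (τ * σ) Q := by
  funext a
  simp only [psi]
  rw [act_mul]

/-- Lists of forms to which the cocycles below may be applied. -/
structure Good (L : List (Matrix (Fin n) (Fin n) ℝ)) : Prop where
  coer : ∀ Q ∈ L, Coer Q
  gen : ∀ m ρ, ρ ≤ m → m < n → ∀ σ, GenPos (L.map (psi m ρ σ))
  gen_cons : ∀ m ρ, ρ ≤ m → m < n → ∀ σ, ∀ y : Fin ρ → ℤ, y ≠ 0 →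
    GenPos ((fun a => (y a : ℝ)) :: L.map (psi m ρ σ))

lemma Good.sublist {L L' : List (Matrix (Fin n) (Fin n) ℝ)} (h : Good L) (h' : L'.Sublist L) :
    Good L' :=
  ⟨fun Q hQ => h.coer Q (h'.subset hQ), fun m ρ h1 h2 σ => (h.gen m ρ h1 h2 σ).sublist (h'.map _),
    fun m ρ h1 h2 σ y hy => (h.gen_cons m ρ h1 h2 σ y hy).sublist ((h'.map _).cons_cons _)⟩

lemma Good.map_act {L : List (Matrix (Fin n) (Fin n) ℝ)} (h : Good L)
    (τ : SpecialLinearGroup (Fin n) ℤ) : Good (L.map (act τ)) := by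
  have e : ∀ m ρ σ, (L.map (act τ)).map (psi m ρ σ) = L.map (psi m ρ (τ * σ)) := by
    intro m ρ σ
    rw [List.map_map]
    exact List.map_congr_left fun Q _ => psi_act m ρ σ τ Q
  refine ⟨fun Q hQ => ?_, fun m ρ h1 h2 σ => ?_, fun m ρ h1 h2 σ y hy => ?_⟩
  · obtain ⟨R, hR, rfl⟩ := List.mem_map.1 hQ
    exact (h.coer R hR).act τ
  · rw [e]; exact h.gen m ρ h1 h2 _
  · rw [e]; exact h.gen_cons m ρ h1 h2 _ y hy

lemma genPos_nil {m : ℕ} : GenPos ([] : List (Fin m → ℝ)) := by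
  intro l hl _
  rw [List.sublist_nil.1 hl]
  exact linearIndependent_empty_type (ι := Fin 0)

lemma genPos_singleton {m : ℕ} {y : Fin m → ℝ} (hy : y ≠ 0) : GenPos [y] := by
  refine genPos_nil.concat (z := y) fun l hl _ => ?_
  rw [List.sublist_nil.1 hl]
  have : Set.range ([] : List (Fin m → ℝ)).get = ∅ := Set.range_eq_empty (ι := Fin 0) _
  rw [this, Submodule.span_empty]
  simpa using hy

lemma good_nil : Good ([] : List (Matrix (Fin n) (Fin n) ℝ)) := by
  refine ⟨by simp, fun _ _ _ _ _ => genPos_nil, fun m ρ _ _ _ y hy => genPos_singleton fun h => hy ?_⟩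
  ext a
  simpa using congrFun h a

end CodimOne

namespace CodimOne

/-! ### Generic perturbations of a base form -/

variable {n : ℕ} [NeZero n]

/-- The symmetric perturbation of a form by an arbitrary matrix. -/
def pert (X : Matrix (Fin n) (Fin n) ℝ) (θ : Fin n → Fin n → ℝ) : Matrix (Fin n) (Fin n) ℝ :=
  X + (Matrix.of θ + (Matrix.of θ)ᵀ)

omit [NeZero n] in
lemma act_add (σ : SpecialLinearGroup (Fin n) ℤ) (P Q : Matrix (Fin n) (Fin n) ℝ) :
    act σ (P + Q) = act σ P + act σ Q := by
  simp only [act, Matrix.mul_add, Matrix.add_mul]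

omit [NeZero n] in
lemma act_smul (σ : SpecialLinearGroup (Fin n) ℤ) (c : ℝ) (Q : Matrix (Fin n) (Fin n) ℝ) :
    act σ (c • Q) = c • act σ Q := by
  simp only [act, Matrix.mul_smul, Matrix.smul_mul]

omit [NeZero n] in
lemma act_transpose (σ : SpecialLinearGroup (Fin n) ℤ) (Q : Matrix (Fin n) (Fin n) ℝ) :
    act σ Qᵀ = (act σ Q)ᵀ := by
  simp only [act, transpose_mul, transpose_transpose, Matrix.mul_assoc]

/-- `psi` as a linear map on perturbations. -/
def psiLin (m ρ : ℕ) (σ : SpecialLinearGroup (Fin n) ℤ) :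
    (Fin n → Fin n → ℝ) →ₗ[ℝ] (Fin ρ → ℝ) where
  toFun θ := psi m ρ σ (Matrix.of θ + (Matrix.of θ)ᵀ)
  map_add' θ η := by
    funext a
    simp only [psi, Pi.add_apply]
    have : (Matrix.of (θ + η) + (Matrix.of (θ + η))ᵀ) =
        (Matrix.of θ + (Matrix.of θ)ᵀ) + (Matrix.of η + (Matrix.of η)ᵀ) := by
      ext i j; simp; ring
    rw [this, act_add]; rfl
  map_smul' c θ := by
    funext a
    simp only [psi, Pi.smul_apply, RingHom.id_apply]
    have : (Matrix.of (c • θ) + (Matrix.of (c • θ))ᵀ) = c • (Matrix.of θ + (Matrix.of θ)ᵀ) := by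
      ext i j; simp; ring
    rw [this, act_smul]; rfl

lemma psiLin_surjective {m ρ : ℕ} (hρ : ρ ≤ m) (hm : m < n)
    (σ : SpecialLinearGroup (Fin n) ℤ) : Function.Surjective (psiLin (n := n) m ρ σ) := by
  intro c
  let N : Matrix (Fin n) (Fin n) ℝ := Matrix.of fun i j =>
    if h : (i : ℕ) < ρ ∧ (j : ℕ) = m then c ⟨i, h.1⟩ else 0
  refine ⟨fun i j => act σ⁻¹ N i j, ?_⟩
  funext a
  have e : (Matrix.of fun i j => act σ⁻¹ N i j) = act σ⁻¹ N := rfl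
  show act σ (Matrix.of (fun i j => act σ⁻¹ N i j) + (Matrix.of fun i j => act σ⁻¹ N i j)ᵀ) _ _ = _
  rw [e, ← act_transpose, ← act_add, ← act_mul, inv_mul_cancel, act_one]
  have ha := a.2
  have h1 : (a : ℕ) % n = a := Nat.mod_eq_of_lt (by omega)
  have h2 : m % n = m := Nat.mod_eq_of_lt hm
  have h3 : (a : ℕ) ≠ m := by omega
  simp [N, Fin.ofNat, h1, h2, h3]

lemma ae_psi_notMem {m ρ : ℕ} (hρ : ρ ≤ m) (hm : m < n) (σ : SpecialLinearGroup (Fin n) ℤ)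
    (X : Matrix (Fin n) (Fin n) ℝ) {p : Submodule ℝ (Fin ρ → ℝ)} (hp : p ≠ ⊤) :
    ∀ᵐ θ ∂(MeasureTheory.volume : MeasureTheory.Measure (Fin n → Fin n → ℝ)),
      psi m ρ σ (pert X θ) ∉ p := by
  let f : (Fin n → Fin n → ℝ) →ᵃ[ℝ] (Fin ρ → ℝ) :=
    (psiLin m ρ σ).toAffineMap + AffineMap.const ℝ _ (psi m ρ σ X)
  have hf : ∀ θ, f θ = psi m ρ σ (pert X θ) := by
    intro θ
    funext a
    simp only [psi, pert, act_add]
    show psi m ρ σ _ a + psi m ρ σ X a = _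
    simp only [psi, act_add, Matrix.add_apply]; ring
  have hs : AffineSubspace.comap f p.toAffineSubspace ≠ ⊤ := by
    intro h
    apply hp
    rw [eq_top_iff]
    intro v _
    obtain ⟨θ, hθ⟩ := psiLin_surjective hρ hm σ (v - psi m ρ σ X)
    have h1 : θ ∈ AffineSubspace.comap f p.toAffineSubspace := by rw [h]; trivial
    rw [AffineSubspace.mem_comap] at h1
    have h2 : f θ = v := by
      show psiLin m ρ σ θ + psi m ρ σ X = v
      rw [hθ]; simp
    rw [h2] at h1
    exact h1
  have := MeasureTheory.Measure.addHaar_affineSubspace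
    (MeasureTheory.volume : MeasureTheory.Measure (Fin n → Fin n → ℝ)) _ hs
  rw [MeasureTheory.ae_iff]
  convert this using 2
  ext θ
  simp only [not_not, Set.mem_ofPred_eq, ← hf]
  rfl

/-- The vertex of the arrangement attached to a group element. -/
def vert (X : Matrix (Fin n) (Fin n) ℝ) (g : SpecialLinearGroup (Fin n) ℤ)
    (θ : Fin n → Fin n → ℝ) : Matrix (Fin n) (Fin n) ℝ := act g⁻¹ (pert X θ)

omit [NeZero n] in
lemma vert_mul (X : Matrix (Fin n) (Fin n) ℝ) (γ g : SpecialLinearGroup (Fin n) ℤ)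
    (θ : Fin n → Fin n → ℝ) : vert X (γ * g) θ = act γ⁻¹ (vert X g θ) := by
  rw [vert, vert, _root_.mul_inv_rev, act_mul]

lemma span_ne_top_of_length_lt {m : ℕ} {l : List (Fin m → ℝ)} (h : l.length < m) :
    Submodule.span ℝ (Set.range l.get) ≠ ⊤ := by
  intro ht
  have h1 := finrank_range_le_card (R := ℝ) l.get
  rw [Set.finrank, ht, finrank_top, Module.finrank_fin_fun, Fintype.card_fin] at h1
  omega

lemma ae_genPos_concat {m ρ : ℕ} (hρ : ρ ≤ m) (hm : m < n) (σ : SpecialLinearGroup (Fin n) ℤ)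
    (X : Matrix (Fin n) (Fin n) ℝ) {L : List (Fin ρ → ℝ)} (hL : GenPos L) :
    ∀ᵐ θ ∂(MeasureTheory.volume : MeasureTheory.Measure (Fin n → Fin n → ℝ)),
      GenPos (L ++ [psi m ρ σ (pert X θ)]) := by
  have h : ∀ l ∈ L.sublists.toFinset, ∀ᵐ θ
      ∂(MeasureTheory.volume : MeasureTheory.Measure (Fin n → Fin n → ℝ)), l.length < ρ →
        psi m ρ σ (pert X θ) ∉ Submodule.span ℝ (Set.range l.get) := by
    intro l _
    by_cases h : l.length < ρ
    · filter_upwards [ae_psi_notMem hρ hm σ X (span_ne_top_of_length_lt h)] with θ hθ _ using hθ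
    · exact Filter.Eventually.of_forall fun θ h' => absurd h' h
  have h2 := (Filter.eventually_all_finset _).2 h
  filter_upwards [h2] with θ hθ
  exact hL.concat fun l hl hlen => hθ l (by simpa using hl) hlen

lemma ae_good_concat {X : Matrix (Fin n) (Fin n) ℝ} {L : List (Matrix (Fin n) (Fin n) ℝ)}
    (hL : Good L) (g : SpecialLinearGroup (Fin n) ℤ) :
    ∀ᵐ θ ∂(MeasureTheory.volume : MeasureTheory.Measure (Fin n → Fin n → ℝ)),
      Coer (pert X θ) → Good (L ++ [vert X g θ]) := by
  have : Countable (Matrix (Fin n) (Fin n) ℤ) := inferInstanceAs (Countable (Fin n → Fin n → ℤ))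
  have : Countable (SpecialLinearGroup (Fin n) ℤ) := Subtype.countable
  have h1 : ∀ m ρ (σ : SpecialLinearGroup (Fin n) ℤ), ∀ᵐ θ
      ∂(MeasureTheory.volume : MeasureTheory.Measure (Fin n → Fin n → ℝ)), ρ ≤ m → m < n →
      GenPos (L.map (psi m ρ σ) ++ [psi m ρ (g⁻¹ * σ) (pert X θ)]) := by
    intro m ρ σ
    by_cases h : ρ ≤ m ∧ m < n
    · filter_upwards [ae_genPos_concat h.1 h.2 (g⁻¹ * σ) X (hL.gen m ρ h.1 h.2 σ)]
        with θ hθ _ _ using hθ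
    · exact Filter.Eventually.of_forall fun θ h1 h2 => absurd ⟨h1, h2⟩ h
  have h2 : ∀ m ρ (σ : SpecialLinearGroup (Fin n) ℤ) (y : Fin ρ → ℤ), ∀ᵐ θ
      ∂(MeasureTheory.volume : MeasureTheory.Measure (Fin n → Fin n → ℝ)), ρ ≤ m → m < n → y ≠ 0 →
      GenPos (((fun a => (y a : ℝ)) :: L.map (psi m ρ σ)) ++
        [psi m ρ (g⁻¹ * σ) (pert X θ)]) := by
    intro m ρ σ y
    by_cases h : (ρ ≤ m ∧ m < n) ∧ y ≠ 0
    · filter_upwards [ae_genPos_concat h.1.1 h.1.2 (g⁻¹ * σ) X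
        (hL.gen_cons m ρ h.1.1 h.1.2 σ y h.2)] with θ hθ _ _ _ using hθ
    · exact Filter.Eventually.of_forall fun θ h1 h2 h3 => absurd ⟨⟨h1, h2⟩, h3⟩ h
  simp only [← MeasureTheory.ae_all_iff] at h1 h2
  filter_upwards [h1, h2] with θ h1 h2 hc
  refine ⟨fun Q hQ => ?_, fun m ρ a b σ => ?_, fun m ρ a b σ y hy => ?_⟩
  · rcases List.mem_append.1 hQ with h | h
    · exact hL.coer Q h
    · rw [List.mem_singleton.1 h]; exact hc.act _
  · have := h1 m ρ σ a b
    rwa [← psi_act, ← List.map_singleton (f := psi m ρ σ), ← List.map_append] at this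
  · have := h2 m ρ σ y a b hy
    rwa [← psi_act, List.cons_append, ← List.map_singleton (f := psi m ρ σ),
      ← List.map_append] at this

/-- Almost all parameters in a small ball. -/
noncomputable def smallFilter (n : ℕ) : Filter (Fin n → Fin n → ℝ) :=
  MeasureTheory.ae ((MeasureTheory.volume : MeasureTheory.Measure _).restrict
    (Metric.ball 0 (1 / (8 * (n : ℝ)))))

lemma smallFilter_neBot : (smallFilter n).NeBot := by
  have hn : 0 < (n : ℝ) := by exact_mod_cast Nat.pos_of_ne_zero (NeZero.ne n)
  rw [smallFilter, MeasureTheory.ae_neBot]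
  intro h
  rw [MeasureTheory.Measure.restrict_eq_zero] at h
  exact (Metric.measure_ball_pos _ (0 : Fin n → Fin n → ℝ) (by positivity :
    0 < 1 / (8 * (n : ℝ)))).ne' h

lemma evAll_good {X : Matrix (Fin n) (Fin n) ℝ} {R : Matrix (Fin n) (Fin n) ℝ → Prop}
    (hX : ∀ θ ∈ Metric.ball (0 : Fin n → Fin n → ℝ) (1 / (8 * (n : ℝ))), Coer (pert X θ))
    {l : List (SpecialLinearGroup (Fin n) ℤ)}
    (hR : ∀ g ∈ l, ∀ θ ∈ Metric.ball (0 : Fin n → Fin n → ℝ) (1 / (8 * (n : ℝ))),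
      R (vert X g θ))
    {pre : List (Matrix (Fin n) (Fin n) ℝ)} (hp : Good pre) (hpR : ∀ Q ∈ pre, R Q) :
    ListCochain.EvAll (vert X) (smallFilter n)
      (fun L => Good (pre ++ L) ∧ ∀ Q ∈ pre ++ L, R Q) l := by
  induction l generalizing pre with
  | nil => simpa [ListCochain.EvAll] using ⟨hp, hpR⟩
  | cons g l ih =>
    have h1 : ∀ᶠ θ in smallFilter n, θ ∈ Metric.ball (0 : Fin n → Fin n → ℝ) (1 / (8 * (n : ℝ))) :=
      MeasureTheory.ae_restrict_mem Metric.isOpen_ball.measurableSet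
    have h2 : ∀ᶠ θ in smallFilter n, Coer (pert X θ) → Good (pre ++ [vert X g θ]) :=
      MeasureTheory.ae_restrict_of_ae (ae_good_concat hp g)
    show ∀ᶠ θ in _, _
    filter_upwards [h1, h2] with θ h1 h2
    have := ih (fun g hg => hR g (List.mem_cons_of_mem _ hg)) (h2 (hX θ h1)) (by
      intro Q hQ
      rcases List.mem_append.1 hQ with h | h
      · exact hpR Q h
      · rw [List.mem_singleton.1 h]; exact hR g List.mem_cons_self θ h1)
    simpa only [List.append_assoc, List.singleton_append] using this

end CodimOne

namespace CodimOne

/-! ### Forms with a distinguished pair of short vectors -/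

variable {n : ℕ}

/-- An integer vector, viewed as a real one. -/
def cv (w : Fin n → ℤ) : Fin n → ℝ := fun a => (w a : ℝ)

lemma cv_mulVec (σ : SpecialLinearGroup (Fin n) ℤ) (w : Fin n → ℤ) :
    cv ((σ : Matrix (Fin n) (Fin n) ℤ) *ᵥ w) = rl σ *ᵥ cv w := by
  funext a
  simp [cv, rl, mulVec, dotProduct]

lemma cv_comb (a b : ℤ) (v w : Fin n → ℤ) :
    cv (a • v + b • w) = (a : ℝ) • cv v + (b : ℝ) • cv w := by
  funext i; simp [cv]

/-- The vectors `w₁`, `w₂` form an acute-superbase pair which is shorter than every integer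
vector outside the lattice they span. -/
structure Deep (w₁ w₂ : Fin n → ℤ) (Q : Matrix (Fin n) (Fin n) ℝ) : Prop where
  neg : bil Q (cv w₁) (cv w₂) < 0
  pos_left : 0 < bil Q (cv w₁) (cv w₁) + bil Q (cv w₁) (cv w₂)
  pos_right : 0 < bil Q (cv w₂) (cv w₂) + bil Q (cv w₁) (cv w₂)
  far_left : ∀ y : Fin n → ℤ, (∀ a b : ℤ, y ≠ a • w₁ + b • w₂) →
    bil Q (cv w₁) (cv w₁) < bil Q (cv y) (cv y)
  far_right : ∀ y : Fin n → ℤ, (∀ a b : ℤ, y ≠ a • w₁ + b • w₂) →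
    bil Q (cv w₂) (cv w₂) < bil Q (cv y) (cv y)

lemma bil_act_inv (σ : SpecialLinearGroup (Fin n) ℤ) (Q : Matrix (Fin n) (Fin n) ℝ)
    (v w : Fin n → ℤ) :
    bil (act σ Q) (cv ((σ⁻¹ : SpecialLinearGroup (Fin n) ℤ).1 *ᵥ v))
      (cv ((σ⁻¹ : SpecialLinearGroup (Fin n) ℤ).1 *ᵥ w)) = bil Q (cv v) (cv w) := by
  have h : ∀ v : Fin n → ℤ, rl σ *ᵥ cv ((σ⁻¹ : SpecialLinearGroup (Fin n) ℤ).1 *ᵥ v) = cv v := by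
    intro v
    have := cv_mulVec σ⁻¹ v
    rw [this, mulVec_mulVec, ← rl_mul, mul_inv_cancel, rl_one, one_mulVec]
  rw [bil_act, h, h]

lemma inv_mulVec_mulVec {R : Type*} [CommRing R] (σ : SpecialLinearGroup (Fin n) R)
    (y : Fin n → R) : (σ⁻¹ : SpecialLinearGroup (Fin n) R).1 *ᵥ (σ.1 *ᵥ y) = y := by
  rw [mulVec_mulVec]
  have : (σ⁻¹ : SpecialLinearGroup (Fin n) R).1 * σ.1 = 1 :=
    congrArg Subtype.val (inv_mul_cancel σ)
  rw [this, one_mulVec]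

lemma mulVec_inv_mulVec {R : Type*} [CommRing R] (σ : SpecialLinearGroup (Fin n) R)
    (y : Fin n → R) : σ.1 *ᵥ ((σ⁻¹ : SpecialLinearGroup (Fin n) R).1 *ᵥ y) = y := by
  simpa using inv_mulVec_mulVec σ⁻¹ y

lemma Deep.act {w₁ w₂ : Fin n → ℤ} {Q : Matrix (Fin n) (Fin n) ℝ} (h : Deep w₁ w₂ Q)
    (σ : SpecialLinearGroup (Fin n) ℤ) :
    Deep ((σ⁻¹ : SpecialLinearGroup (Fin n) ℤ).1 *ᵥ w₁)
      ((σ⁻¹ : SpecialLinearGroup (Fin n) ℤ).1 *ᵥ w₂) (act σ Q) := by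
  have key : ∀ y : Fin n → ℤ, (∀ a b : ℤ, y ≠
      a • ((σ⁻¹ : SpecialLinearGroup (Fin n) ℤ).1 *ᵥ w₁) +
      b • ((σ⁻¹ : SpecialLinearGroup (Fin n) ℤ).1 *ᵥ w₂)) →
      ∀ a b : ℤ, σ.1 *ᵥ y ≠ a • w₁ + b • w₂ := by
    intro y hy a b hab
    apply hy a b
    rw [← mulVec_smul, ← mulVec_smul, ← mulVec_add, ← hab, inv_mulVec_mulVec]
  have e : ∀ y : Fin n → ℤ, bil (CodimOne.act σ Q) (cv y) (cv y) =
      bil Q (cv (σ.1 *ᵥ y)) (cv (σ.1 *ᵥ y)) := by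
    intro y
    rw [← bil_act_inv σ Q, inv_mulVec_mulVec]
  refine ⟨?_, ?_, ?_, fun y hy => ?_, fun y hy => ?_⟩
  · rw [bil_act_inv]; exact h.neg
  · rw [bil_act_inv, bil_act_inv]; exact h.pos_left
  · rw [bil_act_inv, bil_act_inv]; exact h.pos_right
  · rw [bil_act_inv, e]; exact h.far_left _ (key y hy)
  · rw [bil_act_inv, e]; exact h.far_right _ (key y hy)

lemma Deep.sum {w₁ w₂ : Fin n → ℤ} {k : ℕ} [NeZero k] {α : Fin k → ℝ}
    {Q : Fin k → Matrix (Fin n) (Fin n) ℝ} (hα : ∀ i, 0 < α i) (h : ∀ i, Deep w₁ w₂ (Q i)) :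
    Deep w₁ w₂ (∑ i, α i • Q i) := by
  have : Nonempty (Fin k) := ⟨0⟩
  refine ⟨?_, ?_, ?_, fun y hy => ?_, fun y hy => ?_⟩
  · rw [bil_sum]
    exact Finset.sum_neg (fun i _ => mul_neg_of_pos_of_neg (hα i) (h i).neg) Finset.univ_nonempty
  · rw [bil_sum, bil_sum, ← Finset.sum_add_distrib]
    refine Finset.sum_pos (fun i _ => ?_) Finset.univ_nonempty
    rw [← mul_add]; exact mul_pos (hα i) (h i).pos_left
  · rw [bil_sum, bil_sum, ← Finset.sum_add_distrib]
    refine Finset.sum_pos (fun i _ => ?_) Finset.univ_nonempty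
    rw [← mul_add]; exact mul_pos (hα i) (h i).pos_right
  · rw [bil_sum, bil_sum]
    exact Finset.sum_lt_sum_of_nonempty Finset.univ_nonempty fun i _ =>
      mul_lt_mul_of_pos_left ((h i).far_left y hy) (hα i)
  · rw [bil_sum, bil_sum]
    exact Finset.sum_lt_sum_of_nonempty Finset.univ_nonempty fun i _ =>
      mul_lt_mul_of_pos_left ((h i).far_right y hy) (hα i)

lemma unimodular_sum_ne_zero {a b c d : ℤ} (h : b * c - a * d = 1) {P R S : ℝ} (hP : 0 < P)
    (hR : 0 < R) (hS : 0 < S) :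
    P * (a * c) + R * (b * d) + S * ((a - b) * (c - d)) ≠ 0 := by
  intro h0
  have main : ∀ x y t : ℤ, x * y = t * (t - 1) → 0 ≤ x → 0 ≤ y →
      P * x + R * y + S * ((x + y - (2 * t - 1) : ℤ) : ℝ) = 0 → False := by
    intro x y t hxy hx hy h0
    have hx' : (0 : ℝ) ≤ P * x := mul_nonneg hP.le (by exact_mod_cast hx)
    have hy' : (0 : ℝ) ≤ R * y := mul_nonneg hR.le (by exact_mod_cast hy)
    rcases le_or_gt 0 (x + y - (2 * t - 1)) with he | he
    · have he' : (0 : ℝ) ≤ S * ((x + y - (2 * t - 1) : ℤ) : ℝ) :=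
        mul_nonneg hS.le (by exact_mod_cast he)
      have e1 : P * (x : ℝ) = 0 := by linarith
      have e2 : R * (y : ℝ) = 0 := by linarith
      have e3 : S * ((x + y - (2 * t - 1) : ℤ) : ℝ) = 0 := by linarith
      have f1 : x = 0 := by exact_mod_cast (mul_eq_zero.1 e1).resolve_left hP.ne'
      have f2 : y = 0 := by exact_mod_cast (mul_eq_zero.1 e2).resolve_left hR.ne'
      have f3 : x + y - (2 * t - 1) = 0 := by
        exact_mod_cast (mul_eq_zero.1 e3).resolve_left hS.ne'
      omega
    · have ht : t ≤ 1 := by nlinarith [sq_nonneg (x - y)]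
      have f1 : x = 0 := by omega
      have f2 : y = 0 := by omega
      rw [f1, f2] at h0 he
      have : S * (((0 : ℤ) + 0 - (2 * t - 1) : ℤ) : ℝ) = 0 := by simpa using h0
      have := (mul_eq_zero.1 this).resolve_left hS.ne'
      have : (0 : ℤ) + 0 - (2 * t - 1) = 0 := by exact_mod_cast this
      omega
  have hxy : (a * c) * (b * d) = (b * c) * (b * c - 1) := by
    have : a * d = b * c - 1 := by linarith
    rw [← this]; ring
  have ht : 0 ≤ (b * c) * (b * c - 1) := by
    rcases le_or_gt (b * c) 0 with h | h
    · exact mul_nonneg_of_nonpos_of_nonpos h (by omega)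
    · exact mul_nonneg h.le (by omega)
  rw [← hxy] at ht
  have hR' : ((a : ℝ) - b) * (c - d) =
      ((a * c + b * d - (2 * (b * c) - 1) : ℤ) : ℝ) := by
    have h' : (b : ℝ) * c - a * d = 1 := by exact_mod_cast h
    push_cast; linarith
  rw [hR'] at h0
  have neg : a * c ≤ 0 → b * d ≤ 0 → False := by
    intro hx hy
    refine main (-(a * c)) (-(b * d)) (1 - b * c) (by linarith) (by omega) (by omega) ?_
    push_cast at h0 ⊢; linarith
  rcases le_total 0 (a * c) with hx | hx <;> rcases le_total 0 (b * d) with hy | hy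
  · exact main _ _ _ hxy hx hy (by push_cast at h0 ⊢; linarith)
  · rcases hx.eq_or_lt with h1 | h1
    · exact neg h1.symm.le hy
    · have : b * d = 0 := le_antisymm hy (nonneg_of_mul_nonneg_right ht h1)
      exact main _ _ _ hxy hx this.symm.le (by push_cast at h0 ⊢; linarith)
  · rcases hy.eq_or_lt with h1 | h1
    · exact neg hx h1.symm.le
    · have : a * c = 0 := le_antisymm hx (nonneg_of_mul_nonneg_left ht h1)
      exact main _ _ _ hxy this.symm.le hy (by push_cast at h0 ⊢; linarith)
  · exact neg hx hy

/-- Short vectors have no component along a basis vector orthogonal to the others. -/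
lemma Deep.eq_zero_of_orthogonal {w₁ w₂ : Fin n → ℤ} {Q : Matrix (Fin n) (Fin n) ℝ}
    (h : Deep w₁ w₂ Q) (hs : Qᵀ = Q) (hpos : ∀ x : Fin n → ℝ, x ≠ 0 → 0 < bil Q x x) (m : Fin n)
    (h₁ : ∀ a, m < a → w₁ a = 0) (h₂ : ∀ a, m < a → w₂ a = 0) (hQ : ∀ a, a < m → Q a m = 0) :
    w₁ m = 0 ∧ w₂ m = 0 := by
  set N := Q m m with hN
  have hb : ∀ w : Fin n → ℤ, (∀ a, m < a → w a = 0) →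
      bil Q (cv w) (cv (Pi.single m 1)) = w m * N := by
    intro w hw
    have : cv (Pi.single m 1 : Fin n → ℤ) = Pi.single m 1 := by
      funext a; simp [cv, Pi.single_apply]
    rw [this]
    simp only [bil, mulVec_single_one]
    rw [dotProduct, Finset.sum_eq_single m]
    · rfl
    · intro a _ ha
      rcases lt_or_gt_of_ne ha with h | h
      · simp [col_apply, hQ a h]
      · simp [cv, hw a h]
    · simp
  have hNb : bil Q (cv (Pi.single m 1)) (cv (Pi.single m 1)) = N := by
    rw [hb _ (fun a ha => by simp [ha.ne'])]; simp
  have hN0 : 0 < N := by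
    rw [← hNb]
    refine hpos _ fun h => ?_
    have := congrFun h m
    simp [cv] at this
  have hle : ∀ w : Fin n → ℤ, (∀ a, m < a → w a = 0) → w m ≠ 0 →
      bil Q (cv (Pi.single m 1)) (cv (Pi.single m 1)) ≤ bil Q (cv w) (cv w) := by
    intro w hw h0
    rw [hNb]
    have h1 : 0 ≤ bil Q (cv w - (w m : ℝ) • cv (Pi.single m 1))
        (cv w - (w m : ℝ) • cv (Pi.single m 1)) := by
      rcases eq_or_ne (cv w - (w m : ℝ) • cv (Pi.single m 1)) 0 with h | h
      · rw [h]; simp [bil]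
      · exact (hpos _ h).le
    rw [sub_eq_add_neg, ← neg_smul, bil_add_left, bil_add_right, bil_add_right, bil_smul_left,
      bil_smul_left, bil_smul_right, bil_smul_right, hNb, bil_comm hs (cv (Pi.single m 1)) (cv w),
      hb w hw] at h1
    have h2 : (1 : ℝ) ≤ (w m : ℝ) ^ 2 := by
      have : (1 : ℤ) ≤ (w m) ^ 2 := by
        have := sq_nonneg (w m); have := pow_ne_zero 2 h0; omega
      exact_mod_cast this
    nlinarith
  by_contra hcon
  have hex : ∃ a b : ℤ, (Pi.single m 1 : Fin n → ℤ) = a • w₁ + b • w₂ := by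
    by_contra hne
    push Not at hne
    by_cases hw : w₁ m = 0
    · exact absurd (h.far_right _ hne) (not_lt.2 (hle _ h₂ fun h => hcon ⟨hw, h⟩))
    · exact absurd (h.far_left _ hne) (not_lt.2 (hle _ h₁ hw))
  obtain ⟨a, b, hab⟩ := hex
  have hdet : b * w₂ m - a * (-w₁ m) = 1 := by
    have := congrFun hab m
    simp at this; linarith
  have hz : bil Q (cv (w₂ m • w₁ + (-w₁ m) • w₂)) (cv (Pi.single m 1)) = 0 := by
    rw [cv_comb, bil_add_left, bil_smul_left, bil_smul_left, hb _ h₁, hb _ h₂]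
    push_cast; ring
  rw [hab, cv_comb, cv_comb, bil_add_left, bil_add_right, bil_add_right] at hz
  simp only [bil_smul_left, bil_smul_right, bil_comm hs (cv w₂) (cv w₁)] at hz
  refine unimodular_sum_ne_zero hdet h.pos_left h.pos_right (neg_pos.2 h.neg) ?_
  push_cast at hz ⊢
  linarith

/-! ### The base form -/

variable [NeZero n]

/-- A form whose two shortest vectors are the first two basis vectors. -/
def baseForm (n : ℕ) [NeZero n] : Matrix (Fin n) (Fin n) ℝ :=
  let w : Fin n → ℝ := Pi.single (Fin.ofNat n 0) 1 - Pi.single (Fin.ofNat n 1) 1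
  diagonal (fun a : Fin n => if (a : ℕ) < 2 then 1 else 10) + vecMulVec w w

lemma transpose_pert_baseForm (θ : Fin n → Fin n → ℝ) :
    (pert (baseForm n) θ)ᵀ = pert (baseForm n) θ := by
  ext i j
  simp only [pert, baseForm, transpose_apply, Matrix.add_apply, of_apply, vecMulVec_apply]
  rw [← transpose_apply (diagonal _), diagonal_transpose]
  ring

lemma bil_baseForm (v : Fin n → ℝ) :
    ∑ a : Fin n, (if (a : ℕ) < 2 then 1 else 10) * v a ^ 2 ≤ bil (baseForm n) v v := by
  have h1 : bil (diagonal (fun a : Fin n => if (a : ℕ) < 2 then (1 : ℝ) else 10)) v v =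
      ∑ a : Fin n, (if (a : ℕ) < 2 then 1 else 10) * v a ^ 2 := by
    simp only [bil, dotProduct, mulVec_diagonal]
    exact Finset.sum_congr rfl fun a _ => by ring
  rw [← h1, baseForm, bil, bil, Matrix.add_mulVec, dotProduct_add, le_add_iff_nonneg_right,
    vecMulVec_mulVec]
  simp only [dotProduct_smul, MulOpposite.smul_eq_mul_unop, MulOpposite.unop_op]
  rw [dotProduct_comm v]
  exact mul_self_nonneg _

lemma abs_bil_pert_le {θ : Fin n → Fin n → ℝ}
    (hθ : θ ∈ Metric.ball (0 : Fin n → Fin n → ℝ) (1 / (8 * (n : ℝ)))) (v : Fin n → ℝ) :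
    |bil (Matrix.of θ + (Matrix.of θ)ᵀ) v v| ≤ (1 / 4) * ∑ a, v a ^ 2 := by
  have hn : 0 < (n : ℝ) := by exact_mod_cast Nat.pos_of_ne_zero (NeZero.ne n)
  have hθ' : ∀ i j, |θ i j| ≤ 1 / (8 * (n : ℝ)) := by
    intro i j
    rw [mem_ball_zero_iff] at hθ
    exact ((norm_le_pi_norm (θ i) j).trans (norm_le_pi_norm θ i)).trans hθ.le
  have e : bil (Matrix.of θ + (Matrix.of θ)ᵀ) v v = ∑ i, ∑ j, v i * ((θ i j + θ j i) * v j) := by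
    simp [bil, dotProduct, mulVec, Finset.mul_sum]
  rw [e]
  calc |∑ i, ∑ j, v i * ((θ i j + θ j i) * v j)|
      ≤ ∑ i, ∑ j, |v i * ((θ i j + θ j i) * v j)| :=
        (Finset.abs_sum_le_sum_abs _ _).trans
          (Finset.sum_le_sum fun i _ => Finset.abs_sum_le_sum_abs _ _)
    _ ≤ ∑ i : Fin n, ∑ j : Fin n, (1 / (8 * (n : ℝ))) * (v i ^ 2 + v j ^ 2) := by
        refine Finset.sum_le_sum fun i _ => Finset.sum_le_sum fun j _ => ?_
        rw [abs_mul, abs_mul]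
        have h1 : |θ i j + θ j i| ≤ 2 * (1 / (8 * (n : ℝ))) :=
          (abs_add_le _ _).trans (by linarith [hθ' i j, hθ' j i])
        have h2 : 0 < 1 / (8 * (n : ℝ)) := by positivity
        calc |v i| * (|θ i j + θ j i| * |v j|) = |θ i j + θ j i| * (|v i| * |v j|) := by ring
          _ ≤ 2 * (1 / (8 * (n : ℝ))) * (|v i| * |v j|) := by gcongr
          _ ≤ _ := by
            have := two_mul_le_add_sq |v i| |v j|
            rw [sq_abs, sq_abs] at this
            nlinarith
    _ = _ := by
        simp only [← Finset.mul_sum, Finset.sum_add_distrib, Finset.sum_const, Finset.card_univ,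
          Fintype.card_fin, nsmul_eq_mul]
        field_simp
        ring

omit [NeZero n] in
lemma bil_add_form (P Q : Matrix (Fin n) (Fin n) ℝ) (v w : Fin n → ℝ) :
    bil (P + Q) v w = bil P v w + bil Q v w := by
  simp [bil, Matrix.add_mulVec, dotProduct_add]

lemma le_bil_pert_baseForm {θ : Fin n → Fin n → ℝ}
    (hθ : θ ∈ Metric.ball (0 : Fin n → Fin n → ℝ) (1 / (8 * (n : ℝ)))) (v : Fin n → ℝ) :
    ∑ a : Fin n, (if (a : ℕ) < 2 then 3 / 4 else 39 / 4) * v a ^ 2 ≤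
      bil (pert (baseForm n) θ) v v := by
  have h1 := bil_baseForm v
  have h2 := neg_le_of_abs_le (abs_bil_pert_le hθ v)
  rw [pert, bil_add_form]
  have : ∑ a : Fin n, (if (a : ℕ) < 2 then (3 / 4 : ℝ) else 39 / 4) * v a ^ 2 =
      ∑ a : Fin n, (if (a : ℕ) < 2 then 1 else 10) * v a ^ 2 - (1 / 4) * ∑ a, v a ^ 2 := by
    rw [Finset.mul_sum, ← Finset.sum_sub_distrib]
    refine Finset.sum_congr rfl fun a _ => ?_
    split_ifs <;> ring
  linarith

lemma coer_pert_baseForm {θ : Fin n → Fin n → ℝ}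
    (hθ : θ ∈ Metric.ball (0 : Fin n → Fin n → ℝ) (1 / (8 * (n : ℝ)))) :
    Coer (pert (baseForm n) θ) := by
  refine ⟨transpose_pert_baseForm θ, 3 / 4, by norm_num, fun x => ?_⟩
  refine le_trans ?_ (le_bil_pert_baseForm hθ x)
  obtain ⟨a, ha⟩ : ∃ a, ‖x‖ = |x a| := by
    obtain ⟨a, -, ha⟩ := Finset.exists_mem_eq_sup Finset.univ Finset.univ_nonempty fun b => ‖x b‖₊
    exact ⟨a, by rw [Pi.norm_def, ha]; simp⟩
  rw [ha, sq_abs]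
  refine le_trans ?_ (Finset.single_le_sum
    (f := fun a : Fin n => (if (a : ℕ) < 2 then (3 / 4 : ℝ) else 39 / 4) * x a ^ 2)
    (fun b _ => ?_) (Finset.mem_univ a))
  · split_ifs <;> nlinarith [sq_nonneg (x a)]
  · split_ifs <;> positivity

lemma deep_pert_baseForm (hn : 2 ≤ n) {θ : Fin n → Fin n → ℝ}
    (hθ : θ ∈ Metric.ball (0 : Fin n → Fin n → ℝ) (1 / (8 * (n : ℝ)))) :
    Deep (Pi.single (Fin.ofNat n 0) 1) (Pi.single (Fin.ofNat n 1) 1) (pert (baseForm n) θ) := by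
  set i₀ := Fin.ofNat n 0 with hi₀
  set i₁ := Fin.ofNat n 1 with hi₁
  have hne : i₀ ≠ i₁ := by
    intro h
    have := congrArg Fin.val h
    simp [hi₀, hi₁, Fin.ofNat, Nat.mod_eq_of_lt (show 1 < n by omega)] at this
  have v0 : (i₀ : ℕ) = 0 := by simp [hi₀, Fin.ofNat]
  have v1 : (i₁ : ℕ) = 1 := by simp [hi₁, Fin.ofNat, Nat.mod_eq_of_lt (show 1 < n by omega)]
  have hn' : (2 : ℝ) ≤ n := by exact_mod_cast hn
  have hθ' : ∀ i j, |θ i j| ≤ 1 / 16 := by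
    intro i j
    rw [mem_ball_zero_iff] at hθ
    refine ((norm_le_pi_norm (θ i) j).trans (norm_le_pi_norm θ i)).trans (hθ.le.trans ?_)
    rw [div_le_div_iff₀ (by positivity) (by norm_num)]; linarith
  have hc : ∀ a : Fin n, cv (Pi.single a 1 : Fin n → ℤ) = Pi.single a 1 := by
    intro a; funext b; simp [cv, Pi.single_apply]
  have hb : ∀ a b : Fin n, bil (pert (baseForm n) θ) (cv (Pi.single a 1)) (cv (Pi.single b 1)) =
      baseForm n a b + (θ a b + θ b a) := by
    intro a b; rw [hc, hc, bil_single]; rfl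
  have bf : ∀ a b, baseForm n a b = diagonal (fun a : Fin n => if (a : ℕ) < 2 then (1 : ℝ) else 10)
      a b + ((Pi.single i₀ 1 - Pi.single i₁ 1 : Fin n → ℝ) a) *
        ((Pi.single i₀ 1 - Pi.single i₁ 1 : Fin n → ℝ) b) := fun _ _ => rfl
  have b01 : baseForm n i₀ i₁ = -1 := by
    rw [bf]; clear_value i₀ i₁; simp [hne, hne.symm]
  have b00 : baseForm n i₀ i₀ = 2 := by
    rw [bf]; clear_value i₀ i₁; simp [hne, v0]; norm_num
  have b11 : baseForm n i₁ i₁ = 2 := by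
    rw [bf]; clear_value i₀ i₁; simp [hne.symm, v1]; norm_num
  have t00 := abs_le.1 (hθ' i₀ i₀)
  have t01 := abs_le.1 (hθ' i₀ i₁)
  have t10 := abs_le.1 (hθ' i₁ i₀)
  have t11 := abs_le.1 (hθ' i₁ i₁)
  have far : ∀ y : Fin n → ℤ,
      (∀ a b : ℤ, y ≠ a • Pi.single i₀ 1 + b • Pi.single i₁ 1) →
      (39 / 4 : ℝ) ≤ bil (pert (baseForm n) θ) (cv y) (cv y) := by
    intro y hy
    refine le_trans ?_ (le_bil_pert_baseForm hθ _)
    obtain ⟨a, ha2, ha⟩ : ∃ a : Fin n, ¬ (a : ℕ) < 2 ∧ y a ≠ 0 := by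
      by_contra hcon
      push Not at hcon
      refine hy (y i₀) (y i₁) ?_
      funext a
      by_cases h0 : a = i₀
      · subst h0; simp [hne]
      · by_cases h1 : a = i₁
        · subst h1; simp [hne.symm]
        · have e0 : (a : ℕ) ≠ 0 := fun h => h0 (Fin.ext (by rw [v0, h]))
          have e1 : (a : ℕ) ≠ 1 := fun h => h1 (Fin.ext (by rw [v1, h]))
          rw [hcon a (by omega)]
          simp [h0, h1]
    refine le_trans ?_ (Finset.single_le_sum
      (f := fun a : Fin n => (if (a : ℕ) < 2 then (3 / 4 : ℝ) else 39 / 4) * cv y a ^ 2)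
      (fun b _ => ?_) (Finset.mem_univ a))
    · rw [if_neg ha2]
      have : (1 : ℤ) ≤ (y a) ^ 2 := by
        have := sq_nonneg (y a); have := pow_ne_zero 2 ha; omega
      have : (1 : ℝ) ≤ cv y a ^ 2 := by simp only [cv]; exact_mod_cast this
      linarith
    · split_ifs <;> positivity
  refine ⟨?_, ?_, ?_, fun y hy => ?_, fun y hy => ?_⟩
  · rw [hb, b01]; linarith
  · rw [hb, hb, b01, b00]; linarith
  · rw [hb, hb, b01, b11]; linarith
  · refine lt_of_lt_of_le ?_ (far y hy)
    rw [hb, b00]; linarith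
  · refine lt_of_lt_of_le ?_ (far y hy)
    rw [hb, b11]; linarith

end CodimOne

namespace ListCochain

variable {ι X : Type*}

/-- Only finitely many members of the family are nonzero on lists with entries from `L`. -/
def LocFin (f : ι → List X → ℚ) (L : List X) : Prop := {i | ∃ L', L' ⊆ L ∧ f i L' ≠ 0}.Finite

lemma LocFin.support {f : ι → List X → ℚ} {L : List X} (h : LocFin f L) {L' : List X}
    (hL' : L' ⊆ L) : (Function.support fun i => f i L').Finite :=
  h.subset fun _ hi => ⟨L', hL', hi⟩

lemma d_finsum {f : ι → List X → ℚ} {L : List X} (h : LocFin f L) :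
    d (fun l => ∑ᶠ i, f i l) L = ∑ᶠ i, d (f i) L := by
  have hfin : {i | ∃ L', L' ⊆ L ∧ f i L' ≠ 0}.Finite := h
  have h1 : ∀ L', L' ⊆ L → ∑ᶠ i, f i L' = ∑ i ∈ hfin.toFinset, f i L' := fun L' hL' =>
    finsum_eq_sum_of_support_subset _ fun i hi => by
      simp only [Set.Finite.coe_toFinset]; exact ⟨L', hL', hi⟩
  have h2 : ∑ᶠ i, d (f i) L = ∑ i ∈ hfin.toFinset, d (f i) L := by
    refine finsum_eq_sum_of_support_subset _ fun i hi => ?_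
    simp only [Set.Finite.coe_toFinset]
    by_contra hcon
    apply hi
    have : ∀ l' : List X, l'.Sublist L → l'.length + 1 = L.length → f i l' = 0 := by
      intro l' hl' _
      by_contra h0
      exact hcon ⟨l', hl'.subset, h0⟩
    exact (d_congr this).trans (d_zero L)
  rw [h2, ← d_sum]
  exact d_congr fun l' hl' _ => h1 l' hl'.subset

lemma LocFin.mono {f g : ι → List X → ℚ} {L : List X} (h : LocFin f L)
    (hg : ∀ i L', L' ⊆ L → f i L' = 0 → g i L' = 0) : LocFin g L :=
  h.subset fun i ⟨L', hL', h0⟩ => ⟨L', hL', fun h => h0 (hg i L' hL' h)⟩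

end ListCochain

namespace CodimOne

/-! ### Sums over cosets -/

section Coset

variable {G : Type*} [Group G]

/-- The sum over left cosets of a right-invariant function. -/
noncomputable def cosetSum (H : Subgroup G) (T : G → ℚ) : ℚ := ∑ᶠ c : G ⧸ H, T c.out

lemma exists_out_eq_mul (H : Subgroup G) (σ : G) : ∃ s ∈ H, (σ : G ⧸ H).out = σ * s := by
  obtain ⟨s, hs⟩ := QuotientGroup.mk_out_eq_mul H σ
  exact ⟨s, s.2, hs⟩

lemma cosetSum_mul_left {H : Subgroup G} {T : G → ℚ} (hT : ∀ σ, ∀ s ∈ H, T (σ * s) = T σ) (g : G) :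
    cosetSum H (fun σ => T (g * σ)) = cosetSum H T := by
  rw [cosetSum, cosetSum, ← finsum_comp_equiv (MulAction.toPerm g) (f := fun c : G ⧸ H => T c.out)]
  refine finsum_congr fun c => ?_
  obtain ⟨s, hs, h⟩ := exists_out_eq_mul H (g * c.out)
  have : (MulAction.toPerm g c : G ⧸ H) = ((g * c.out : G) : G ⧸ H) := by
    conv_lhs => rw [← QuotientGroup.out_eq' c]
    rfl
  rw [this, h, hT _ s hs]

end Coset

/-! ### Block subgroups -/

variable {n : ℕ}

/-- Matrices which are trivial outside of the first `j` rows and columns. -/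
def blockSubgroup (n : ℕ) (R : Type*) [CommRing R] (j : ℕ) :
    Subgroup (SpecialLinearGroup (Fin n) R) where
  carrier := {σ | ∀ b : Fin n, j ≤ b → σ.1 *ᵥ Pi.single b 1 = Pi.single b 1 ∧
    Pi.single b 1 ᵥ* σ.1 = Pi.single b 1}
  one_mem' := fun b _ => ⟨one_mulVec _, vecMul_one _⟩
  mul_mem' := by
    intro σ τ hσ hτ b hb
    constructor
    · show (σ.1 * τ.1) *ᵥ _ = _
      rw [← mulVec_mulVec, (hτ b hb).1, (hσ b hb).1]
    · show _ ᵥ* (σ.1 * τ.1) = _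
      rw [← vecMul_vecMul, (hσ b hb).2, (hτ b hb).2]
  inv_mem' := by
    intro σ hσ b hb
    constructor
    · conv_lhs => rw [← (hσ b hb).1]
      exact inv_mulVec_mulVec σ _
    · conv_lhs => rw [← (hσ b hb).2]
      rw [vecMul_vecMul]
      have : σ.1 * (σ⁻¹).1 = 1 := congrArg Subtype.val (mul_inv_cancel σ)
      rw [this, vecMul_one]

section

variable {R : Type*} [CommRing R] {j : ℕ} {σ : SpecialLinearGroup (Fin n) R}

lemma blockSubgroup_mono {j k : ℕ} (h : j ≤ k) : blockSubgroup n R j ≤ blockSubgroup n R k :=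
  fun _ hσ b hb => hσ b (h.trans hb)

lemma col_of_mem (h : σ ∈ blockSubgroup n R j) {b : Fin n} (hb : j ≤ b) (a : Fin n) :
    σ.1 a b = if a = b then 1 else 0 := by
  have := congrFun (h b hb).1 a
  rwa [mulVec_single_one, col_apply, Pi.single_apply] at this

lemma row_of_mem (h : σ ∈ blockSubgroup n R j) {a : Fin n} (ha : j ≤ a) (b : Fin n) :
    σ.1 a b = if b = a then 1 else 0 := by
  have := congrFun (h a ha).2 b
  rwa [single_one_vecMul, row_apply, Pi.single_apply] at this

lemma mem_blockSubgroup (hc : ∀ b : Fin n, j ≤ b → ∀ a, σ.1 a b = if a = b then 1 else 0)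
    (hr : ∀ a : Fin n, j ≤ a → ∀ b, σ.1 a b = if b = a then 1 else 0) :
    σ ∈ blockSubgroup n R j := by
  refine fun b hb => ⟨?_, ?_⟩
  · funext a
    rw [mulVec_single_one, col_apply, hc b hb, Pi.single_apply]
  · funext a
    rw [single_one_vecMul, row_apply, hr b hb, Pi.single_apply]

lemma mem_blockSubgroup_of_succ {m : Fin n} (h : σ ∈ blockSubgroup n R (m + 1))
    (hc : σ.1 *ᵥ Pi.single m 1 = Pi.single m 1) (hr : Pi.single m 1 ᵥ* σ.1 = Pi.single m 1) :
    σ ∈ blockSubgroup n R m := by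
  intro b hb
  rcases (Fin.le_def.2 hb).eq_or_lt with rfl | hlt
  · exact ⟨hc, hr⟩
  · exact h b hlt

end

lemma mem_blockSubgroup_map {p : ℕ} {j : ℕ} {σ : SpecialLinearGroup (Fin n) ℤ}
    (h : σ ∈ blockSubgroup n ℤ j) :
    SpecialLinearGroup.map (Int.castRingHom (ZMod p)) σ ∈ blockSubgroup n (ZMod p) j := by
  refine mem_blockSubgroup (fun b hb a => ?_) fun a ha b => ?_
  · rw [SpecialLinearGroup.map_apply_coe, RingHom.mapMatrix_apply, Matrix.map_apply,
      col_of_mem h hb]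
    split_ifs <;> simp
  · rw [SpecialLinearGroup.map_apply_coe, RingHom.mapMatrix_apply, Matrix.map_apply,
      row_of_mem h ha]
    split_ifs <;> simp

/-! ### Boundedness of frames -/

lemma Pinch.norm_le {K : ℝ} {q : Matrix (Fin n) (Fin n) ℝ} (hq : Pinch K q) {v : Fin n → ℝ}
    (hv : v ≠ 0) {b : Fin n} (h : bil q v v ≤ |bil q v (Pi.single b 1)|) : ‖v‖ ≤ K := by
  have h1 := hq.pos v hv
  have h2 := hq.le v b
  have h3 : bil q v v * ‖v‖ ≤ bil q v v * K := by
    calc _ ≤ |bil q v (Pi.single b 1)| * ‖v‖ := by gcongr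
      _ ≤ _ := by linarith
  exact le_of_mul_le_mul_left h3 h1

lemma one_le_norm_cv {w : Fin n → ℤ} (hw : w ≠ 0) : 1 ≤ ‖cv w‖ := by
  obtain ⟨a, ha⟩ := Function.ne_iff.1 hw
  refine le_trans ?_ (norm_le_pi_norm (cv w) a)
  rw [Real.norm_eq_abs, cv]
  exact_mod_cast Int.one_le_abs ha

lemma frame_bound {K : ℝ} (hK : 0 ≤ K) {q : Matrix (Fin n) (Fin n) ℝ} (hq : Pinch K q)
    {m : Fin n} {σ : SpecialLinearGroup (Fin n) ℤ} (hσ : σ ∈ blockSubgroup n ℤ (m + 1)) {β : ℝ}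
    (hβ : 0 ≤ β * σ.1 m m) (h0 : β = 0 ∨ (σ.1 m m ≠ 0 ∧ ∃ a < m, σ.1 m a ≠ 0))
    (hrel : ∀ a < m, β * σ.1 m a + act σ q a m = 0) (b : Fin n) :
    |(σ.1 b m : ℝ)| ≤ K + 1 ∧ |((σ⁻¹).1 m b : ℝ)| ≤ K + 1 := by
  have hσi := inv_mem hσ
  have hl : (σ⁻¹).1 * σ.1 = 1 := congrArg Subtype.val (inv_mul_cancel σ)
  have hr : σ.1 * (σ⁻¹).1 = 1 := congrArg Subtype.val (mul_inv_cancel σ)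
  set w : Fin n → ℤ := fun c => σ.1 c m with hw
  have hw0 : w ≠ 0 := by
    intro h
    have h1 := congrFun (congrFun hl m) m
    rw [mul_apply, one_apply_eq, Finset.sum_eq_zero] at h1
    · exact zero_ne_one h1
    · intro c _
      have : σ.1 c m = 0 := congrFun h c
      rw [this, mul_zero]
  have hv0 : cv w ≠ 0 := norm_pos_iff.1 (lt_of_lt_of_le one_pos (one_le_norm_cv hw0))
  have hv1 := one_le_norm_cv hw0
  have hvc : rl σ *ᵥ Pi.single m 1 = cv w := by
    funext c; simp [rl, cv, hw]
  set N := bil q (cv w) (cv w) with hN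
  have hN0 : 0 < N := hq.pos _ hv0
  have hact : ∀ a, act σ q a m = bil q (cv w) (rl σ *ᵥ Pi.single a 1) := by
    intro a; rw [act_apply, hvc, bil_comm hq.symm]
  have hmm : act σ q m m = N := by rw [hact, hvc]
  have key : ∀ b ≤ m, ((σ⁻¹).1 m b : ℝ) * (β * σ.1 m m + N) =
      (if m = b then β else 0) + bil q (cv w) (Pi.single b 1) := by
    intro b hb
    have e1 : (Pi.single b 1 : Fin n → ℝ) =
        ∑ a, ((σ⁻¹).1 a b : ℝ) • (rl σ *ᵥ Pi.single a 1) := by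
      funext c
      have := congrFun (congrFun hr c) b
      rw [mul_apply] at this
      simp only [Finset.sum_apply, Pi.smul_apply, smul_eq_mul, mulVec_single_one, col_apply, rl,
        Matrix.map_apply]
      rw [Pi.single_apply]
      have h2 : ((∑ a, σ.1 c a * (σ⁻¹).1 a b : ℤ) : ℝ) = ((1 : Matrix (Fin n) (Fin n) ℤ) c b : ℤ) := by
        rw [this]
      rw [one_apply] at h2
      push_cast at h2
      rw [← h2]
      exact Finset.sum_congr rfl fun a _ => mul_comm _ _
    have e2 : bil q (cv w) (Pi.single b 1) = ∑ a, ((σ⁻¹).1 a b : ℝ) * act σ q a m := by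
      rw [e1]
      simp only [bil, mulVec_sum, dotProduct_sum, mulVec_smul, dotProduct_smul, smul_eq_mul, hact]
    have e3 : ∑ a, (σ.1 m a : ℝ) * ((σ⁻¹).1 a b : ℝ) = if m = b then 1 else 0 := by
      have := congrFun (congrFun hr m) b
      rw [mul_apply, one_apply] at this
      exact_mod_cast this
    have e4 : ∑ a, (((σ⁻¹).1 a b : ℝ) * act σ q a m + β * ((σ.1 m a : ℝ) * ((σ⁻¹).1 a b : ℝ))) =
        ((σ⁻¹).1 m b : ℝ) * (β * σ.1 m m + N) := by
      rw [Finset.sum_eq_single m]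
      · rw [hmm]; ring
      · intro a _ ha
        rcases lt_or_gt_of_ne ha with h | h
        · have := hrel a h
          linear_combination ((σ⁻¹).1 a b : ℝ) * this
        · rw [row_of_mem hσi (show (m : ℕ) + 1 ≤ a from h), if_neg (hb.trans_lt h).ne]
          simp
      · simp
    rw [← e4, Finset.sum_add_distrib, ← e2, ← Finset.mul_sum, e3]
    split_ifs <;> ring
  have hnorm : ‖cv w‖ ≤ K := by
    by_cases hex : ∃ b < m, (σ⁻¹).1 m b ≠ 0
    · obtain ⟨b, hb, hne⟩ := hex
      have h1 := key b hb.le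
      rw [if_neg hb.ne', zero_add] at h1
      refine hq.norm_le hv0 (b := b) ?_
      rw [← h1, abs_mul, abs_of_pos (by linarith : 0 < β * σ.1 m m + N)]
      have : (1 : ℝ) ≤ |((σ⁻¹).1 m b : ℝ)| := by exact_mod_cast Int.one_le_abs hne
      nlinarith
    · push Not at hex
      have hrow : ∀ a, ((σ⁻¹).1 * σ.1) m a = (σ⁻¹).1 m m * σ.1 m a := by
        intro a
        rw [mul_apply, Finset.sum_eq_single m]
        · intro b _ hb
          rcases lt_or_gt_of_ne hb with h | h
          · rw [hex b h, zero_mul]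
          · rw [col_of_mem hσi (show (m : ℕ) + 1 ≤ b from h), if_neg h.ne, zero_mul]
        · simp
      have h1 : (σ⁻¹).1 m m * σ.1 m m = 1 := by rw [← hrow, hl, one_apply_eq]
      have hne : (σ⁻¹).1 m m ≠ 0 := left_ne_zero_of_mul_eq_one h1
      have hβ0 : β = 0 := h0.resolve_right fun ⟨_, a, ha, hne'⟩ => by
        have := hrow a
        rw [hl, one_apply_ne ha.ne'] at this
        exact mul_ne_zero hne hne' this.symm
      have h2 := key m le_rfl
      rw [hβ0, ite_self, zero_mul, zero_add, zero_add] at h2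
      refine hq.norm_le hv0 (b := m) ?_
      rw [← h2, abs_mul, abs_of_pos hN0]
      have : (1 : ℝ) ≤ |((σ⁻¹).1 m m : ℝ)| := by exact_mod_cast Int.one_le_abs hne
      nlinarith
  refine ⟨?_, ?_⟩
  · have := (norm_le_pi_norm (cv w) b).trans hnorm
    rw [Real.norm_eq_abs, cv, hw] at this
    linarith
  · rcases lt_or_ge m b with h | h
    · rw [col_of_mem hσi (show (m : ℕ) + 1 ≤ b from h), if_neg h.ne]
      simp; linarith
    · have h1 := key b h
      have h2 := hq.le (cv w) b
      have h3 : |bil q (cv w) (Pi.single b 1)| ≤ K * N :=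
        le_trans (le_mul_of_one_le_right (abs_nonneg _) hv1) h2
      have h4 : |β| ≤ β * σ.1 m m := by
        rcases h0 with h0 | ⟨h0, -⟩
        · simp [h0]
        · rw [← abs_of_nonneg hβ, abs_mul]
          refine le_mul_of_one_le_right (abs_nonneg _) ?_
          exact_mod_cast Int.one_le_abs h0
      have h5 : 0 < β * σ.1 m m + N := by linarith
      have h6 : |((σ⁻¹).1 m b : ℝ)| * (β * σ.1 m m + N) ≤ (K + 1) * (β * σ.1 m m + N) := by
        rw [← abs_of_pos h5, ← abs_mul, h1, abs_of_pos h5]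
        have h7 : |(if m = b then β else 0)| ≤ |β| := by
          split_ifs <;> simp
        calc _ ≤ |(if m = b then β else 0)| + |bil q (cv w) (Pi.single b 1)| := abs_add_le _ _
          _ ≤ β * σ.1 m m + K * N := by linarith
          _ ≤ _ := by nlinarith [mul_nonneg hK hβ]
      exact le_of_mul_le_mul_right h6 h5

lemma finite_cosets (m : Fin n) (K : ℝ) :
    {c : SpecialLinearGroup (Fin n) ℤ ⧸ blockSubgroup n ℤ m |
      c.out ∈ blockSubgroup n ℤ (m + 1) ∧
      ∀ b, |(c.out.1 b m : ℝ)| ≤ K ∧ |((c.out⁻¹).1 m b : ℝ)| ≤ K}.Finite := by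
  let φ : SpecialLinearGroup (Fin n) ℤ ⧸ blockSubgroup n ℤ m → (Fin n → ℤ) × (Fin n → ℤ) :=
    fun c => (fun b => c.out.1 b m, fun b => (c.out⁻¹).1 m b)
  have hb : ∀ z : ℤ, |(z : ℝ)| ≤ K → -⌈K⌉ ≤ z ∧ z ≤ ⌈K⌉ := by
    intro z hz
    have h := abs_le.1 (show |z| ≤ ⌈K⌉ by
      have := hz.trans (Int.le_ceil K)
      exact_mod_cast this)
    exact h
  refine Set.Finite.of_finite_image (f := φ) ?_ ?_
  · have hfin := Set.finite_Icc (fun _ => -⌈K⌉ : Fin n → ℤ) fun _ => ⌈K⌉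
    refine (hfin.prod hfin).subset ?_
    rintro _ ⟨c, ⟨-, hc⟩, rfl⟩
    exact ⟨⟨fun b => (hb _ (hc b).1).1, fun b => (hb _ (hc b).1).2⟩,
      ⟨fun b => (hb _ (hc b).2).1, fun b => (hb _ (hc b).2).2⟩⟩
  · rintro c ⟨hc, -⟩ c' ⟨hc', -⟩ h
    rw [← QuotientGroup.out_eq' c, ← QuotientGroup.out_eq' c']
    refine QuotientGroup.eq.2 (mem_blockSubgroup_of_succ (mul_mem (inv_mem hc) hc') ?_ ?_)
    · have h1 : c'.out.1 *ᵥ Pi.single m 1 = c.out.1 *ᵥ Pi.single m 1 := by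
        funext b
        simpa using (congrFun (congrArg Prod.fst h) b).symm
      show (c.out⁻¹.1 * c'.out.1) *ᵥ _ = _
      rw [← mulVec_mulVec, h1]
      exact inv_mulVec_mulVec _ _
    · have h1 : Pi.single m 1 ᵥ* (c.out⁻¹).1 = Pi.single m 1 ᵥ* (c'.out⁻¹).1 := by
        funext b
        rw [single_one_vecMul, single_one_vecMul]
        exact congrFun (congrArg Prod.snd h) b
      have h2 : (c'.out⁻¹).1 * c'.out.1 = 1 := congrArg Subtype.val (inv_mul_cancel c'.out)
      show _ ᵥ* (c.out⁻¹.1 * c'.out.1) = _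
      rw [← vecMul_vecMul, h1, vecMul_vecMul, h2, vecMul_one]

end CodimOne

namespace CodimOne

variable {n : ℕ}

/-- The upper left block. -/
def corner {R : Type*} {m : ℕ} (hm : m ≤ n) (A : Matrix (Fin n) (Fin n) R) : Matrix (Fin m) (Fin m) R :=
  A.submatrix (Fin.castLE hm) (Fin.castLE hm)

lemma det_corner {R : Type*} [CommRing R] {m : ℕ} (hm : m ≤ n) {σ : SpecialLinearGroup (Fin n) R}
    (hσ : σ ∈ blockSubgroup n R m) : (corner hm σ.1).det = 1 := by
  have h := twoBlockTriangular_det σ.1 (fun i : Fin n => (i : ℕ) < m) fun i hi j hj => by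
    rw [row_of_mem hσ (not_lt.1 hi), if_neg]
    rintro rfl; exact hi hj
  have h2 : (toSquareBlockProp σ.1 fun i : Fin n => ¬ (i : ℕ) < m) = 1 := by
    ext i j
    rw [toSquareBlockProp_def, of_apply, col_of_mem hσ (not_lt.1 j.2), one_apply]
    simp [Subtype.ext_iff]
  rw [h2, det_one, mul_one, σ.2] at h
  let e : Fin m ≃ {i : Fin n // (i : ℕ) < m} :=
    ⟨fun a => ⟨Fin.castLE hm a, a.2⟩, fun i => ⟨i.1, i.2⟩, fun a => rfl, fun i => rfl⟩
  rw [← det_submatrix_equiv_self e] at h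
  exact h.symm

lemma sum_block {R : Type*} [CommRing R] {m : ℕ} (hm : m < n) {s : SpecialLinearGroup (Fin n) R}
    (hs : s ∈ blockSubgroup n R m) {S : Type*} [CommRing S] (φ : R →+* S) (f : Fin n → S)
    (a : Fin m) : ∑ b, φ (s.1 b ⟨a, by omega⟩) * f b =
      ∑ b : Fin m, φ (corner hm.le s.1 b a) * f ⟨b, by omega⟩ := by
  symm
  refine Finset.sum_of_injOn (Fin.castLE hm.le) (by intro x _ y _ h; simpa using h) (by simp)
    (fun b _ hb => ?_) fun b _ => rfl
  have hb' : m ≤ b := by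
    by_contra hlt
    exact hb ⟨⟨b, by omega⟩, by simp, rfl⟩
  rw [row_of_mem hs hb', if_neg, map_zero, zero_mul]
  intro h; have := congrArg Fin.val h; simp at this; omega

variable [NeZero n]

lemma ofNat_eq {m : ℕ} (hm : m < n) : Fin.ofNat n m = ⟨m, hm⟩ := Fin.ext (Nat.mod_eq_of_lt hm)

lemma psi_apply {m ρ : ℕ} (hρ : ρ ≤ m) (hm : m < n) (σ : SpecialLinearGroup (Fin n) ℤ)
    (Q : Matrix (Fin n) (Fin n) ℝ) (a : Fin ρ) :
    psi m ρ σ Q a = act σ Q ⟨a, by omega⟩ ⟨m, hm⟩ := by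
  rw [psi, ofNat_eq hm, ofNat_eq (show (a : ℕ) < n by omega)]

lemma psi_sum {m ρ : ℕ} (σ : SpecialLinearGroup (Fin n) ℤ) {k : ℕ} (α : Fin k → ℝ)
    (Q : Fin k → Matrix (Fin n) (Fin n) ℝ) (a : Fin ρ) :
    psi m ρ σ (∑ i, α i • Q i) a = ∑ i, α i * psi m ρ σ (Q i) a := by
  simp only [psi, act_apply, bil_sum]

lemma exists_comb {m ρ : ℕ} {σ : SpecialLinearGroup (Fin n) ℤ} {L : List (Matrix (Fin n) (Fin n) ℝ)}
    (h : simplexSign (L.map (psi m ρ σ)) ≠ 0) :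
    ∃ (k : ℕ) (_ : NeZero k) (α : Fin k → ℝ) (Q : Fin k → Matrix (Fin n) (Fin n) ℝ),
      (∀ i, 0 < α i) ∧ (∀ i, Q i ∈ L) ∧ ∀ a, psi m ρ σ (∑ i, α i • Q i) a = 0 := by
  obtain ⟨hlen, α, hα, h0⟩ := exists_of_simplexSign_ne_zero h
  rw [List.length_map] at hlen
  have hlen' : (L.map (psi m ρ σ)).length = L.length := List.length_map _
  refine ⟨L.length, ⟨by omega⟩, fun i => α (i.cast hlen'.symm), L.get, fun i => hα _,
    fun i => L.get_mem i, fun a => ?_⟩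
  rw [psi_sum, ← h0 a]
  refine Fintype.sum_equiv (finCongr hlen'.symm) _ _ fun i => ?_
  simp

lemma exists_comb_cons {m ρ : ℕ} (hρ : ρ ≠ 0) {y : Fin ρ → ℝ}
    {σ : SpecialLinearGroup (Fin n) ℤ} {L : List (Matrix (Fin n) (Fin n) ℝ)}
    (h : simplexSign (y :: L.map (psi m ρ σ)) ≠ 0) :
    ∃ (k : ℕ) (_ : NeZero k) (α : Fin k → ℝ) (Q : Fin k → Matrix (Fin n) (Fin n) ℝ) (β : ℝ),
      0 < β ∧ (∀ i, 0 < α i) ∧ (∀ i, Q i ∈ L) ∧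
        ∀ a, β * y a + psi m ρ σ (∑ i, α i • Q i) a = 0 := by
  obtain ⟨hlen, α, hα, h0⟩ := exists_of_simplexSign_ne_zero h
  rw [List.length_cons, List.length_map] at hlen
  have hlen' : (y :: L.map (psi m ρ σ)).length = L.length + 1 := by simp
  refine ⟨L.length, ⟨by omega⟩, fun i => α (i.succ.cast hlen'.symm), L.get,
    α ((0 : Fin (L.length + 1)).cast hlen'.symm), hα _, fun i => hα _,
    fun i => L.get_mem i, fun a => ?_⟩
  rw [psi_sum, ← h0 a, ← Equiv.sum_comp (finCongr hlen'.symm), Fin.sum_univ_succ]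
  congr 1
  simp

/-- The normalised off-diagonal part of a row. -/
def bottom (m : ℕ) (σ : SpecialLinearGroup (Fin n) ℤ) : Fin m → ℤ := fun a =>
  Int.sign (σ.1 (Fin.ofNat n m) (Fin.ofNat n m)) * σ.1 (Fin.ofNat n m) (Fin.ofNat n a)

lemma bottom_apply {m : ℕ} (hm : m < n) (σ : SpecialLinearGroup (Fin n) ℤ) (a : Fin m) :
    bottom m σ a = Int.sign (σ.1 ⟨m, hm⟩ ⟨m, hm⟩) * σ.1 ⟨m, hm⟩ ⟨a, by omega⟩ := by
  rw [bottom, ofNat_eq hm, ofNat_eq (show (a : ℕ) < n by omega)]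

lemma finite_frame {L : List (Matrix (Fin n) (Fin n) ℝ)} (hL : ∀ Q ∈ L, Coer Q) {m : ℕ}
    (hm : m < n) :
    {c : SpecialLinearGroup (Fin n) ℤ ⧸ blockSubgroup n ℤ m |
      c.out ∈ blockSubgroup n ℤ (m + 1) ∧
      ∃ L', L' ⊆ L ∧ simplexSign (L'.map (psi m m c.out)) ≠ 0}.Finite := by
  obtain ⟨K, hK, hp⟩ := exists_pinch L hL
  refine (finite_cosets ⟨m, hm⟩ (K + 1)).subset ?_
  rintro c ⟨hc, L', hL', hs⟩
  obtain ⟨k, _, α, Q, hα, hQ, h0⟩ := exists_comb hs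
  refine ⟨hc, frame_bound (β := 0) hK (Pinch.sum hα fun i => hp _ (hL' (hQ i))) hc (by simp)
    (Or.inl rfl) fun a ha => ?_⟩
  have := h0 ⟨a, ha⟩
  rw [psi_apply le_rfl hm] at this
  simpa using this

lemma finite_frame_cons {L : List (Matrix (Fin n) (Fin n) ℝ)} (hL : ∀ Q ∈ L, Coer Q) {m : ℕ}
    (hm : m < n) :
    {c : SpecialLinearGroup (Fin n) ℤ ⧸ blockSubgroup n ℤ m |
      c.out ∈ blockSubgroup n ℤ (m + 1) ∧ bottom m c.out ≠ 0 ∧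
      ∃ L', L' ⊆ L ∧ simplexSign ((fun a => (bottom m c.out a : ℝ)) ::
        L'.map (psi m m c.out)) ≠ 0}.Finite := by
  obtain ⟨K, hK, hp⟩ := exists_pinch L hL
  refine (finite_cosets ⟨m, hm⟩ (K + 1)).subset ?_
  rintro c ⟨hc, hb, L', hL', hs⟩
  obtain ⟨a, ha⟩ := Function.ne_iff.1 hb
  have hm0 : m ≠ 0 := fun h => by subst h; exact a.elim0
  obtain ⟨k, _, α, Q, β, hβ, hα, hQ, h0⟩ := exists_comb_cons hm0 hs
  rw [bottom_apply hm] at ha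
  have h1 := left_ne_zero_of_mul ha
  rw [Ne, Int.sign_eq_zero_iff_zero] at h1
  refine ⟨hc, frame_bound (β := β * Int.sign (c.out.1 ⟨m, hm⟩ ⟨m, hm⟩)) hK
    (Pinch.sum hα fun i => hp _ (hL' (hQ i))) hc ?_
    (Or.inr ⟨h1, ⟨a, by omega⟩, a.2, right_ne_zero_of_mul ha⟩) fun b hb' => ?_⟩
  · rw [mul_assoc]
    refine mul_nonneg hβ.le ?_
    rw [← Int.cast_mul, Int.sign_mul_self_eq_abs]
    positivity
  · have := h0 ⟨b, hb'⟩
    rw [psi_apply le_rfl hm, bottom_apply hm] at this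
    push_cast at this
    linear_combination this

/-! ### The right action of block matrices -/

lemma psi_mul_block {m : ℕ} (hm : m < n) (σ : SpecialLinearGroup (Fin n) ℤ)
    {s : SpecialLinearGroup (Fin n) ℤ} (hs : s ∈ blockSubgroup n ℤ m)
    (Q : Matrix (Fin n) (Fin n) ℝ) :
    psi m m (σ * s) Q = ((corner hm.le s.1).map (Int.castRingHom ℝ))ᵀ *ᵥ psi m m σ Q := by
  funext a
  rw [← psi_act, psi_apply le_rfl hm, act_apply]
  have h1 : rl s *ᵥ Pi.single ⟨m, hm⟩ 1 = Pi.single ⟨m, hm⟩ 1 := by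
    funext b
    rw [mulVec_single_one, col_apply, rl, Matrix.map_apply, col_of_mem hs le_rfl, Pi.single_apply]
    split_ifs <;> simp
  rw [h1]
  have h2 : bil (act σ Q) (rl s *ᵥ Pi.single ⟨a, by omega⟩ 1) (Pi.single ⟨m, hm⟩ 1) =
      ∑ b, Int.castRingHom ℝ (s.1 b ⟨a, by omega⟩) * act σ Q b ⟨m, hm⟩ := by
    rw [bil, mulVec_single_one, mulVec_single_one, dotProduct]
    rfl
  rw [h2, sum_block hm hs, mulVec, dotProduct]
  refine Finset.sum_congr rfl fun b _ => ?_
  rw [psi_apply le_rfl hm]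
  rfl

lemma bottom_mul_block {m : ℕ} (hm : m < n) (σ : SpecialLinearGroup (Fin n) ℤ)
    {s : SpecialLinearGroup (Fin n) ℤ} (hs : s ∈ blockSubgroup n ℤ m) :
    bottom m (σ * s) = (corner hm.le s.1)ᵀ *ᵥ bottom m σ := by
  have hmul : (σ * s).1 = σ.1 * s.1 := rfl
  funext a
  rw [bottom_apply hm, hmul]
  have h1 : (σ.1 * s.1) ⟨m, hm⟩ ⟨m, hm⟩ = σ.1 ⟨m, hm⟩ ⟨m, hm⟩ := by
    rw [mul_apply, Finset.sum_eq_single ⟨m, hm⟩]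
    · rw [col_of_mem hs le_rfl, if_pos rfl, mul_one]
    · intro b _ hb
      rw [col_of_mem hs le_rfl, if_neg hb, mul_zero]
    · simp
  have h2 : (σ.1 * s.1) ⟨m, hm⟩ ⟨a, by omega⟩ =
      ∑ b, RingHom.id ℤ (s.1 b ⟨a, by omega⟩) * σ.1 ⟨m, hm⟩ b := by
    rw [mul_apply]
    exact Finset.sum_congr rfl fun b _ => mul_comm _ _
  rw [h1, h2, sum_block hm hs, mulVec, dotProduct, Finset.mul_sum]
  refine Finset.sum_congr rfl fun b _ => ?_
  rw [bottom_apply hm]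
  simp only [RingHom.id_apply, transpose_apply]
  ring

lemma simplexSign_map_psi_mul {m : ℕ} (hm : m < n) (σ : SpecialLinearGroup (Fin n) ℤ)
    {s : SpecialLinearGroup (Fin n) ℤ} (hs : s ∈ blockSubgroup n ℤ m)
    (L : List (Matrix (Fin n) (Fin n) ℝ)) :
    simplexSign (L.map (psi m m (σ * s))) = simplexSign (L.map (psi m m σ)) := by
  have hdet : (((corner hm.le s.1).map (Int.castRingHom ℝ))ᵀ).det = 1 := by
    rw [det_transpose, ← RingHom.mapMatrix_apply, ← RingHom.map_det, det_corner hm.le hs, map_one]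
  rw [← simplexSign_map_mulVec _ hdet (L.map (psi m m σ)), List.map_map]
  congr 1
  exact List.map_congr_left fun Q _ => psi_mul_block hm σ hs Q

lemma simplexSign_cons_map_psi_mul {m : ℕ} (hm : m < n) (σ : SpecialLinearGroup (Fin n) ℤ)
    {s : SpecialLinearGroup (Fin n) ℤ} (hs : s ∈ blockSubgroup n ℤ m)
    (L : List (Matrix (Fin n) (Fin n) ℝ)) :
    simplexSign ((fun a => (bottom m (σ * s) a : ℝ)) :: L.map (psi m m (σ * s))) =
      simplexSign ((fun a => (bottom m σ a : ℝ)) :: L.map (psi m m σ)) := by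
  have hdet : (((corner hm.le s.1).map (Int.castRingHom ℝ))ᵀ).det = 1 := by
    rw [det_transpose, ← RingHom.mapMatrix_apply, ← RingHom.map_det, det_corner hm.le hs, map_one]
  rw [← simplexSign_map_mulVec _ hdet (_ :: L.map (psi m m σ)), List.map_cons, List.map_map]
  congr 2
  · funext a
    rw [bottom_mul_block hm σ hs]
    simp [mulVec, dotProduct]
  · exact List.map_congr_left fun Q _ => psi_mul_block hm σ hs Q

lemma bottom_mul_block_eq_zero {m : ℕ} (hm : m < n) (σ : SpecialLinearGroup (Fin n) ℤ)
    {s : SpecialLinearGroup (Fin n) ℤ} (hs : s ∈ blockSubgroup n ℤ m) :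
    bottom m (σ * s) = 0 ↔ bottom m σ = 0 := by
  constructor
  · intro h
    have := bottom_mul_block hm (σ * s) (inv_mem hs)
    rwa [h, mulVec_zero, mul_inv_cancel_right] at this
  · intro h
    rw [bottom_mul_block hm σ hs, h, mulVec_zero]

end CodimOne

namespace CodimOne

open ListCochain

variable {n : ℕ}

/-- Reduction modulo `p`. -/
abbrev red (p : ℕ) : SpecialLinearGroup (Fin n) ℤ →* SpecialLinearGroup (Fin n) (ZMod p) :=
  SpecialLinearGroup.map (Int.castRingHom (ZMod p))

lemma red_apply (p : ℕ) (σ : SpecialLinearGroup (Fin n) ℤ) (a b : Fin n) :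
    (red p σ).1 a b = (σ.1 a b : ZMod p) := rfl

lemma red_mem_block {p j : ℕ} {σ : SpecialLinearGroup (Fin n) ℤ} (h : σ ∈ blockSubgroup n ℤ j) :
    red p σ ∈ blockSubgroup n (ZMod p) j := mem_blockSubgroup_map h

lemma map_act_map_act (σ τ : SpecialLinearGroup (Fin n) ℤ) (L : List (Matrix (Fin n) (Fin n) ℝ)) :
    (L.map (act τ)).map (act σ) = L.map (act (τ * σ)) := by
  rw [List.map_map]
  exact List.map_congr_left fun Q _ => (act_mul τ σ Q).symm

lemma exists_block_comb {R : Type*} [CommRing R] {j : ℕ} {σ : SpecialLinearGroup (Fin n) R}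
    (hσ : σ ∈ blockSubgroup n R j) {r : SpecialLinearGroup (Fin n) R}
    (hr : ∀ a : Fin n, (a : ℕ) < j → r.1 *ᵥ Pi.single a 1 = Pi.single a 1) {b : Fin n}
    (hb : (b : ℕ) < j) : r.1 *ᵥ (σ.1 *ᵥ Pi.single b 1) = σ.1 *ᵥ Pi.single b 1 := by
  have h : σ.1 *ᵥ Pi.single b 1 = ∑ a, σ.1 a b • (Pi.single a 1 : Fin n → R) := by
    funext c
    simp [Finset.sum_apply, Pi.single_apply]
  rw [h, mulVec_sum]
  refine Finset.sum_congr rfl fun a _ => ?_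
  rw [mulVec_smul]
  by_cases ha : (a : ℕ) < j
  · rw [hr a ha]
  · rw [row_of_mem hσ (not_lt.1 ha), if_neg (by rintro rfl; exact ha hb), zero_smul, zero_smul]

lemma rl_mulVec_single (σ : SpecialLinearGroup (Fin n) ℤ) (b : Fin n) :
    rl σ *ᵥ Pi.single b 1 = cv (σ.1 *ᵥ Pi.single b 1) := by
  funext a
  simp [rl, cv]

lemma act_apply_congr {σ τ : SpecialLinearGroup (Fin n) ℤ} {a b : Fin n}
    (ha : σ.1 *ᵥ Pi.single a 1 = τ.1 *ᵥ Pi.single a 1)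
    (hb : σ.1 *ᵥ Pi.single b 1 = τ.1 *ᵥ Pi.single b 1) (Q : Matrix (Fin n) (Fin n) ℝ) :
    act σ Q a b = act τ Q a b := by
  simp only [act_apply, rl_mulVec_single, ha, hb]

variable [NeZero n] (p : ℕ)

/-- The summand of the top stage of the cocycle. -/
noncomputable def frameTerm (m : ℕ)
    (e : SpecialLinearGroup (Fin n) (ZMod p) → List (Matrix (Fin n) (Fin n) ℝ) → ℚ)
    (h : SpecialLinearGroup (Fin n) (ZMod p)) (L : List (Matrix (Fin n) (Fin n) ℝ))
    (σ : SpecialLinearGroup (Fin n) ℤ) : ℚ :=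
  open scoped Classical in
  if σ ∈ blockSubgroup n ℤ (m + 1) then
    cup m (fun l => simplexSign (l.map (psi m m σ)))
      (fun l => e ((red p σ)⁻¹ * h) (l.map (act σ))) L
  else 0

/-- The iterated cocycle, before averaging over perturbations. -/
noncomputable def flagCochain : ℕ → SpecialLinearGroup (Fin n) (ZMod p) →
    List (Matrix (Fin n) (Fin n) ℝ) → ℚ
  | 0, h, _ => open scoped Classical in if h ∈ blockSubgroup n (ZMod p) 2 then 1 else 0
  | i + 1, h, L => cosetSum (blockSubgroup n ℤ (i + 2)) (frameTerm p (i + 2) (flagCochain i) h L)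

/-- The degree of `flagCochain`. -/
def flagDegree : ℕ → ℕ
  | 0 => 0
  | i + 1 => flagDegree i + (i + 2)

variable {p}

lemma frameTerm_map_act {m : ℕ}
    {e : SpecialLinearGroup (Fin n) (ZMod p) → List (Matrix (Fin n) (Fin n) ℝ) → ℚ}
    {g : SpecialLinearGroup (Fin n) ℤ} (hg : g ∈ blockSubgroup n ℤ (m + 1))
    (h : SpecialLinearGroup (Fin n) (ZMod p)) (L : List (Matrix (Fin n) (Fin n) ℝ))
    (σ : SpecialLinearGroup (Fin n) ℤ) :
    frameTerm p m e h (L.map (act g)) σ = frameTerm p m e (red p g * h) L (g * σ) := by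
  have hiff : g * σ ∈ blockSubgroup n ℤ (m + 1) ↔ σ ∈ blockSubgroup n ℤ (m + 1) :=
    Subgroup.mul_mem_cancel_left _ hg
  by_cases hσ : σ ∈ blockSubgroup n ℤ (m + 1)
  · rw [frameTerm, frameTerm, if_pos hσ, if_pos (hiff.2 hσ)]
    simp only [cup, ← List.map_take, ← List.map_drop, map_act_map_act]
    congr 2
    · rw [List.map_map]
      exact List.map_congr_left fun Q _ => psi_act _ _ _ _ _
    · have h1 : red p (g * σ) = red p g * red p σ := map_mul _ _ _
      rw [h1]; group
  · rw [frameTerm, frameTerm, if_neg hσ, if_neg (mt hiff.1 hσ)]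

lemma frameTerm_mul {m : ℕ} (hm : m < n)
    {e : SpecialLinearGroup (Fin n) (ZMod p) → List (Matrix (Fin n) (Fin n) ℝ) → ℚ}
    (he : ∀ g ∈ blockSubgroup n ℤ m, ∀ h L, e h (L.map (act g)) = e (red p g * h) L)
    (h : SpecialLinearGroup (Fin n) (ZMod p)) (L : List (Matrix (Fin n) (Fin n) ℝ))
    (σ : SpecialLinearGroup (Fin n) ℤ) {s : SpecialLinearGroup (Fin n) ℤ}
    (hs : s ∈ blockSubgroup n ℤ m) :
    frameTerm p m e h L (σ * s) = frameTerm p m e h L σ := by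
  have hs' : s ∈ blockSubgroup n ℤ (m + 1) := blockSubgroup_mono (Nat.le_succ m) hs
  have hiff : σ * s ∈ blockSubgroup n ℤ (m + 1) ↔ σ ∈ blockSubgroup n ℤ (m + 1) :=
    Subgroup.mul_mem_cancel_right _ hs'
  by_cases hσ : σ ∈ blockSubgroup n ℤ (m + 1)
  · rw [frameTerm, frameTerm, if_pos hσ, if_pos (hiff.2 hσ)]
    simp only [cup, simplexSign_map_psi_mul hm σ hs, ← map_act_map_act]
    have h1 : red p (σ * s) = red p σ * red p s := map_mul _ _ _
    have h2 : red p s * ((red p σ * red p s)⁻¹ * h) = (red p σ)⁻¹ * h := by group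
    rw [he s hs, h1, h2]
  · rw [frameTerm, frameTerm, if_neg hσ, if_neg (mt hiff.1 hσ)]

lemma flagCochain_map_act {i : ℕ} (hi : i + 2 ≤ n) {g : SpecialLinearGroup (Fin n) ℤ}
    (hg : g ∈ blockSubgroup n ℤ (i + 2)) (h : SpecialLinearGroup (Fin n) (ZMod p))
    (L : List (Matrix (Fin n) (Fin n) ℝ)) :
    flagCochain p i h (L.map (act g)) = flagCochain p i (red p g * h) L := by
  induction i generalizing g h L with
  | zero =>
    have hiff : red p g * h ∈ blockSubgroup n (ZMod p) 2 ↔ h ∈ blockSubgroup n (ZMod p) 2 :=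
      Subgroup.mul_mem_cancel_left _ (red_mem_block hg)
    by_cases hh : h ∈ blockSubgroup n (ZMod p) 2
    · rw [flagCochain, flagCochain, if_pos hh, if_pos (hiff.2 hh)]
    · rw [flagCochain, flagCochain, if_neg hh, if_neg (mt hiff.1 hh)]
  | succ i ih =>
    simp only [flagCochain]
    rw [← cosetSum_mul_left (T := frameTerm p (i + 2) (flagCochain p i) (red p g * h) L)
      (fun σ s hs => frameTerm_mul (by omega)
      (fun g hg h L => ih (by omega) hg h L) _ _ σ hs) g]
    congr 1
    funext σ
    exact frameTerm_map_act hg h L σ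

lemma frameTerm_mul_flag {i : ℕ} (hi : i + 2 < n) (h : SpecialLinearGroup (Fin n) (ZMod p))
    (L : List (Matrix (Fin n) (Fin n) ℝ)) (σ : SpecialLinearGroup (Fin n) ℤ)
    {s : SpecialLinearGroup (Fin n) ℤ} (hs : s ∈ blockSubgroup n ℤ (i + 2)) :
    frameTerm p (i + 2) (flagCochain p i) h L (σ * s) =
      frameTerm p (i + 2) (flagCochain p i) h L σ :=
  frameTerm_mul hi (fun _ hg h L => flagCochain_map_act hi.le hg h L) h L σ hs

lemma mem_of_frameTerm_ne_zero {m : ℕ}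
    {e : SpecialLinearGroup (Fin n) (ZMod p) → List (Matrix (Fin n) (Fin n) ℝ) → ℚ}
    {h : SpecialLinearGroup (Fin n) (ZMod p)} {L : List (Matrix (Fin n) (Fin n) ℝ)}
    {σ : SpecialLinearGroup (Fin n) ℤ} (hne : frameTerm p m e h L σ ≠ 0) :
    σ ∈ blockSubgroup n ℤ (m + 1) ∧ simplexSign ((L.take (m + 1)).map (psi m m σ)) ≠ 0 ∧
      e ((red p σ)⁻¹ * h) ((L.drop m).map (act σ)) ≠ 0 := by
  rw [frameTerm] at hne
  split_ifs at hne with hσ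
  · exact ⟨hσ, left_ne_zero_of_mul hne, right_ne_zero_of_mul hne⟩
  · exact absurd rfl hne

lemma locFin_frameTerm {m : ℕ} (hm : m < n)
    (e : SpecialLinearGroup (Fin n) (ZMod p) → List (Matrix (Fin n) (Fin n) ℝ) → ℚ)
    (h : SpecialLinearGroup (Fin n) (ZMod p)) {L : List (Matrix (Fin n) (Fin n) ℝ)}
    (hL : ∀ Q ∈ L, Coer Q) :
    LocFin (fun (c : SpecialLinearGroup (Fin n) ℤ ⧸ blockSubgroup n ℤ m) l =>
      frameTerm p m e h l c.out) L := by
  refine (finite_frame hL hm).subset ?_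
  rintro c ⟨L', hL', hne⟩
  obtain ⟨h1, h2, -⟩ := mem_of_frameTerm_ne_zero hne
  exact ⟨h1, _, fun Q hQ => hL' (List.take_subset _ _ hQ), h2⟩

lemma exists_of_cosetSum_ne_zero {G : Type*} [Group G] {H : Subgroup G} {T : G → ℚ}
    (h : cosetSum H T ≠ 0) : ∃ σ, T σ ≠ 0 := by
  by_contra! hcon
  exact h (finsum_eq_zero_of_forall_eq_zero fun c => hcon _)

lemma d_frameTerm {m k : ℕ} (hm : m < n)
    {e : SpecialLinearGroup (Fin n) (ZMod p) → List (Matrix (Fin n) (Fin n) ℝ) → ℚ}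
    (he : ∀ h L, Good L → L.length = k + 2 → d (e h) L = 0)
    (h : SpecialLinearGroup (Fin n) (ZMod p)) {L : List (Matrix (Fin n) (Fin n) ℝ)}
    (hL : Good L) (hlen : L.length = k + m + 2) (σ : SpecialLinearGroup (Fin n) ℤ) :
    d (fun l => frameTerm p m e h l σ) L = 0 := by
  simp only [frameTerm]
  split_ifs with hσ
  · rw [show (fun l => cup m (fun l => simplexSign (l.map (psi m m σ)))
      (fun l => e ((red p σ)⁻¹ * h) (l.map (act σ))) l) = cup m _ _ from rfl,
      d_cup _ _ _ _ (by omega), d_map, d_map, d_simplexSign _ ?_, he _ _ ?_ ?_]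
    · simp
    · exact (hL.sublist (List.drop_sublist _ _)).map_act σ
    · simp; omega
    · exact (hL.sublist (List.take_sublist _ _)).gen m m le_rfl hm σ
  · exact d_zero L

lemma d_flagCochain {i : ℕ} (hi : i + 2 ≤ n) (h : SpecialLinearGroup (Fin n) (ZMod p))
    {L : List (Matrix (Fin n) (Fin n) ℝ)} (hL : Good L) (hlen : L.length = flagDegree i + 2) :
    d (flagCochain p i h) L = 0 := by
  induction i generalizing h L with
  | zero =>
    match L, hlen with
    | [a, b], _ => simp [d_cons, flagCochain]
  | succ i ih =>
    have e : flagCochain p (i + 1) h = fun l =>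
        ∑ᶠ c : SpecialLinearGroup (Fin n) ℤ ⧸ blockSubgroup n ℤ (i + 2),
          frameTerm p (i + 2) (flagCochain p i) h l c.out := by
      funext l; rfl
    rw [e, d_finsum (locFin_frameTerm (by omega) _ h hL.coer)]
    refine finsum_eq_zero_of_forall_eq_zero fun c => ?_
    exact d_frameTerm (k := flagDegree i) (by omega) (fun h L hL hl => ih (by omega) h hL hl) h hL
      (by rw [hlen, flagDegree]) _

lemma mem_of_flagCochain_ne_zero {i : ℕ} {h : SpecialLinearGroup (Fin n) (ZMod p)}
    {L : List (Matrix (Fin n) (Fin n) ℝ)} (hne : flagCochain p i h L ≠ 0) :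
    h ∈ blockSubgroup n (ZMod p) (i + 2) := by
  induction i generalizing h L with
  | zero =>
    rw [flagCochain] at hne
    by_contra hh
    exact hne (if_neg hh)
  | succ i ih =>
    obtain ⟨σ, hσ⟩ := exists_of_cosetSum_ne_zero hne
    obtain ⟨h1, -, h2⟩ := mem_of_frameTerm_ne_zero hσ
    have := mul_mem (red_mem_block (p := p) h1) (blockSubgroup_mono (Nat.le_succ _) (ih h2))
    rwa [mul_inv_cancel_left] at this

lemma psi_congr {m ρ : ℕ} (hρ : ρ ≤ m) (hm : m < n) {σ τ : SpecialLinearGroup (Fin n) ℤ}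
    (h : ∀ a : Fin n, (a : ℕ) < m + 1 → σ.1 *ᵥ Pi.single a 1 = τ.1 *ᵥ Pi.single a 1)
    (Q : Matrix (Fin n) (Fin n) ℝ) : psi m ρ σ Q = psi m ρ τ Q := by
  funext a
  rw [psi_apply hρ hm, psi_apply hρ hm]
  exact act_apply_congr (h _ (by simp; omega)) (h _ (by simp)) Q

lemma flagCochain_map_act_of_fixes {i : ℕ} (hi : i + 2 ≤ n) {r : SpecialLinearGroup (Fin n) ℤ}
    (hr : ∀ a : Fin n, (a : ℕ) < i + 2 → r.1 *ᵥ Pi.single a 1 = Pi.single a 1)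
    (h : SpecialLinearGroup (Fin n) (ZMod p)) (L : List (Matrix (Fin n) (Fin n) ℝ)) :
    flagCochain p i h (L.map (act r)) = flagCochain p i h L := by
  induction i generalizing r h L with
  | zero => rfl
  | succ i ih =>
    simp only [flagCochain]
    congr 1
    funext σ
    simp only [frameTerm]
    split_ifs with hσ
    · simp only [cup, ← List.map_take, ← List.map_drop]
      congr 1
      · rw [List.map_map]
        congr 1
        refine List.map_congr_left fun Q _ => ?_
        rw [Function.comp_apply, psi_act]
        refine psi_congr le_rfl (by omega) (fun a ha => ?_) Q
        have : (r * σ).1 = r.1 * σ.1 := rfl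
        rw [this, ← mulVec_mulVec, exists_block_comb hσ hr ha]
      · rw [map_act_map_act, show r * σ = σ * (σ⁻¹ * r * σ) by group, ← map_act_map_act]
        refine ih (by omega) (fun a ha => ?_) _ _
        have : (σ⁻¹ * r * σ).1 = σ⁻¹.1 * r.1 * σ.1 := rfl
        rw [this, ← mulVec_mulVec, ← mulVec_mulVec,
          exists_block_comb hσ hr (show (a : ℕ) < i + 1 + 2 by omega), inv_mulVec_mulVec]
    · rfl

end CodimOne

namespace CodimOne

open ListCochain

variable {n p : ℕ}

/-- Reduction of a vector modulo `p`. -/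
def rv (p : ℕ) (w : Fin n → ℤ) : Fin n → ZMod p := fun a => (w a : ZMod p)

lemma rv_mulVec (σ : SpecialLinearGroup (Fin n) ℤ) (w : Fin n → ℤ) :
    rv p (σ.1 *ᵥ w) = (red p σ).1 *ᵥ rv p w := by
  funext a
  simp [rv, mulVec, dotProduct, red_apply]

lemma mulVec_eq_zero_of_mem {R : Type*} [CommRing R] {j : ℕ} {σ : SpecialLinearGroup (Fin n) R}
    (hσ : σ ∈ blockSubgroup n R j) {w : Fin n → R} (hw : ∀ a : Fin n, j ≤ a → w a = 0) :
    ∀ a : Fin n, j ≤ a → (σ.1 *ᵥ w) a = 0 := by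
  intro a ha
  rw [mulVec, dotProduct, Finset.sum_eq_single a]
  · rw [hw a ha, mul_zero]
  · intro b _ hb
    rw [row_of_mem hσ ha, if_neg hb, zero_mul]
  · simp

variable [NeZero n]

lemma flagCochain_mismatch {i : ℕ} (hi : i + 2 ≤ n) {h : SpecialLinearGroup (Fin n) (ZMod p)}
    {L : List (Matrix (Fin n) (Fin n) ℝ)} (hL : ∀ Q ∈ L, Coer Q) {w₁ w₂ : Fin n → ℤ}
    (hD : ∀ Q ∈ L, Deep w₁ w₂ Q) (h₁ : ∀ a : Fin n, i + 2 ≤ a → w₁ a = 0)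
    (h₂ : ∀ a : Fin n, i + 2 ≤ a → w₂ a = 0) (hne : flagCochain p i h L ≠ 0) :
    (∀ a : Fin n, 2 ≤ (a : ℕ) → (h⁻¹.1 *ᵥ rv p w₁) a = 0) ∧
      ∀ a : Fin n, 2 ≤ (a : ℕ) → (h⁻¹.1 *ᵥ rv p w₂) a = 0 := by
  induction i generalizing h L w₁ w₂ with
  | zero =>
    have hh := inv_mem (mem_of_flagCochain_ne_zero hne)
    exact ⟨mulVec_eq_zero_of_mem hh fun a ha => by simp [rv, h₁ a ha],
      mulVec_eq_zero_of_mem hh fun a ha => by simp [rv, h₂ a ha]⟩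
  | succ i ih =>
    obtain ⟨σ, hσ⟩ := exists_of_cosetSum_ne_zero hne
    obtain ⟨hmem, hs, he⟩ := mem_of_frameTerm_ne_zero hσ
    obtain ⟨k, _, α, Q, hα, hQ, h0⟩ := exists_comb hs
    have hQL : ∀ j, Q j ∈ L := fun j => List.take_subset _ _ (hQ j)
    obtain ⟨K, hK, hp⟩ := exists_pinch L hL
    have hm : i + 2 < n := by omega
    have hpin := (Pinch.sum hα fun j => hp _ (hQL j))
    have hdeep := (Deep.sum hα fun j => hD _ (hQL j)).act σ
    have hsup : ∀ {w : Fin n → ℤ}, (∀ a : Fin n, i + 1 + 2 ≤ a → w a = 0) →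
        ∀ a : Fin n, i + 1 + 2 ≤ a → (σ⁻¹.1 *ᵥ w) a = 0 := fun hw =>
      mulVec_eq_zero_of_mem (inv_mem hmem) hw
    obtain ⟨z₁, z₂⟩ := hdeep.eq_zero_of_orthogonal (transpose_act σ hpin.symm)
      (fun x hx => by
        rw [bil_act]
        refine hpin.pos _ fun h => hx ?_
        rw [← one_mulVec x, ← rl_one, ← inv_mul_cancel σ, rl_mul, ← mulVec_mulVec, h, mulVec_zero]) ⟨i + 2, hm⟩ (fun a ha => hsup h₁ a ha)
      (fun a ha => hsup h₂ a ha) (fun a ha => by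
        have := h0 ⟨a, ha⟩
        rwa [psi_apply le_rfl hm] at this)
    have hext : ∀ {w : Fin n → ℤ}, w ⟨i + 2, hm⟩ = 0 → (∀ a : Fin n, i + 1 + 2 ≤ a → w a = 0) →
        ∀ a : Fin n, i + 2 ≤ a → w a = 0 := by
      intro w hw hw' a ha
      rcases ha.eq_or_lt with h | h
      · rwa [show a = ⟨i + 2, hm⟩ from Fin.ext h.symm]
      · exact hw' a h
    have key := ih (w₁ := σ⁻¹.1 *ᵥ w₁) (w₂ := σ⁻¹.1 *ᵥ w₂) hm.le (fun R hR => by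
      obtain ⟨R', hR', rfl⟩ := List.mem_map.1 hR
      exact (hL _ (List.drop_subset _ _ hR')).act σ) (fun R hR => by
      obtain ⟨R', hR', rfl⟩ := List.mem_map.1 hR
      exact (hD _ (List.drop_subset _ _ hR')).act σ) (hext z₁ (hsup h₁)) (hext z₂ (hsup h₂)) he
    have e : ∀ w : Fin n → ℤ, ((red p σ)⁻¹ * h)⁻¹.1 *ᵥ rv p (σ⁻¹.1 *ᵥ w) = h⁻¹.1 *ᵥ rv p w := by
      intro w
      have e1 : ((red p σ)⁻¹ * h)⁻¹.1 = h⁻¹.1 * (red p σ).1 := by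
        rw [_root_.mul_inv_rev, inv_inv]; rfl
      rw [e1, ← mulVec_mulVec, ← rv_mulVec, mulVec_inv_mulVec]
    rwa [e, e] at key

end CodimOne

namespace CodimOne

open ListCochain

variable {n : ℕ}

/-! ### Unipotent groups -/

/-- Upper unitriangular matrices congruent to the identity modulo `p`, whose columns before the
`m`th one are trivial and whose `m`th column is trivial from row `ρ` on. -/
def unip (n p m ρ : ℕ) : Subgroup (SpecialLinearGroup (Fin n) ℤ) where
  carrier := {u | red p u = 1 ∧ ∀ a b : Fin n,
    (b ≤ a ∨ (b : ℕ) < m ∨ ((b : ℕ) = m ∧ ρ ≤ a)) → u.1 a b = if a = b then 1 else 0}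
  one_mem' := ⟨map_one _, fun a b _ => one_apply⟩
  mul_mem' := by
    rintro u v ⟨hu, hu'⟩ ⟨hv, hv'⟩
    refine ⟨by rw [map_mul, hu, hv, one_mul], fun a b h => ?_⟩
    rw [← hu' a b h]
    have : (u * v).1 = u.1 * v.1 := rfl
    rw [this, mul_apply, Finset.sum_eq_single b]
    · rw [hv' b b (Or.inl le_rfl), if_pos rfl, mul_one]
    · intro c _ hc
      by_cases hcb : b ≤ c ∨ (b : ℕ) < m ∨ ((b : ℕ) = m ∧ ρ ≤ c)
      · rw [hv' c b hcb, if_neg hc, mul_zero]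
      · push Not at hcb
        have hca : c < a := by
          rcases h with h | h | h
          · exact hcb.1.trans_le h
          · exact absurd h (not_lt.2 hcb.2.1)
          · exact Fin.lt_def.2 ((hcb.2.2 h.1).trans_le h.2)
        rw [hu' a c (Or.inl hca.le), if_neg hca.ne', zero_mul]
    · simp
  inv_mem' := by
    rintro u ⟨hu, hu'⟩
    refine ⟨by rw [map_inv, hu, inv_one], fun a b => ?_⟩
    induction b using WellFoundedLT.induction with
    | ind b ih =>
    intro h
    have h1 : (u⁻¹.1 * u.1) a b = (1 : Matrix (Fin n) (Fin n) ℤ) a b :=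
      congrFun (congrFun (congrArg Subtype.val (inv_mul_cancel u)) a) b
    rw [one_apply] at h1
    rw [← h1, mul_apply, Finset.sum_eq_single b]
    · rw [hu' b b (Or.inl le_rfl), if_pos rfl, mul_one]
    · intro c _ hc
      by_cases hcb : b ≤ c ∨ (b : ℕ) < m ∨ ((b : ℕ) = m ∧ ρ ≤ c)
      · rw [hu' c b hcb, if_neg hc, mul_zero]
      · push Not at hcb
        have hca : c < a := by
          rcases h with h | h | h
          · exact hcb.1.trans_le h
          · exact absurd h (not_lt.2 hcb.2.1)
          · exact Fin.lt_def.2 ((hcb.2.2 h.1).trans_le h.2)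
        rw [ih c hcb.1 (Or.inl hca.le), if_neg hca.ne', zero_mul]
    · simp

variable {p m ρ : ℕ}

section

variable {u : SpecialLinearGroup (Fin n) ℤ}

lemma red_of_mem_unip (hu : u ∈ unip n p m ρ) : red p u = 1 := hu.1

lemma unip_apply (hu : u ∈ unip n p m ρ) {a b : Fin n}
    (h : b ≤ a ∨ (b : ℕ) < m ∨ ((b : ℕ) = m ∧ ρ ≤ a)) : u.1 a b = if a = b then 1 else 0 := hu.2 a b h

lemma dvd_of_mem_unip (hu : u ∈ unip n p m ρ) {a b : Fin n} (hab : a ≠ b) : (p : ℤ) ∣ u.1 a b := by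
  rw [← ZMod.intCast_zmod_eq_zero_iff_dvd]
  have h := congrFun (congrFun (congrArg Subtype.val hu.1) a) b
  rw [red_apply] at h
  rw [h]
  exact one_apply_ne hab

lemma unip_le {m' ρ' : ℕ} (h : m' < m ∨ m' = m ∧ ρ ≤ ρ') : unip n p m ρ ≤ unip n p m' ρ' :=
  fun u hu => ⟨hu.1, fun a b hab => hu.2 a b (by omega)⟩

lemma unip_mulVec_of_lt (hu : u ∈ unip n p m ρ) {b : Fin n} (hb : (b : ℕ) < m) :
    u.1 *ᵥ Pi.single b 1 = Pi.single b 1 := by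
  funext a
  rw [mulVec_single_one, col_apply, unip_apply hu (Or.inr (Or.inl hb)), Pi.single_apply]

end

lemma exists_truncation {u : SpecialLinearGroup (Fin n) ℤ} (hu : u ∈ unip n p m ρ) (j : ℕ) :
    ∃ v ∈ blockSubgroup n ℤ j, v ∈ unip n p m ρ ∧
      ∀ a : Fin n, (a : ℕ) < j → u.1 *ᵥ Pi.single a 1 = v.1 *ᵥ Pi.single a 1 := by
  let A : Matrix (Fin n) (Fin n) ℤ := of fun a b =>
    if (b : ℕ) < j then u.1 a b else if a = b then 1 else 0
  have hA : ∀ a b : Fin n, (b ≤ a ∨ (b : ℕ) < m ∨ ((b : ℕ) = m ∧ ρ ≤ a)) →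
      A a b = if a = b then 1 else 0 := by
    intro a b h
    simp only [A, of_apply]
    rw [unip_apply hu h, ite_self]
  have hdet : A.det = 1 := by
    have hT : A.BlockTriangular id := fun a b h => by
      have h' : b < a := h
      rw [hA a b (Or.inl h'.le), if_neg h'.ne']
    rw [det_of_isUpperTriangular hT]
    exact Finset.prod_eq_one fun a _ => by rw [hA a a (Or.inl le_rfl), if_pos rfl]
  refine ⟨⟨A, hdet⟩, mem_blockSubgroup (fun b hb a => ?_) fun a ha b => ?_, ⟨?_, hA⟩, fun a ha => ?_⟩
  · simp [A, not_lt.2 hb]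
  · show A a b = _
    by_cases hb : (b : ℕ) < j
    · rw [hA a b (Or.inl (Fin.le_def.2 (hb.le.trans ha)))]
      simp [eq_comm]
    · simp [A, hb, eq_comm]
  · ext a b
    show ((A a b : ℤ) : ZMod p) = (1 : Matrix (Fin n) (Fin n) (ZMod p)) a b
    have h : ((u.1 a b : ℤ) : ZMod p) = (1 : Matrix (Fin n) (Fin n) (ZMod p)) a b :=
      congrFun (congrFun (congrArg Subtype.val hu.1) a) b
    rw [one_apply] at h ⊢
    simp only [A, of_apply]
    split_ifs at h ⊢ <;> simp [h]
  · funext b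
    simp [A, ha]

/-! ### Shears -/

/-- The `m`th basis vector, modified by a multiple of `p` in the coordinates before `ρ`. -/
def zvec (n p m ρ : ℕ) (w : Fin ρ → ℤ) : Fin n → ℤ := fun a =>
  if h : (a : ℕ) < ρ ∧ (a : ℕ) < m then p * w ⟨a, h.1⟩ else if (a : ℕ) = m then 1 else 0

/-- The matrix with `m`th column `zvec`, and trivial other columns. -/
def shear (n p m ρ : ℕ) (w : Fin ρ → ℤ) : SpecialLinearGroup (Fin n) ℤ :=
  ⟨of fun a b => if (b : ℕ) = m then zvec n p m ρ w a else if a = b then 1 else 0, by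
    rw [det_of_isUpperTriangular]
    · refine Finset.prod_eq_one fun a _ => ?_
      by_cases ha : (a : ℕ) = m <;> simp [zvec, ha]
    · intro a b h
      have h' : b < a := h
      have h'' : (b : ℕ) < a := h
      simp only [of_apply, zvec]
      rw [if_neg h'.ne']
      split_ifs <;> first | rfl | omega⟩

lemma shear_apply (w : Fin ρ → ℤ) (a b : Fin n) : (shear n p m ρ w).1 a b =
    if (b : ℕ) = m then zvec n p m ρ w a else if a = b then 1 else 0 := rfl

lemma shear_mulVec_of_ne (w : Fin ρ → ℤ) {b : Fin n} (hb : (b : ℕ) ≠ m) :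
    (shear n p m ρ w).1 *ᵥ Pi.single b 1 = Pi.single b 1 := by
  funext a
  rw [mulVec_single_one, col_apply, shear_apply, if_neg hb, Pi.single_apply]

lemma shear_mulVec (hm : m < n) (w : Fin ρ → ℤ) :
    (shear n p m ρ w).1 *ᵥ Pi.single ⟨m, hm⟩ 1 = zvec n p m ρ w := by
  funext a
  rw [mulVec_single_one, col_apply, shear_apply, if_pos rfl]

lemma shear_mem_unip (w : Fin ρ → ℤ) : shear n p m ρ w ∈ unip n p m ρ := by
  refine ⟨?_, fun a b h => ?_⟩
  · ext a b
    show (((shear n p m ρ w).1 a b : ℤ) : ZMod p) = (1 : Matrix (Fin n) (Fin n) (ZMod p)) a b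
    rw [one_apply, shear_apply, zvec]
    split_ifs <;> simp <;> omega
  · rw [shear_apply, zvec]
    split_ifs <;> first | rfl | omega

lemma shear_mem_block (w : Fin ρ → ℤ) : shear n p m ρ w ∈ blockSubgroup n ℤ (m + 1) := by
  refine mem_blockSubgroup (fun b hb a => ?_) fun a ha b => ?_ <;>
  · rw [shear_apply, zvec]
    split_ifs <;> first | rfl | omega

lemma shear_row (hm : m < n) (w : Fin ρ → ℤ) (b : Fin n) :
    (shear n p m ρ w).1 ⟨m, hm⟩ b = if b = ⟨m, hm⟩ then 1 else 0 := by
  rw [shear_apply, zvec]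
  simp only [lt_self_iff_false, and_false, dite_false, if_true, Fin.ext_iff]
  split_ifs <;> first | rfl | omega

lemma mul_shear_mulVec {u : SpecialLinearGroup (Fin n) ℤ} (hu : u ∈ unip n p m ρ) (hρ : ρ ≤ m)
    (hm : m < n) {v : Fin ρ → ℤ} (hv : ∀ a : Fin ρ, u.1 ⟨a, by omega⟩ ⟨m, hm⟩ = p * v a)
    (w : Fin ρ → ℤ) {a : Fin n} (ha : (a : ℕ) < m + 1) :
    (u * shear n p m ρ w).1 *ᵥ Pi.single a 1 = (shear n p m ρ (w + v)).1 *ᵥ Pi.single a 1 := by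
  have : (u * shear n p m ρ w).1 = u.1 * (shear n p m ρ w).1 := rfl
  rw [this, ← mulVec_mulVec]
  rcases Nat.lt_succ_iff_lt_or_eq.1 ha with h | h
  · rw [shear_mulVec_of_ne w h.ne, shear_mulVec_of_ne _ h.ne, unip_mulVec_of_lt hu h]
  · obtain rfl : a = ⟨m, hm⟩ := Fin.ext h
    rw [shear_mulVec, shear_mulVec]
    have e : zvec n p m ρ w = ∑ b, zvec n p m ρ w b • (Pi.single b 1 : Fin n → ℤ) := by
      funext c
      simp [Finset.sum_apply, Pi.single_apply]
    rw [e, mulVec_sum]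
    simp only [mulVec_smul]
    have e2 : ∀ b, zvec n p m ρ w b • (u.1 *ᵥ Pi.single b 1) =
        zvec n p m ρ w b • (Pi.single b 1 : Fin n → ℤ) +
          if (b : ℕ) = m then u.1 *ᵥ Pi.single b 1 - Pi.single b 1 else 0 := by
      intro b
      rcases lt_trichotomy (b : ℕ) m with hb | hb | hb
      · rw [unip_mulVec_of_lt hu hb, if_neg hb.ne, add_zero]
      · rw [if_pos hb]
        have : zvec n p m ρ w b = 1 := by simp [zvec, hb]
        rw [this, one_smul, one_smul, add_sub_cancel]
      · have : zvec n p m ρ w b = 0 := by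
          rw [zvec, dif_neg (by omega), if_neg (by omega)]
        rw [this, if_neg hb.ne', zero_smul, zero_smul, zero_add]
    rw [Finset.sum_congr rfl fun b _ => e2 b, Finset.sum_add_distrib, ← e,
      Finset.sum_eq_single ⟨m, hm⟩ (fun b _ hb => if_neg fun h => hb (Fin.ext h)) (by simp),
      if_pos rfl]
    funext c
    rw [Pi.add_apply, Pi.sub_apply, mulVec_single_one, col_apply, Pi.single_apply]
    by_cases hc : (c : ℕ) < ρ
    · have hcm : (c : ℕ) < m := by omega
      have := hv ⟨c, hc⟩
      rw [this, if_neg (by rintro rfl; simp at hcm), zvec, zvec, dif_pos ⟨hc, hcm⟩,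
        dif_pos ⟨hc, hcm⟩, Pi.add_apply]
      ring
    · rw [unip_apply hu (Or.inr (Or.inr ⟨rfl, not_lt.1 hc⟩)), sub_self, add_zero, zvec, zvec,
        dif_neg (by tauto), dif_neg (by tauto)]

lemma finsum_of_injective {α β : Type*} {φ : α → β} (hφ : Function.Injective φ) {f : β → ℚ}
    (h : ∀ b, f b ≠ 0 → b ∈ Set.range φ) : ∑ᶠ b, f b = ∑ᶠ a, f (φ a) := by
  rw [← finsum_mem_range hφ]
  exact finsum_congr fun b => by
    by_cases hb : b ∈ Set.range φ
    · simp [hb]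
    · have : f b = 0 := by
        by_contra hne
        exact hb (h b hne)
      simp [hb, this]

variable {n : ℕ} [NeZero n]

/-! ### Sums over the columns of shears -/

/-- The signed count of the shears whose pairing vectors surround the origin. -/
noncomputable def columnSum (p m ρ : ℕ) (L : List (Matrix (Fin n) (Fin n) ℝ)) : ℚ :=
  ∑ᶠ w : Fin ρ → ℤ, simplexSign (L.map (psi m ρ (shear n p m ρ w)))

/-- The sign of the last coordinate, as a vector. -/
def tip {ρ : ℕ} (w : Fin (ρ + 1) → ℤ) : Fin (ρ + 1) → ℤ :=
  Pi.single (Fin.last ρ) (if 0 < w (Fin.last ρ) then 1 else -1)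

/-- A primitive for `columnSum p m (ρ + 1)`. -/
noncomputable def fillSum (p m ρ : ℕ) (L : List (Matrix (Fin n) (Fin n) ℝ)) : ℚ :=
  ∑ᶠ w : Fin (ρ + 1) → ℤ, simplexSign ((fun a => (tip w a : ℝ)) ::
    L.map (psi m (ρ + 1) (shear n p m (ρ + 1) w)))

lemma tip_ne_zero {ρ : ℕ} (w : Fin (ρ + 1) → ℤ) : tip w ≠ 0 := by
  intro h
  have := congrFun h (Fin.last ρ)
  rw [tip, Pi.single_eq_same] at this
  split_ifs at this
  all_goals simp at this

lemma tip_mul_nonneg {ρ : ℕ} (w : Fin (ρ + 1) → ℤ) (a : Fin (ρ + 1)) : 0 ≤ w a * tip w a := by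
  rw [tip]
  by_cases ha : a = Fin.last ρ
  · subst ha
    rw [Pi.single_eq_same]
    split_ifs with h <;> linarith
  · rw [Pi.single_eq_of_ne ha, mul_zero]

variable {p m ρ : ℕ}

section Finiteness

lemma norm_le_of_pairing {K : ℝ} {q : Matrix (Fin n) (Fin n) ℝ} (hq : Pinch K q) (hp : p ≠ 0)
    (hρ : ρ ≤ m) (hm : m < n) {w : Fin ρ → ℤ} {y : Fin ρ → ℝ} (hy : ∀ a, 0 ≤ w a * y a)
    (h0 : ∀ a, y a + psi m ρ (shear n p m ρ w) q a = 0) (a : Fin ρ) : |(w a : ℝ)| ≤ K := by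
  set z := zvec n p m ρ w with hz
  have hz0 : cv z ≠ 0 := by
    intro h
    have := congrFun h ⟨m, hm⟩
    simp [cv, hz, zvec] at this
  have hps : ∀ a : Fin ρ, bil q (cv z) (Pi.single ⟨a, by omega⟩ 1) = - y a := by
    intro a
    have h1 := h0 a
    rw [psi_apply hρ hm, act_apply, rl_mulVec_single, rl_mulVec_single, shear_mulVec hm,
      shear_mulVec_of_ne w (by simp; omega)] at h1
    have h2 : cv (Pi.single (⟨a, by omega⟩ : Fin n) 1) = Pi.single ⟨a, by omega⟩ 1 := by
      funext b; simp [cv, Pi.single_apply]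
    rw [h2] at h1
    rw [bil_comm hq.symm]
    linarith
  have hdec : cv z = Pi.single ⟨m, hm⟩ 1 +
      ∑ a : Fin ρ, ((p : ℝ) * w a) • (Pi.single ⟨a, by omega⟩ 1 : Fin n → ℝ) := by
    funext b
    rw [Pi.add_apply, Finset.sum_apply]
    simp only [Pi.smul_apply, Pi.single_apply, smul_eq_mul, mul_ite, mul_one, mul_zero, cv, hz,
      zvec, Fin.ext_iff]
    by_cases hb : (b : ℕ) < ρ
    · rw [dif_pos ⟨hb, by omega⟩, if_neg (by omega), zero_add,
        Finset.sum_eq_single ⟨b, hb⟩]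
      · simp
      · intro c _ hc
        rw [if_neg fun h => hc (Fin.ext h.symm)]
      · simp
    · rw [dif_neg (by tauto), Finset.sum_eq_zero fun c _ => if_neg (by omega)]
      split_ifs <;> simp
  have hle : bil q (cv z) (cv z) ≤ |bil q (cv z) (Pi.single ⟨m, hm⟩ 1)| := by
    have h1 : bil q (cv z) (cv z) = bil q (cv z) (Pi.single ⟨m, hm⟩ 1) +
        ∑ a : Fin ρ, (p : ℝ) * w a * bil q (cv z) (Pi.single ⟨a, by omega⟩ 1) := by
      conv_lhs => enter [3]; rw [hdec]
      rw [bil_add_right]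
      congr 1
      rw [bil, mulVec_sum, dotProduct_sum]
      exact Finset.sum_congr rfl fun a _ => bil_smul_right _ _ _ _
    rw [h1]
    refine le_trans ?_ (le_abs_self _)
    rw [add_le_iff_nonpos_right]
    refine Finset.sum_nonpos fun a _ => ?_
    rw [hps]
    have := mul_nonneg (Nat.cast_nonneg (α := ℝ) p) (hy a)
    linarith
  have h3 := (norm_le_pi_norm (cv z) ⟨a, by omega⟩).trans (hq.norm_le hz0 hle)
  refine le_trans ?_ h3
  have h4 : cv z ⟨a, by omega⟩ = (p : ℝ) * w a := by
    simp only [cv, hz, zvec]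
    rw [dif_pos ⟨a.2, a.2.trans_le hρ⟩]
    simp
  rw [h4, Real.norm_eq_abs, abs_mul, Nat.abs_cast]
  exact le_mul_of_one_le_left (abs_nonneg _) (by exact_mod_cast Nat.one_le_iff_ne_zero.2 hp)

lemma finite_of_abs_le (K : ℝ) : {w : Fin ρ → ℤ | ∀ a, |(w a : ℝ)| ≤ K}.Finite := by
  refine (Set.finite_Icc (fun _ => -⌈K⌉ : Fin ρ → ℤ) fun _ => ⌈K⌉).subset fun w hw => ?_
  have h : ∀ a, |w a| ≤ ⌈K⌉ := fun a => by
    have := (hw a).trans (Int.le_ceil K)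
    exact_mod_cast this
  exact ⟨fun a => (abs_le.1 (h a)).1, fun a => (abs_le.1 (h a)).2⟩

variable {L : List (Matrix (Fin n) (Fin n) ℝ)}

lemma locFin_columnSum (hp : p ≠ 0) (hρ : ρ ≤ m) (hm : m < n) (hL : ∀ Q ∈ L, Coer Q) :
    LocFin (fun (w : Fin ρ → ℤ) l => simplexSign (l.map (psi m ρ (shear n p m ρ w)))) L := by
  obtain ⟨K, hK, hpi⟩ := exists_pinch L hL
  refine (finite_of_abs_le K).subset ?_
  rintro w ⟨L', hL', hs⟩
  obtain ⟨k, _, α, Q, hα, hQ, h0⟩ := exists_comb hs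
  exact norm_le_of_pairing (y := 0) (Pinch.sum hα fun i => hpi _ (hL' (hQ i))) hp hρ hm (by simp)
    (by simpa using h0)

lemma locFin_fillSum (hp : p ≠ 0) (hρ : ρ < m) (hm : m < n) (hL : ∀ Q ∈ L, Coer Q) :
    LocFin (fun (w : Fin (ρ + 1) → ℤ) l => simplexSign ((fun a => (tip w a : ℝ)) ::
      l.map (psi m (ρ + 1) (shear n p m (ρ + 1) w)))) L := by
  obtain ⟨K, hK, hpi⟩ := exists_pinch L hL
  refine (finite_of_abs_le K).subset ?_
  rintro w ⟨L', hL', hs⟩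
  obtain ⟨k, _, α, Q, β, hβ, hα, hQ, h0⟩ := exists_comb_cons (Nat.succ_ne_zero ρ) hs
  refine norm_le_of_pairing (y := fun a => β * tip w a)
    (Pinch.sum hα fun i => hpi _ (hL' (hQ i))) hp hρ hm (fun a => ?_) h0
  have h1 : (0 : ℝ) ≤ w a * tip w a := by exact_mod_cast tip_mul_nonneg w a
  have := mul_nonneg hβ.le h1
  linarith

lemma d_columnSum (hp : p ≠ 0) (hρ : ρ ≤ m) (hm : m < n) (hL : Good L) :
    d (columnSum p m ρ) L = 0 := by
  have e : columnSum p m ρ = fun l : List (Matrix (Fin n) (Fin n) ℝ) =>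
    ∑ᶠ w : Fin ρ → ℤ, simplexSign (l.map (psi m ρ (shear n p m ρ w))) := rfl
  rw [e, d_finsum (locFin_columnSum hp hρ hm hL.coer)]
  refine finsum_eq_zero_of_forall_eq_zero fun w => ?_
  rw [d_map, d_simplexSign _ (hL.gen m ρ hρ hm _)]

lemma d_fillSum (hp : p ≠ 0) (hρ : ρ < m) (hm : m < n) (hL : Good L) :
    d (fillSum p m ρ) L = columnSum p m (ρ + 1) L := by
  have e : fillSum p m ρ = fun l : List (Matrix (Fin n) (Fin n) ℝ) =>
    ∑ᶠ w : Fin (ρ + 1) → ℤ, simplexSign ((fun a => (tip w a : ℝ)) ::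
      l.map (psi m (ρ + 1) (shear n p m (ρ + 1) w))) := rfl
  rw [e, d_finsum (locFin_fillSum hp hρ hm hL.coer), columnSum]
  refine finsum_congr fun w => ?_
  rw [d_map (f := fun l => simplexSign (_ :: l)),
    d_simplexSign_cons _ _ (hL.gen_cons m _ hρ hm _ _ (tip_ne_zero w))]

end Finiteness

section Invariance

variable {u : SpecialLinearGroup (Fin n) ℤ}

lemma exists_column (hu : u ∈ unip n p m ρ) (hρ : ρ ≤ m) (hm : m < n) :
    ∃ v : Fin ρ → ℤ, ∀ a : Fin ρ, u.1 ⟨a, by omega⟩ ⟨m, hm⟩ = p * v a := by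
  choose v hv using fun a : Fin ρ => dvd_of_mem_unip hu
    (a := ⟨a, by omega⟩) (b := ⟨m, hm⟩) (by simp [Fin.ext_iff]; omega)
  exact ⟨v, hv⟩

lemma map_psi_shear_act (hu : u ∈ unip n p m ρ) (hρ : ρ ≤ m) (hm : m < n) {v : Fin ρ → ℤ}
    (hv : ∀ a : Fin ρ, u.1 ⟨a, by omega⟩ ⟨m, hm⟩ = p * v a) (w : Fin ρ → ℤ)
    (L : List (Matrix (Fin n) (Fin n) ℝ)) :
    (L.map (act u)).map (psi m ρ (shear n p m ρ w)) =
      L.map (psi m ρ (shear n p m ρ (w + v))) := by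
  rw [List.map_map]
  refine List.map_congr_left fun Q _ => ?_
  rw [Function.comp_apply, psi_act]
  exact psi_congr hρ hm (fun a ha => mul_shear_mulVec hu hρ hm hv w ha) Q

lemma fillSum_map_act_eq (hu : u ∈ unip n p m (ρ + 1)) (hρ : ρ < m) (hm : m < n)
    {v : Fin (ρ + 1) → ℤ} (hv : ∀ a : Fin (ρ + 1), u.1 ⟨a, by omega⟩ ⟨m, hm⟩ = p * v a)
    (L : List (Matrix (Fin n) (Fin n) ℝ)) :
    fillSum p m ρ (L.map (act u)) =
      ∑ᶠ w : Fin (ρ + 1) → ℤ, simplexSign ((fun a => (tip (w - v) a : ℝ)) ::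
        L.map (psi m (ρ + 1) (shear n p m (ρ + 1) w))) := by
  refine (finsum_congr fun w => ?_).trans (finsum_comp_equiv (Equiv.addRight v))
  rw [map_psi_shear_act hu hρ hm hv, Equiv.coe_addRight, add_sub_cancel_right]

lemma fillSum_map_act (hp : p ≠ 0) (hu : u ∈ unip n p m ρ) (hρ : ρ < m) (hm : m < n)
    (L : List (Matrix (Fin n) (Fin n) ℝ)) : fillSum p m ρ (L.map (act u)) = fillSum p m ρ L := by
  have hu' : u ∈ unip n p m (ρ + 1) := unip_le (Or.inr ⟨rfl, Nat.le_succ ρ⟩) hu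
  obtain ⟨v, hv⟩ := exists_column hu' hρ hm
  have hv0 : v (Fin.last ρ) = 0 := by
    have := hv (Fin.last ρ)
    rw [unip_apply hu (Or.inr (Or.inr ⟨rfl, by simp⟩)), if_neg (by simp [Fin.ext_iff]; omega)] at this
    simpa [hp] using this.symm
  rw [fillSum_map_act_eq hu' hρ hm hv, fillSum]
  refine finsum_congr fun w => ?_
  rw [show tip (w - v) = tip w by simp [tip, hv0]]

lemma simplexSign_tip {w : Fin (ρ + 1) → ℤ} (hw : w (Fin.last ρ) = 0) (hρ : ρ < m) (hm : m < n)
    {v : Fin (ρ + 1) → ℤ} (hv : v (Fin.last ρ) = -1) {L : List (Matrix (Fin n) (Fin n) ℝ)}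
    (hL : Good L) :
    simplexSign ((fun a => (tip (w - v) a : ℝ)) ::
        L.map (psi m (ρ + 1) (shear n p m (ρ + 1) w))) -
      simplexSign ((fun a => (tip w a : ℝ)) ::
        L.map (psi m (ρ + 1) (shear n p m (ρ + 1) w))) =
      (-1) ^ (ρ + 1) * simplexSign (L.map (psi m ρ (shear n p m ρ fun a => w a.castSucc))) := by
  have h1 : (fun a => (tip (w - v) a : ℝ)) = Pi.single (Fin.last ρ) 1 := by
    funext a
    rw [tip, Pi.sub_apply, hw, hv]
    by_cases ha : a = Fin.last ρ <;> simp [ha]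
  have h2 : (fun a => (tip w a : ℝ)) = Pi.single (Fin.last ρ) (-1) := by
    funext a
    rw [tip, hw]
    by_cases ha : a = Fin.last ρ <;> simp [ha]
  rw [h1, h2, simplexSign_cons_single _ (hL.gen m (ρ + 1) hρ hm _), List.map_map]
  congr 2
  refine List.map_congr_left fun Q _ => ?_
  funext a
  rw [Function.comp_apply, psi_apply hρ hm, psi_apply hρ.le hm]
  refine act_apply_congr ?_ ?_ Q
  · rw [shear_mulVec_of_ne _ (by simp; omega), shear_mulVec_of_ne _ (by simp; omega)]
  · rw [shear_mulVec hm, shear_mulVec hm]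
    funext b
    simp only [zvec]
    by_cases hb : (b : ℕ) < ρ
    · rw [dif_pos ⟨by omega, by omega⟩, dif_pos ⟨hb, by omega⟩]
      rfl
    · rw [dif_neg (show ¬((b : ℕ) < ρ ∧ (b : ℕ) < m) by tauto)]
      by_cases hb' : (b : ℕ) < ρ + 1
      · rw [dif_pos ⟨hb', by omega⟩, if_neg (by omega)]
        have : (⟨b, hb'⟩ : Fin (ρ + 1)) = Fin.last ρ := Fin.ext (by simp; omega)
        rw [this, hw, mul_zero]
      · rw [dif_neg (by tauto)]

lemma fillSum_map_act_sub (hp : p ≠ 0) (hu : u ∈ unip n p m (ρ + 1)) (hρ : ρ < m) (hm : m < n)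
    {v : Fin (ρ + 1) → ℤ} (hv : ∀ a : Fin (ρ + 1), u.1 ⟨a, by omega⟩ ⟨m, hm⟩ = p * v a)
    (hv1 : v (Fin.last ρ) = -1) {L : List (Matrix (Fin n) (Fin n) ℝ)} (hL : Good L) :
    fillSum p m ρ (L.map (act u)) - fillSum p m ρ L = (-1) ^ (ρ + 1) * columnSum p m ρ L := by
  have hf1 : (Function.support fun w : Fin (ρ + 1) → ℤ =>
      simplexSign ((fun a => (tip (w - v) a : ℝ)) ::
        L.map (psi m (ρ + 1) (shear n p m (ρ + 1) w)))).Finite := by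
    have h1 := (locFin_fillSum (L := L.map (act u)) hp hρ hm
      (hL.map_act u).coer).support (List.Subset.refl _)
    refine (h1.image (· + v)).subset fun w hw => ⟨w - v, ?_, sub_add_cancel w v⟩
    rw [Function.mem_support, map_psi_shear_act hu hρ hm hv, sub_add_cancel]
    exact hw
  rw [fillSum_map_act_eq hu hρ hm hv, fillSum, ← finsum_sub_distrib hf1
    ((locFin_fillSum hp hρ hm hL.coer).support (List.Subset.refl _)),
    finsum_of_injective (φ := fun w : Fin ρ → ℤ => (Fin.snoc w 0 : Fin (ρ + 1) → ℤ)),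
    columnSum, mul_finsum]
  · refine finsum_congr fun w => ?_
    rw [simplexSign_tip (by simp) hρ hm hv1 hL]
    simp
  · intro w w' h
    funext a
    simpa using congrFun h a.castSucc
  · intro w hw
    have h0 : w (Fin.last ρ) = 0 := by
      by_contra hne
      apply hw
      rw [show tip (w - v) = tip w by
        simp only [tip, Pi.sub_apply, hv1]
        congr 2
        simp only [eq_iff_iff]
        omega, sub_self]
    refine ⟨fun a => w a.castSucc, ?_⟩
    simp only
    rw [← h0]
    exact Fin.snoc_init_self w

lemma exists_mulVec_zvec (hu : u ∈ unip n p 1 0) (w : Fin m → ℤ) :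
    ∃ w', u.1 *ᵥ zvec n p m m w = zvec n p m m w' := by
  have hle : ∀ a b : Fin n, b ≤ a → u.1 a b = if a = b then 1 else 0 := fun a b h =>
    unip_apply hu (Or.inl h)
  have hdvd : ∀ c : Fin n, (c : ℕ) < m → (p : ℤ) ∣ (u.1 *ᵥ zvec n p m m w) c := by
    intro c hc
    rw [mulVec, dotProduct]
    refine Finset.dvd_sum fun b _ => ?_
    by_cases hb : c = b
    · subst hb
      rw [zvec, dif_pos ⟨hc, hc⟩]
      exact (dvd_mul_right _ _).mul_left _
    · exact (dvd_of_mem_unip hu hb).mul_right _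
  by_cases hmn : m ≤ n
  swap
  · refine ⟨fun a => if h : (a : ℕ) < n then (u.1 *ᵥ zvec n p m m w) ⟨a, h⟩ / p else 0, ?_⟩
    funext c
    rw [zvec, dif_pos ⟨by omega, by omega⟩, dif_pos c.2, Int.mul_ediv_cancel' (hdvd c (by omega))]
  refine ⟨fun a => (u.1 *ᵥ zvec n p m m w) ⟨a, by omega⟩ / p, ?_⟩
  funext c
  by_cases hc : (c : ℕ) < m
  · conv_rhs => rw [zvec]
    rw [dif_pos ⟨hc, hc⟩]
    exact (Int.mul_ediv_cancel' (hdvd c hc)).symm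
  · conv_rhs => rw [zvec, dif_neg (by tauto)]
    rw [mulVec, dotProduct, Finset.sum_eq_single c]
    · rw [hle c c le_rfl, if_pos rfl, one_mul, zvec, dif_neg (by tauto)]
    · intro b _ hb
      rcases lt_or_gt_of_ne hb with h | h
      · rw [hle c b h.le, if_neg hb.symm, zero_mul]
      · have : (c : ℕ) < b := h
        rw [zvec, dif_neg (by omega), if_neg (by omega), mul_zero]
    · simp

lemma zvec_injective (hp : p ≠ 0) (hm : m < n) : Function.Injective (zvec n p m m) := by
  intro w w' h
  funext a
  have := congrFun h ⟨a, by omega⟩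
  rw [zvec, zvec, dif_pos ⟨a.2, a.2⟩, dif_pos ⟨a.2, a.2⟩] at this
  exact mul_left_cancel₀ (by exact_mod_cast hp) this

lemma simplexSign_map_act_shear (hu : u ∈ unip n p 1 0) (hm : m < n) {w w' : Fin m → ℤ}
    (hw : u.1 *ᵥ zvec n p m m w = zvec n p m m w') (L : List (Matrix (Fin n) (Fin n) ℝ)) :
    simplexSign ((L.map (act u)).map (psi m m (shear n p m m w))) =
      simplexSign (L.map (psi m m (shear n p m m w'))) := by
  obtain ⟨v, hv, -, huv⟩ := exists_truncation hu m
  have e : ∀ a : Fin n, (a : ℕ) < m + 1 → (u * shear n p m m w).1 *ᵥ Pi.single a 1 =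
      (shear n p m m w' * v).1 *ᵥ Pi.single a 1 := by
    intro a ha
    have h1 : (u * shear n p m m w).1 = u.1 * (shear n p m m w).1 := rfl
    have h2 : (shear n p m m w' * v).1 = (shear n p m m w').1 * v.1 := rfl
    rw [h1, h2, ← mulVec_mulVec, ← mulVec_mulVec]
    rcases Nat.lt_succ_iff_lt_or_eq.1 ha with h | h
    · rw [shear_mulVec_of_ne _ h.ne, huv a h]
      exact (exists_block_comb hv (fun b hb => shear_mulVec_of_ne _ hb.ne) h).symm
    · obtain rfl : a = ⟨m, hm⟩ := Fin.ext h
      rw [shear_mulVec hm, hw, (hv _ le_rfl).1, shear_mulVec hm]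
  rw [List.map_map, List.map_congr_left (g := psi m m (shear n p m m w' * v)) fun Q _ => by
    rw [Function.comp_apply, psi_act]; exact psi_congr le_rfl hm e Q,
    simplexSign_map_psi_mul hm _ hv]

/-- The full column sum is invariant under all unipotent matrices. -/
lemma columnSum_map_act (hp : p ≠ 0) (hu : u ∈ unip n p 1 0) (hm : m < n)
    (L : List (Matrix (Fin n) (Fin n) ℝ)) :
    columnSum p m m (L.map (act u)) = columnSum p m m L := by
  choose f hf using fun w : Fin m → ℤ => exists_mulVec_zvec hu w
  choose g hg using fun w : Fin m → ℤ => exists_mulVec_zvec (inv_mem hu) w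
  let e : (Fin m → ℤ) ≃ (Fin m → ℤ) :=
    { toFun := f
      invFun := g
      left_inv := fun w => zvec_injective hp hm (by rw [← hg, ← hf, inv_mulVec_mulVec])
      right_inv := fun w => zvec_injective hp hm (by rw [← hf, ← hg, mulVec_inv_mulVec]) }
  exact (finsum_congr fun w => simplexSign_map_act_shear hu hm (hf w) L).trans
    (finsum_comp_equiv e (f := fun w => simplexSign (L.map (psi m m (shear n p m m w)))))

end Invariance

end CodimOne

namespace CodimOne

open ListCochain

variable {n : ℕ} [NeZero n] {p : ℕ}

section Unipotent

variable {u : SpecialLinearGroup (Fin n) ℤ}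

lemma exists_unip_factor (hu : u ∈ unip n p 1 0) (j : ℕ) :
    ∃ r, ∃ v ∈ blockSubgroup n ℤ j, u = r * v ∧ red p v = 1 ∧ v ∈ unip n p 1 0 ∧
      ∀ a : Fin n, (a : ℕ) < j → r.1 *ᵥ Pi.single a 1 = Pi.single a 1 := by
  obtain ⟨v, hv, hvu, h⟩ := exists_truncation hu j
  refine ⟨u * v⁻¹, v, hv, by group, hvu.1, hvu, fun a ha => ?_⟩
  have h1 : (u * v⁻¹).1 = u.1 * v⁻¹.1 := rfl
  have h2 : ∀ b : Fin n, (b : ℕ) < j → (v⁻¹ * u).1 *ᵥ Pi.single b 1 = Pi.single b 1 := by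
    intro b hb
    have h3 : (v⁻¹ * u).1 = v⁻¹.1 * u.1 := rfl
    rw [h3, ← mulVec_mulVec, h b hb, inv_mulVec_mulVec]
  have h4 := exists_block_comb (inv_mem hv) h2 ha
  rw [h1, ← mulVec_mulVec]
  have h5 : (v⁻¹ * u).1 = v⁻¹.1 * u.1 := rfl
  rw [h5, ← mulVec_mulVec] at h4
  have h6 := congrArg (fun x => v.1 *ᵥ x) h4
  simpa only [mulVec_inv_mulVec] using h6

end Unipotent

/-! ### Splitting off the last stage -/

/-- The primitive of the summand of a coset whose last row is nontrivial. -/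
noncomputable def bottomTerm (p i : ℕ) (h : SpecialLinearGroup (Fin n) (ZMod p))
    (L : List (Matrix (Fin n) (Fin n) ℝ)) (σ : SpecialLinearGroup (Fin n) ℤ) : ℚ :=
  open scoped Classical in
  if σ ∈ blockSubgroup n ℤ (i + 3) ∧ bottom (i + 2) σ ≠ 0 then
    cup (i + 1) (fun l => simplexSign ((fun a => (bottom (i + 2) σ a : ℝ)) ::
        l.map (psi (i + 2) (i + 2) σ)))
      (fun l => flagCochain p i ((red p σ)⁻¹ * h) (l.map (act σ))) L
  else 0

/-- The sum of `bottomTerm` over all cosets. -/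
noncomputable def bottomSum (p i : ℕ) (h : SpecialLinearGroup (Fin n) (ZMod p))
    (L : List (Matrix (Fin n) (Fin n) ℝ)) : ℚ :=
  cosetSum (blockSubgroup n ℤ (i + 2)) (bottomTerm p i h L)

variable {i : ℕ} {h : SpecialLinearGroup (Fin n) (ZMod p)} {L : List (Matrix (Fin n) (Fin n) ℝ)}

lemma bottomTerm_mul (hi : i + 2 < n) (h : SpecialLinearGroup (Fin n) (ZMod p))
    (L : List (Matrix (Fin n) (Fin n) ℝ))
    (σ : SpecialLinearGroup (Fin n) ℤ) {s : SpecialLinearGroup (Fin n) ℤ}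
    (hs : s ∈ blockSubgroup n ℤ (i + 2)) :
    bottomTerm p i h L (σ * s) = bottomTerm p i h L σ := by
  have hs' : s ∈ blockSubgroup n ℤ (i + 3) := blockSubgroup_mono (Nat.le_succ _) hs
  have hiff : σ * s ∈ blockSubgroup n ℤ (i + 3) ∧ bottom (i + 2) (σ * s) ≠ 0 ↔
      σ ∈ blockSubgroup n ℤ (i + 3) ∧ bottom (i + 2) σ ≠ 0 :=
    and_congr (Subgroup.mul_mem_cancel_right _ hs') (bottom_mul_block_eq_zero hi σ hs).not
  by_cases hσ : σ ∈ blockSubgroup n ℤ (i + 3) ∧ bottom (i + 2) σ ≠ 0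
  · rw [bottomTerm, bottomTerm, if_pos hσ, if_pos (hiff.2 hσ)]
    simp only [cup, simplexSign_cons_map_psi_mul hi σ hs, ← map_act_map_act]
    have h1 : red p (σ * s) = red p σ * red p s := map_mul _ _ _
    have h2 : red p s * ((red p σ * red p s)⁻¹ * h) = (red p σ)⁻¹ * h := by group
    rw [flagCochain_map_act hi.le hs, h1, h2]
  · rw [bottomTerm, bottomTerm, if_neg hσ, if_neg (mt hiff.1 hσ)]

lemma bottom_mul_left {m : ℕ} (hm : m < n) {v σ : SpecialLinearGroup (Fin n) ℤ}
    (hv : ∀ b : Fin n, v.1 ⟨m, hm⟩ b = if b = ⟨m, hm⟩ then 1 else 0) :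
    bottom m (v * σ) = bottom m σ := by
  have h : ∀ b, (v * σ).1 ⟨m, hm⟩ b = σ.1 ⟨m, hm⟩ b := by
    intro b
    have : (v * σ).1 = v.1 * σ.1 := rfl
    rw [this, mul_apply, Finset.sum_eq_single ⟨m, hm⟩]
    · rw [hv, if_pos rfl, one_mul]
    · intro c _ hc
      rw [hv, if_neg hc, zero_mul]
    · simp
  funext a
  rw [bottom_apply hm, bottom_apply hm, h, h]

lemma row_of_mem_unip {m : ℕ} (hm : m < n) {v : SpecialLinearGroup (Fin n) ℤ}
    (hv : v ∈ unip n p 1 0) (hvb : v ∈ blockSubgroup n ℤ (m + 1)) (b : Fin n) :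
    v.1 ⟨m, hm⟩ b = if b = ⟨m, hm⟩ then 1 else 0 := by
  by_cases hb : b ≤ ⟨m, hm⟩
  · rw [unip_apply hv (Or.inl hb)]
    simp [eq_comm]
  · have hb' : m + 1 ≤ (b : ℕ) := by simpa [Fin.le_def] using hb
    rw [col_of_mem hvb hb']
    simp [eq_comm]

lemma bottomSum_map_act (hi : i + 2 < n) {u : SpecialLinearGroup (Fin n) ℤ}
    (hu : u ∈ unip n p 1 0) (h : SpecialLinearGroup (Fin n) (ZMod p))
    (L : List (Matrix (Fin n) (Fin n) ℝ)) :
    bottomSum p i h (L.map (act u)) = bottomSum p i h L := by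
  obtain ⟨r, v, hv, rfl, hv1, hvu, hr⟩ := exists_unip_factor hu (i + 3)
  rw [bottomSum, bottomSum, ← cosetSum_mul_left (T := bottomTerm p i h L)
    (fun σ s hs => bottomTerm_mul hi h L σ hs) v]
  congr 1
  funext σ
  have hiff : v * σ ∈ blockSubgroup n ℤ (i + 3) ∧ bottom (i + 2) (v * σ) ≠ 0 ↔
      σ ∈ blockSubgroup n ℤ (i + 3) ∧ bottom (i + 2) σ ≠ 0 := by
    rw [bottom_mul_left hi (row_of_mem_unip hi hvu hv)]
    exact and_congr (Subgroup.mul_mem_cancel_left _ hv) Iff.rfl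
  by_cases hσ : σ ∈ blockSubgroup n ℤ (i + 3) ∧ bottom (i + 2) σ ≠ 0
  · rw [bottomTerm, bottomTerm, if_pos hσ, if_pos (hiff.2 hσ)]
    have hvσ := (hiff.2 hσ).1
    simp only [cup, ← List.map_take, ← List.map_drop]
    congr 1
    · rw [List.map_map, bottom_mul_left hi (row_of_mem_unip hi hvu hv)]
      congr 2
      refine List.map_congr_left fun Q _ => ?_
      rw [Function.comp_apply, psi_act]
      refine psi_congr le_rfl hi (fun a ha => ?_) Q
      have : (r * v * σ).1 = r.1 * (v * σ).1 := by
        rw [mul_assoc]; rfl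
      rw [this, ← mulVec_mulVec, exists_block_comb hvσ hr ha]
    · have h1 : red p (v * σ) = red p σ := by
        rw [← one_mul (red p σ), ← hv1]
        exact map_mul _ _ _
      rw [h1, map_act_map_act, show r * v * σ = v * σ * ((v * σ)⁻¹ * r * (v * σ)) by group,
        ← map_act_map_act]
      refine flagCochain_map_act_of_fixes hi.le (fun a ha => ?_) _ _
      have : ((v * σ)⁻¹ * r * (v * σ)).1 = (v * σ)⁻¹.1 * r.1 * (v * σ).1 := rfl
      rw [this, ← mulVec_mulVec, ← mulVec_mulVec,
        exists_block_comb hvσ hr (show (a : ℕ) < i + 3 by omega), inv_mulVec_mulVec]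
  · rw [bottomTerm, bottomTerm, if_neg hσ, if_neg (mt hiff.1 hσ)]

lemma locFin_bottomTerm (hi : i + 2 < n) (h : SpecialLinearGroup (Fin n) (ZMod p))
    (hL : ∀ Q ∈ L, Coer Q) :
    LocFin (fun (c : SpecialLinearGroup (Fin n) ℤ ⧸ blockSubgroup n ℤ (i + 2)) l =>
      bottomTerm p i h l c.out) L := by
  refine (finite_frame_cons hL hi).subset ?_
  rintro c ⟨L', hL', hne⟩
  simp only [bottomTerm] at hne
  split_ifs at hne with hc
  · exact ⟨hc.1, hc.2, _, fun Q hQ => hL' (List.take_subset _ _ hQ), left_ne_zero_of_mul hne⟩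
  · exact absurd rfl hne

lemma d_bottomTerm (hi : i + 2 < n) (h : SpecialLinearGroup (Fin n) (ZMod p)) (hL : Good L)
    (hlen : L.length = flagDegree (i + 1) + 1) {σ : SpecialLinearGroup (Fin n) ℤ}
    (hσ : bottom (i + 2) σ ≠ 0) :
    d (fun l => bottomTerm p i h l σ) L = frameTerm p (i + 2) (flagCochain p i) h L σ := by
  rw [flagDegree] at hlen
  simp only [bottomTerm, frameTerm]
  by_cases hσ' : σ ∈ blockSubgroup n ℤ (i + 3)
  · rw [if_pos hσ']
    simp only [if_pos (show σ ∈ blockSubgroup n ℤ (i + 3) ∧ bottom (i + 2) σ ≠ 0 from ⟨hσ', hσ⟩)]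
    rw [show (fun l => cup (i + 1) (fun l => simplexSign ((fun a => (bottom (i + 2) σ a : ℝ)) ::
        l.map (psi (i + 2) (i + 2) σ)))
      (fun l => flagCochain p i ((red p σ)⁻¹ * h) (l.map (act σ))) l) = cup (i + 1) _ _ from rfl,
      d_cup _ _ _ _ (by omega), d_map, d_map (f := fun l => simplexSign (_ :: l)),
      d_simplexSign_cons, d_flagCochain hi.le, mul_zero, add_zero]
    · rfl
    · exact (hL.sublist (List.drop_sublist _ _)).map_act σ
    · simp; omega
    · exact (hL.sublist (List.take_sublist _ _)).gen_cons _ _ le_rfl hi σ _ hσ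
  · rw [if_neg hσ']
    simp only [hσ', false_and, if_false]
    exact d_zero L

lemma exists_shear (hi : i + 2 < n) (h0 : ∀ a : Fin n, (a : ℕ) < i + 2 → h.1 a ⟨i + 2, hi⟩ = 0)
    (hd0 : h.1 ⟨i + 2, hi⟩ ⟨i + 2, hi⟩ ≠ 0) (hd1 : h.1 ⟨i + 2, hi⟩ ⟨i + 2, hi⟩ ≠ -1)
    {σ : SpecialLinearGroup (Fin n) ℤ} (hσ : bottom (i + 2) σ = 0)
    (hne : frameTerm p (i + 2) (flagCochain p i) h L σ ≠ 0) :
    ∃ w, (shear n p (i + 2) (i + 2) w)⁻¹ * σ ∈ blockSubgroup n ℤ (i + 2) := by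
  obtain ⟨h1, -, h2⟩ := mem_of_frameTerm_ne_zero hne
  have h3 := mem_of_flagCochain_ne_zero h2
  have hcol : ∀ a, ((σ.1 a ⟨i + 2, hi⟩ : ℤ) : ZMod p) = h.1 a ⟨i + 2, hi⟩ := by
    have h4 := (h3 ⟨i + 2, hi⟩ le_rfl).1
    have h5 : ((red p σ)⁻¹ * h).1 = (red p σ)⁻¹.1 * h.1 := rfl
    rw [h5, ← mulVec_mulVec] at h4
    have h6 := congrArg (fun x => (red p σ).1 *ᵥ x) h4
    simp only [mulVec_inv_mulVec] at h6
    intro a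
    have h7 := congrFun h6 a
    rw [mulVec_single_one, mulVec_single_one, col_apply, col_apply] at h7
    exact h7.symm
  have hmm : σ.1 ⟨i + 2, hi⟩ ⟨i + 2, hi⟩ ≠ 0 := by
    intro h4
    have := hcol ⟨i + 2, hi⟩
    rw [h4, Int.cast_zero] at this
    exact hd0 this.symm
  have hrow : ∀ a, a ≠ ⟨i + 2, hi⟩ → σ.1 ⟨i + 2, hi⟩ a = 0 := by
    intro a ha
    by_cases ha' : (a : ℕ) < i + 2
    · have := congrFun hσ ⟨a, ha'⟩
      rw [bottom_apply hi] at this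
      rcases mul_eq_zero.1 this with h4 | h4
      · exact absurd (Int.sign_eq_zero_iff_zero.1 h4) hmm
      · exact h4
    · have : i + 3 ≤ (a : ℕ) := by
        have := Fin.val_ne_of_ne ha
        simp only at this
        omega
      rw [col_of_mem h1 this, if_neg ha.symm]
  have hunit : σ.1 ⟨i + 2, hi⟩ ⟨i + 2, hi⟩ = 1 := by
    have h4 : (σ.1 * σ⁻¹.1) ⟨i + 2, hi⟩ ⟨i + 2, hi⟩ = 1 := by
      rw [show σ.1 * σ⁻¹.1 = 1 from congrArg Subtype.val (mul_inv_cancel σ), one_apply_eq]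
    rw [mul_apply, Finset.sum_eq_single ⟨i + 2, hi⟩
      (fun b _ hb => by rw [hrow b hb, zero_mul]) (by simp)] at h4
    rcases Int.isUnit_iff.1 (IsUnit.of_mul_eq_one _ h4) with h5 | h5
    · exact h5
    · have := hcol ⟨i + 2, hi⟩
      rw [h5] at this
      exact absurd (by simpa using this.symm) hd1
  have hdvd : ∀ a : Fin (i + 2), (p : ℤ) ∣ σ.1 ⟨a, by omega⟩ ⟨i + 2, hi⟩ := by
    intro a
    rw [← ZMod.intCast_zmod_eq_zero_iff_dvd, hcol, h0 _ a.2]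
  choose w hw using hdvd
  have hz : σ.1 *ᵥ Pi.single ⟨i + 2, hi⟩ 1 = zvec n p (i + 2) (i + 2) w := by
    funext a
    rw [mulVec_single_one, col_apply, zvec]
    split_ifs with h4 h5
    · exact hw ⟨a, h4.1⟩
    · obtain rfl : a = ⟨i + 2, hi⟩ := Fin.ext h5
      exact hunit
    · have h6 : i + 3 ≤ (a : ℕ) := by omega
      rw [row_of_mem h1 h6, if_neg (by rintro rfl; simp at h5)]
  have hsb := shear_mem_block (n := n) (p := p) (m := i + 2) w
  set s := shear n p (i + 2) (i + 2) w with hs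
  have hmul : (s⁻¹ * σ).1 = s⁻¹.1 * σ.1 := rfl
  refine ⟨w, mem_blockSubgroup_of_succ (m := ⟨i + 2, hi⟩) (mul_mem (inv_mem hsb) h1) ?_ ?_⟩
  · rw [hmul, ← mulVec_mulVec, hz, ← shear_mulVec hi, inv_mulVec_mulVec]
  · have h4 : Pi.single ⟨i + 2, hi⟩ 1 ᵥ* s.1 = Pi.single ⟨i + 2, hi⟩ 1 := by
      funext b
      rw [single_one_vecMul, row_apply, hs, shear_row hi, Pi.single_apply]
    have h5 : Pi.single ⟨i + 2, hi⟩ 1 ᵥ* σ.1 = Pi.single ⟨i + 2, hi⟩ 1 := by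
      funext b
      rw [single_one_vecMul, row_apply, Pi.single_apply]
      split_ifs with hb
      · rw [hb, hunit]
      · exact hrow b hb
    rw [hmul, ← vecMul_vecMul]
    conv_lhs => rw [← h4]
    rw [vecMul_vecMul, vecMul_vecMul, ← Matrix.mul_assoc,
      show s.1 * s⁻¹.1 = 1 from congrArg Subtype.val (mul_inv_cancel s), Matrix.one_mul, h5]

lemma bottom_shear (hi : i + 2 < n) (w : Fin (i + 2) → ℤ) :
    bottom (i + 2) (shear n p (i + 2) (i + 2) w) = 0 := by
  funext a
  rw [bottom_apply hi, shear_row hi _ ⟨a, _⟩, if_neg (by simp [Fin.ext_iff]; omega), mul_zero]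
  rfl

lemma frameTerm_shear (hi : i + 2 < n) (w : Fin (i + 2) → ℤ) :
    frameTerm p (i + 2) (flagCochain p i) h L (shear n p (i + 2) (i + 2) w) =
      simplexSign ((L.take (i + 3)).map (psi (i + 2) (i + 2) (shear n p (i + 2) (i + 2) w))) *
        flagCochain p i h (L.drop (i + 2)) := by
  rw [frameTerm, if_pos (shear_mem_block w), cup, (shear_mem_unip w).1, inv_one, one_mul,
    flagCochain_map_act_of_fixes hi.le fun a ha => shear_mulVec_of_ne _ ha.ne]

lemma flagCochain_succ (hp : p ≠ 0) (hi : i + 2 < n)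
    (h0 : ∀ a : Fin n, (a : ℕ) < i + 2 → h.1 a ⟨i + 2, hi⟩ = 0)
    (hd0 : h.1 ⟨i + 2, hi⟩ ⟨i + 2, hi⟩ ≠ 0) (hd1 : h.1 ⟨i + 2, hi⟩ ⟨i + 2, hi⟩ ≠ -1)
    (hL : Good L) (hlen : L.length = flagDegree (i + 1) + 1) :
    flagCochain p (i + 1) h L = d (bottomSum p i h) L +
      cup (i + 2) (columnSum p (i + 2) (i + 2)) (flagCochain p i h) L := by
  classical
  let S := blockSubgroup n ℤ (i + 2)
  let T : SpecialLinearGroup (Fin n) ℤ → ℚ := frameTerm p (i + 2) (flagCochain p i) h L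
  have hT : ∀ σ, ∀ s ∈ S, T (σ * s) = T σ := fun σ s hs => frameTerm_mul_flag hi h L σ hs
  have hfin : (Function.support fun c : SpecialLinearGroup (Fin n) ℤ ⧸ S => T c.out).Finite :=
    (locFin_frameTerm hi (flagCochain p i) h hL.coer).support (List.Subset.refl _)
  have hd : d (bottomSum p i h) L = ∑ᶠ c : SpecialLinearGroup (Fin n) ℤ ⧸ S,
      if bottom (i + 2) c.out = 0 then 0 else T c.out := by
    have e : bottomSum p i h = fun l => ∑ᶠ c : SpecialLinearGroup (Fin n) ℤ ⧸ S,
      bottomTerm p i h l c.out := rfl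
    rw [e, d_finsum (locFin_bottomTerm hi h hL.coer)]
    refine finsum_congr fun c => ?_
    split_ifs with hc
    · simp only [bottomTerm, hc, ne_eq, not_true, and_false, if_false]
      exact d_zero L
    · exact d_bottomTerm hi h hL hlen hc
  have hs : cup (i + 2) (columnSum p (i + 2) (i + 2)) (flagCochain p i h) L =
      ∑ᶠ c : SpecialLinearGroup (Fin n) ℤ ⧸ S, if bottom (i + 2) c.out = 0 then T c.out else 0 := by
    rw [finsum_of_injective (φ := fun w : Fin (i + 2) → ℤ =>
      (QuotientGroup.mk (shear n p (i + 2) (i + 2) w) : SpecialLinearGroup (Fin n) ℤ ⧸ S)),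
      cup, columnSum, finsum_mul]
    · refine finsum_congr fun w => ?_
      obtain ⟨s, hs, h1⟩ := exists_out_eq_mul S (shear n p (i + 2) (i + 2) w)
      rw [h1, hT _ s hs, if_pos ((bottom_mul_block_eq_zero hi _ hs).2 (bottom_shear hi w))]
      exact (frameTerm_shear hi w).symm
    · intro w w' hw
      have h1 := (QuotientGroup.eq.1 hw ⟨i + 2, hi⟩ le_rfl).1
      have h2 : ((shear n p (i + 2) (i + 2) w)⁻¹ * shear n p (i + 2) (i + 2) w').1 =
        (shear n p (i + 2) (i + 2) w)⁻¹.1 * (shear n p (i + 2) (i + 2) w').1 := rfl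
      rw [h2, ← mulVec_mulVec] at h1
      have h3 := congrArg (fun x => (shear n p (i + 2) (i + 2) w).1 *ᵥ x) h1
      simp only [mulVec_inv_mulVec, shear_mulVec hi] at h3
      exact (zvec_injective hp hi h3).symm
    · intro c hc
      split_ifs at hc with hb
      · obtain ⟨w, hw⟩ := exists_shear hi h0 hd0 hd1 hb hc
        refine ⟨w, ?_⟩
        rw [← c.out_eq]
        exact QuotientGroup.eq.2 hw
      · exact absurd rfl hc
  rw [hd, hs, ← finsum_add_distrib, flagCochain, cosetSum]
  · refine finsum_congr fun c => ?_
    split_ifs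
    · exact (zero_add _).symm
    · exact (add_zero _).symm
  · refine hfin.subset fun c hc => ?_
    rw [Function.mem_support] at hc ⊢
    split_ifs at hc
    · exact absurd rfl hc
    · exact hc
  · refine hfin.subset fun c hc => ?_
    rw [Function.mem_support] at hc ⊢
    split_ifs at hc
    · exact hc
    · exact absurd rfl hc

end CodimOne

namespace ListCochain

variable {Y : Type*}

lemma cup_cup (a b : ℕ) (f g k : List Y → ℚ) (l : List Y) :
    cup a f (cup b g k) l = cup (a + b) (cup a f g) k l := by
  simp only [cup, List.take_take, List.drop_take, List.drop_drop]
  rw [min_eq_left (by omega : a + 1 ≤ a + b + 1), show a + b + 1 - a = b + 1 by omega, mul_assoc]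

lemma cup_map {X : Type*} (a : ℕ) (f g : List Y → ℚ) (φ : X → Y) (l : List X) :
    cup a f g (l.map φ) = f ((l.take (a + 1)).map φ) * g ((l.drop a).map φ) := by
  rw [cup, List.map_take, List.map_drop]

end ListCochain

namespace CodimOne

open ListCochain

variable {n : ℕ} [NeZero n] {p : ℕ}

/-- The degree of `columnProd`. -/
def columnDegree (n : ℕ) : ℕ → ℕ
  | 0 => 0
  | k + 1 => columnDegree n k + (n - 1 - k)

/-- The product of the column cochains of the last `k` columns. -/
noncomputable def columnProd (p : ℕ) : ℕ → List (Matrix (Fin n) (Fin n) ℝ) → ℚ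
  | 0 => fun _ => 1
  | k + 1 => cup (columnDegree n k) (columnProd p k) (columnSum p (n - 1 - k) (n - 1 - k))

variable {L : List (Matrix (Fin n) (Fin n) ℝ)}

lemma Good.drop (hL : Good L) (a : ℕ) : Good (L.drop a) := hL.sublist (List.drop_sublist _ _)

lemma Good.take (hL : Good L) (a : ℕ) : Good (L.take a) := hL.sublist (List.take_sublist _ _)

lemma d_columnProd (hp : p ≠ 0) : ∀ k, ∀ L : List (Matrix (Fin n) (Fin n) ℝ), Good L →
    L.length = columnDegree n k + 2 → d (columnProd p k) L = 0
  | 0, L, _, hlen => by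
    obtain ⟨x, y, rfl⟩ := List.length_eq_two.1 hlen
    simp [d_cons, columnProd]
  | k + 1, L, hL, hlen => by
    have hn := NeZero.pos n
    simp only [columnDegree] at hlen
    rw [columnProd, d_cup _ _ _ _ (by omega), d_columnSum hp le_rfl (by omega) (hL.drop _)]
    rw [d_columnProd hp k _ (hL.take _) (by rw [List.length_take]; omega)]
    ring

lemma columnProd_map_act (hp : p ≠ 0) {u : SpecialLinearGroup (Fin n) ℤ} (hu : u ∈ unip n p 1 0) :
    ∀ k, ∀ L : List (Matrix (Fin n) (Fin n) ℝ),
      columnProd p k (L.map (act u)) = columnProd p k L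
  | 0, L => rfl
  | k + 1, L => by
    have hn := NeZero.pos n
    rw [columnProd, cup_map, columnProd_map_act hp hu k, columnSum_map_act hp hu (by omega), cup]

/-- Below the diagonal, `flagCochain` is a product of column cochains up to a coboundary. -/
lemma exists_flagCochain_eq (hp : p ≠ 0) {h : SpecialLinearGroup (Fin n) (ZMod p)}
    (hh : ∀ j : Fin n, 2 ≤ (j : ℕ) → (∀ a < j, h.1 a j = 0) ∧ h.1 j j ≠ 0 ∧ h.1 j j ≠ -1)
    {N : ℕ} (hN : N + 2 = n) (k i : ℕ) (hik : i + k = N) :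
    flagDegree i + columnDegree n k = flagDegree N ∧
    ∃ B : List (Matrix (Fin n) (Fin n) ℝ) → ℚ,
      (∀ u ∈ unip n p 1 0, ∀ L, B (L.map (act u)) = B L) ∧
      ∀ L, Good L → L.length = flagDegree N + 1 →
        flagCochain p N h L = d B L + cup (columnDegree n k) (columnProd p k) (flagCochain p i h) L := by
  induction k generalizing i with
  | zero =>
    obtain rfl : i = N := by omega
    refine ⟨by simp [columnDegree], fun _ => 0, fun _ _ _ => rfl, fun L _ _ => ?_⟩
    rw [d_zero]
    simp [cup, columnDegree, columnProd]
  | succ k ih =>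
    obtain ⟨hdeg, B, hB, hE⟩ := ih (i + 1) (by omega)
    have hm : n - 1 - k = i + 2 := by omega
    simp only [flagDegree] at hdeg
    refine ⟨by simp only [columnDegree, hm]; omega, fun L => B L + (-1) ^ columnDegree n k *
      cup (columnDegree n k) (columnProd p k) (bottomSum p i h) L, fun u hu L => ?_,
      fun L hL hlen => ?_⟩
    · simp only [hB u hu]
      rw [cup_map, columnProd_map_act hp hu, bottomSum_map_act (by omega) hu, cup]
    · have hi : i + 2 < n := by omega
      obtain ⟨h0, hd0, hd1⟩ := hh ⟨i + 2, hi⟩ (by simp)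
      rw [hE L hL hlen, d_add, d_smul, d_cup _ _ _ _ (by omega),
        d_columnProd hp k _ (hL.take _) (by rw [List.length_take]; omega)]
      have h1 := flagCochain_succ (L := L.drop (columnDegree n k)) hp hi (h := h)
        (fun a ha => h0 a (Fin.lt_def.2 ha)) hd0 hd1 (hL.drop _)
        (by simp only [List.length_drop, flagDegree]; omega)
      rw [columnProd, columnDegree, hm, ← cup_cup, cup, h1]
      simp only [cup]
      have h2 : ((-1 : ℚ) ^ columnDegree n k) * (-1) ^ columnDegree n k = 1 := by
        rw [← mul_pow]; simp
      linear_combination (-(columnProd p k (L.take (columnDegree n k + 1)) *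
        d (bottomSum p i h) (L.drop (columnDegree n k)))) * h2

end CodimOne

namespace CodimOne

open ListCochain

variable {n : ℕ} [NeZero n]

/-! ### Averaging over perturbations -/

lemma exists_smallFilter_lim (n : ℕ) [NeZero n] : ∃ Lim : ((Fin n → Fin n → ℝ) → ℚ) →ₗ[ℚ] ℚ,
    (∀ f, (∀ᶠ θ in smallFilter n, f θ = 0) → Lim f = 0) ∧ ∀ c, Lim (fun _ => c) = c :=
  have := smallFilter_neBot (n := n)
  exists_lim _

/-- The cochain on `SL_n(ℤ)` obtained from a cochain on forms by averaging over perturbations of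
the vertices. -/
noncomputable def averaged (f : List (Matrix (Fin n) (Fin n) ℝ) → ℚ) :
    List (SpecialLinearGroup (Fin n) ℤ) → ℚ :=
  avg (exists_smallFilter_lim n).choose (vert (baseForm n)) f

variable {f g : List (Matrix (Fin n) (Fin n) ℝ) → ℚ} {l : List (SpecialLinearGroup (Fin n) ℤ)}

lemma averaged_congr (h : ∀ L, L.length = l.length → Good L → f L = g L) :
    averaged f l = averaged g l :=
  avg_congr _ _ (exists_smallFilter_lim n).choose_spec.1
    (evAll_good (R := fun _ => True) (pre := []) (fun _ hθ => coer_pert_baseForm hθ)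
      (fun _ _ _ _ => trivial) good_nil fun _ _ => trivial)
    fun L hL hP => h L hL hP.1

lemma averaged_congr_deep (hn : 2 ≤ n) (hl : ∀ u ∈ l,
      u.1 *ᵥ Pi.single (Fin.ofNat n 0) 1 = Pi.single (Fin.ofNat n 0) 1 ∧
      u.1 *ᵥ Pi.single (Fin.ofNat n 1) 1 = Pi.single (Fin.ofNat n 1) 1)
    (h : ∀ L, L.length = l.length → Good L →
      (∀ Q ∈ L, Deep (Pi.single (Fin.ofNat n 0) 1) (Pi.single (Fin.ofNat n 1) 1) Q) →
        f L = g L) :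
    averaged f l = averaged g l :=
  avg_congr _ _ (exists_smallFilter_lim n).choose_spec.1
    (evAll_good (pre := [])
      (R := fun Q => Deep (Pi.single (Fin.ofNat n 0) 1) (Pi.single (Fin.ofNat n 1) 1) Q)
      (fun _ hθ => coer_pert_baseForm hθ)
      (fun u hu θ hθ => by
        have h1 := (deep_pert_baseForm hn hθ).act u⁻¹
        rwa [inv_inv, (hl u hu).1, (hl u hu).2] at h1) good_nil (by simp))
    fun L hL hP => h L hL hP.1 hP.2

lemma averaged_sub (f g : List (Matrix (Fin n) (Fin n) ℝ) → ℚ)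
    (l : List (SpecialLinearGroup (Fin n) ℤ)) :
    averaged (fun L => f L - g L) l = averaged f l - averaged g l := avg_sub _ _ _ _ _

lemma averaged_smul (c : ℚ) (f : List (Matrix (Fin n) (Fin n) ℝ) → ℚ)
    (l : List (SpecialLinearGroup (Fin n) ℤ)) :
    averaged (fun L => c * f L) l = c * averaged f l := avg_smul _ _ _ _ _

lemma averaged_const (c : ℚ) (l : List (SpecialLinearGroup (Fin n) ℤ)) :
    averaged (fun _ => c) l = c := avg_const _ _ (exists_smallFilter_lim n).choose_spec.2 _ _

lemma averaged_d (f : List (Matrix (Fin n) (Fin n) ℝ) → ℚ)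
    (l : List (SpecialLinearGroup (Fin n) ℤ)) : averaged (d f) l = d (averaged f) l :=
  avg_d _ _ (exists_smallFilter_lim n).choose_spec.2 _ _

lemma averaged_map_mul (γ : SpecialLinearGroup (Fin n) ℤ)
    (f : List (Matrix (Fin n) (Fin n) ℝ) → ℚ) (l : List (SpecialLinearGroup (Fin n) ℤ)) :
    averaged f (l.map (γ * ·)) = averaged (fun L => f (L.map (act γ⁻¹))) l :=
  avg_map _ _ _ _ (fun g θ => vert_mul _ γ g θ) _

/-! ### Restriction to a subgroup -/

/-- The restriction of an averaged cochain to a subgroup. -/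
noncomputable def averagedOn (U : Subgroup (SpecialLinearGroup (Fin n) ℤ))
    (f : List (Matrix (Fin n) (Fin n) ℝ) → ℚ) (l : List U) : ℚ :=
  averaged f (l.map Subtype.val)

variable {U : Subgroup (SpecialLinearGroup (Fin n) ℤ)}

lemma averagedOn_congr {l : List U} (h : ∀ L, L.length = l.length → Good L → f L = g L) :
    averagedOn U f l = averagedOn U g l :=
  averaged_congr fun L hL => h L (by simpa using hL)

lemma averagedOn_d (f : List (Matrix (Fin n) (Fin n) ℝ) → ℚ) (l : List U) :
    averagedOn U (d f) l = d (averagedOn U f) l := by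
  rw [averagedOn, averaged_d, ← d_map]
  rfl

lemma averagedOn_map_mul (u : U) (l : List U) :
    averagedOn U f (l.map (u * ·)) = averagedOn U (fun L => f (L.map (act u.1⁻¹))) l := by
  rw [averagedOn, averagedOn, ← averaged_map_mul, List.map_map, List.map_map]
  rfl

lemma inv_averagedOn {H : Subgroup U} (h : ∀ u ∈ H, ∀ L, Good L → f (L.map (act u.1)) = f L) :
    Inv H (averagedOn U f) := fun u hu l => by
  rw [averagedOn_map_mul]
  exact averagedOn_congr fun L _ hL => h u⁻¹ (inv_mem hu) L hL

end CodimOne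

namespace CodimOne

open ListCochain

variable {n : ℕ} {p m ρ : ℕ}

/-! ### The polycyclic chain of unipotent groups -/

section Entries

variable {u y θ : SpecialLinearGroup (Fin n) ℤ}

lemma mul_left_apply {M : Matrix (Fin n) (Fin n) ℤ} (hθ : θ ∈ unip n p 1 0)
    (hM : ∀ a b : Fin n, (b ≤ a ∨ (b : ℕ) < m ∨ ((b : ℕ) = m ∧ ρ + 1 ≤ a)) → M a b = 0)
    {a b : Fin n} (h : b ≤ a ∨ (b : ℕ) < m ∨ ((b : ℕ) = m ∧ ρ ≤ a)) : (θ.1 * M) a b = M a b := by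
  rw [mul_apply, Finset.sum_eq_single a]
  · rw [unip_apply hθ (Or.inl le_rfl), if_pos rfl, one_mul]
  · intro c _ hc
    rcases lt_or_gt_of_ne hc with hca | hca
    · rw [unip_apply hθ (Or.inl hca.le), if_neg hc.symm, zero_mul]
    · have hca' : (a : ℕ) < c := hca
      rw [hM c b (by simp only [Fin.le_def] at *; omega), mul_zero]
  · simp

lemma mul_right_apply {M : Matrix (Fin n) (Fin n) ℤ} (hθ : θ ∈ unip n p 1 0)
    (hM : ∀ a b : Fin n, (b ≤ a ∨ (b : ℕ) < m ∨ ((b : ℕ) = m ∧ ρ + 1 ≤ a)) → M a b = 0)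
    {a b : Fin n} (h : b ≤ a ∨ (b : ℕ) < m ∨ ((b : ℕ) = m ∧ ρ ≤ a)) : (M * θ.1) a b = M a b := by
  rw [mul_apply, Finset.sum_eq_single b]
  · rw [unip_apply hθ (Or.inl le_rfl), if_pos rfl, mul_one]
  · intro c _ hc
    rcases lt_or_gt_of_ne hc with hca | hca
    · have hca' : (c : ℕ) < b := hca
      rw [hM a c (by simp only [Fin.le_def] at *; omega), zero_mul]
    · rw [unip_apply hθ (Or.inl hca.le), if_neg hc, mul_zero]
  · simp

lemma sub_one_apply (hu : u ∈ unip n p m ρ) (a b : Fin n)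
    (h : b ≤ a ∨ (b : ℕ) < m ∨ ((b : ℕ) = m ∧ ρ ≤ a)) : (u.1 - 1) a b = 0 := by
  rw [Matrix.sub_apply, unip_apply hu h, one_apply, sub_self]

lemma mul_apply_of_mem_unip (hu : u ∈ unip n p m (ρ + 1)) (hy : y ∈ unip n p 1 0) {a b : Fin n}
    (h : b ≤ a ∨ (b : ℕ) < m ∨ ((b : ℕ) = m ∧ ρ ≤ a)) :
    (u * y).1 a b = y.1 a b + (u.1 a b - if a = b then 1 else 0) := by
  have h1 : (u * y).1 = (u.1 - 1) * y.1 + y.1 := by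
    rw [Matrix.sub_mul, Matrix.one_mul, sub_add_cancel]
    rfl
  rw [h1, Matrix.add_apply, mul_right_apply hy (sub_one_apply hu) h, Matrix.sub_apply, one_apply]
  ring

lemma conj_apply (hu : u ∈ unip n p m (ρ + 1)) (hθ : θ ∈ unip n p 1 0) {a b : Fin n}
    (h : b ≤ a ∨ (b : ℕ) < m ∨ ((b : ℕ) = m ∧ ρ ≤ a)) : (θ * u * θ⁻¹).1 a b = u.1 a b := by
  have h1 : (θ * u * θ⁻¹).1 = θ.1 * ((u.1 - 1) * θ⁻¹.1) + 1 := by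
    have h2 : θ.1 * θ⁻¹.1 = 1 := congrArg Subtype.val (mul_inv_cancel θ)
    rw [Matrix.sub_mul, Matrix.mul_sub, Matrix.one_mul, h2, sub_add_cancel, ← Matrix.mul_assoc]
    rfl
  rw [h1, Matrix.add_apply, mul_left_apply hθ (fun c d hcd => ?_) h,
    mul_right_apply (inv_mem hθ) (sub_one_apply hu) h, Matrix.sub_apply, sub_add_cancel]
  rw [mul_right_apply (inv_mem hθ) (sub_one_apply hu) (by omega), sub_one_apply hu c d hcd]

lemma conj_mem_unip_succ (hu : u ∈ unip n p m (ρ + 1)) (hθ : θ ∈ unip n p 1 0) :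
    θ * u * θ⁻¹ ∈ unip n p m (ρ + 1) := by
  refine ⟨?_, fun a b h => ?_⟩
  · have h1 : red p (θ * u * θ⁻¹) = red p θ * red p u * red p θ⁻¹ := by rw [map_mul, map_mul]
    rw [h1, red_of_mem_unip hu, red_of_mem_unip hθ, red_of_mem_unip (inv_mem hθ)]
    simp
  · rw [conj_apply hu hθ (by omega), unip_apply hu h]

lemma mem_unip_of_succ (hu : u ∈ unip n p m (ρ + 1))
    (h : ∀ a b : Fin n, (a : ℕ) = ρ → (b : ℕ) = m → u.1 a b = if a = b then 1 else 0) :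
    u ∈ unip n p m ρ := by
  refine ⟨hu.1, fun a b hab => ?_⟩
  by_cases h1 : (a : ℕ) = ρ ∧ (b : ℕ) = m
  · exact h a b h1.1 h1.2
  · exact unip_apply hu (by omega)

lemma conj_mem_unip (hu : u ∈ unip n p m ρ) (hθ : θ ∈ unip n p 1 0) :
    θ * u * θ⁻¹ ∈ unip n p m ρ := by
  have hu' : u ∈ unip n p m (ρ + 1) := unip_le (Or.inr ⟨rfl, Nat.le_succ ρ⟩) hu
  refine mem_unip_of_succ (conj_mem_unip_succ hu' hθ) fun a b ha hb => ?_
  rw [conj_apply hu' hθ (by omega), unip_apply hu (by omega)]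

lemma unip_le_one (hm : 2 ≤ m) : unip n p m ρ ≤ unip n p 1 0 := unip_le (Or.inl hm)

/-- The entry of the topmost stage of `unip`, as a homomorphism. -/
def entryHom (n p m ρ : ℕ) (hm : 2 ≤ m) (hmn : m < n) (hρ : ρ < m) :
    unip n p m (ρ + 1) →* Multiplicative ℤ :=
  MonoidHom.mk' (fun u => Multiplicative.ofAdd (u.1.1 ⟨ρ, hρ.trans hmn⟩ ⟨m, hmn⟩)) fun u v => by
    rw [← ofAdd_add]
    congr 1
    have := mul_apply_of_mem_unip u.2 (unip_le_one hm v.2) (a := ⟨ρ, hρ.trans hmn⟩)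
      (b := ⟨m, hmn⟩) (Or.inr (Or.inr ⟨rfl, le_rfl⟩))
    rw [if_neg (by simp [Fin.ext_iff]; omega)] at this
    show (u.1 * v.1).1 _ _ = _
    rw [this]
    ring

end Entries

/-- The generator of `unip n p m (ρ + 1)` modulo `unip n p m ρ`. -/
def stepShear (n p m ρ : ℕ) : SpecialLinearGroup (Fin n) ℤ :=
  shear n p m (ρ + 1) (Pi.single (Fin.last ρ) 1)

lemma stepShear_mem : stepShear n p m ρ ∈ unip n p m (ρ + 1) := shear_mem_unip _

lemma stepShear_apply (hmn : m < n) (hρ : ρ < m) :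
    (stepShear n p m ρ).1 ⟨ρ, hρ.trans hmn⟩ ⟨m, hmn⟩ = p := by
  rw [stepShear, shear_apply, if_pos rfl, zvec, dif_pos ⟨by simp, hρ⟩]
  have : (⟨ρ, by simp⟩ : Fin (ρ + 1)) = Fin.last ρ := rfl
  simp [this]

lemma entryHom_stepShear (hm : 2 ≤ m) (hmn : m < n) (hρ : ρ < m) :
    entryHom n p m ρ hm hmn hρ ⟨stepShear n p m ρ, stepShear_mem⟩ = Multiplicative.ofAdd (p : ℤ) :=
  congrArg Multiplicative.ofAdd (stepShear_apply hmn hρ)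

lemma mem_unip_of_entryHom (hm : 2 ≤ m) (hmn : m < n) (hρ : ρ < m) {u : unip n p m (ρ + 1)}
    (hu : entryHom n p m ρ hm hmn hρ u = 1) : u.1 ∈ unip n p m ρ := by
  refine mem_unip_of_succ u.2 fun a b ha hb => ?_
  obtain rfl : a = ⟨ρ, hρ.trans hmn⟩ := Fin.ext ha
  obtain rfl : b = ⟨m, hmn⟩ := Fin.ext hb
  rw [if_neg (by simp [Fin.ext_iff]; omega)]
  exact Multiplicative.ofAdd.injective hu

lemma step_unip (hp : p ≠ 0) (hm : 2 ≤ m) (hmn : m < n) (hρ : ρ < m) :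
    Step ((unip n p m ρ).subgroupOf (unip n p 1 0)) ((unip n p m (ρ + 1)).subgroupOf (unip n p 1 0))
      ⟨stepShear n p m ρ, unip_le_one hm stepShear_mem⟩
      (fun y => y.1.1 ⟨ρ, hρ.trans hmn⟩ ⟨m, hmn⟩ / p) where
  normal := ⟨fun u hu θ => conj_mem_unip (θ := θ.1) hu θ.2⟩
  le := Subgroup.comap_mono (unip_le (Or.inr ⟨rfl, Nat.le_succ ρ⟩))
  mem := stepShear_mem
  le_sup := by
    intro u hu
    have hu' : u.1 ∈ unip n p m (ρ + 1) := hu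
    obtain ⟨c, hc⟩ : (p : ℤ) ∣ u.1.1 ⟨ρ, hρ.trans hmn⟩ ⟨m, hmn⟩ :=
      dvd_of_mem_unip hu' (by simp [Fin.ext_iff]; omega)
    set t : unip n p 1 0 := ⟨stepShear n p m ρ, unip_le_one hm stepShear_mem⟩
    have h1 : u * (t ^ c)⁻¹ ∈ (unip n p m ρ).subgroupOf (unip n p 1 0) := by
      have h2 := mem_unip_of_entryHom hm hmn hρ (p := p)
        (u := ⟨u.1, hu'⟩ * (⟨stepShear n p m ρ, stepShear_mem⟩ ^ c)⁻¹) (by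
          rw [map_mul, map_inv, map_zpow, entryHom_stepShear, ← ofAdd_zsmul, smul_eq_mul, mul_comm c,
            ← hc]
          exact mul_inv_cancel _)
      exact h2
    have h3 := mul_mem (S := Subgroup (unip n p 1 0)) (Subgroup.mem_sup_left
      (T := Subgroup.zpowers t) h1) (Subgroup.mem_sup_right (Subgroup.zpow_mem _
        (Subgroup.mem_zpowers t) c))
    rwa [inv_mul_cancel_right] at h3
  comm := by
    intro θ
    have h2 := mem_unip_of_entryHom hm hmn hρ (p := p)
      (u := ⟨_, conj_mem_unip_succ stepShear_mem θ.2⟩ * ⟨stepShear n p m ρ, stepShear_mem⟩⁻¹) (by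
        rw [map_mul, map_inv, mul_inv_eq_one]
        exact congrArg Multiplicative.ofAdd
          (conj_apply stepShear_mem θ.2 (Or.inr (Or.inr ⟨rfl, le_rfl⟩))))
    exact h2
  left := by
    intro u hu y
    have hu' : u.1 ∈ unip n p m ρ := hu
    have h1 := mul_apply_of_mem_unip (unip_le (Or.inr ⟨rfl, Nat.le_succ ρ⟩) hu') y.2
      (a := ⟨ρ, hρ.trans hmn⟩) (b := ⟨m, hmn⟩) (Or.inr (Or.inr ⟨rfl, le_rfl⟩))
    rw [unip_apply hu' (Or.inr (Or.inr ⟨rfl, le_rfl⟩)), sub_self, add_zero] at h1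
    exact congrArg (· / (p : ℤ)) h1
  shift := by
    intro y
    have h1 := mul_apply_of_mem_unip (stepShear_mem (m := m) (ρ := ρ)) y.2
      (a := ⟨ρ, hρ.trans hmn⟩) (b := ⟨m, hmn⟩) (Or.inr (Or.inr ⟨rfl, le_rfl⟩))
    rw [stepShear_apply hmn hρ, if_neg (by simp [Fin.ext_iff]; omega), sub_zero] at h1
    refine (congrArg (· / (p : ℤ)) h1).trans ?_
    exact Int.add_ediv_of_dvd_right (dvd_refl _) |>.trans (by
      rw [Int.ediv_self (by exact_mod_cast hp)])

lemma inv_stepShear_apply (hm : 2 ≤ m) (hmn : m < n) (hρ : ρ < m) :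
    (stepShear n p m ρ)⁻¹.1 ⟨ρ, hρ.trans hmn⟩ ⟨m, hmn⟩ = -p := by
  have := map_inv (entryHom n p m ρ hm hmn hρ) ⟨stepShear n p m ρ, stepShear_mem⟩
  rw [entryHom_stepShear, ← ofAdd_neg] at this
  exact Multiplicative.ofAdd.injective this

/-! ### Nontriviality of the product of column cochains -/

variable [NeZero n]

lemma columnSum_zero {L : List (Matrix (Fin n) (Fin n) ℝ)} (hL : L.length = 1) :
    columnSum p m 0 L = 1 := by
  rw [columnSum, finsum_unique, simplexSign_dim_zero]
  simpa using hL

/-- The vanishing range of `unip` and the nontriviality of a cochain. -/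
def Detects (p : ℕ) (H : Subgroup (SpecialLinearGroup (Fin n) ℤ)) (r : ℕ)
    (f : List (Matrix (Fin n) (Fin n) ℝ) → ℚ) : Prop :=
  Van r (H.subgroupOf (unip n p 1 0)) ∧
    ¬ Cob (H.subgroupOf (unip n p 1 0)) r (averagedOn (unip n p 1 0) f)

lemma Detects.congr {H : Subgroup (SpecialLinearGroup (Fin n) ℤ)} {r : ℕ}
    {f g : List (Matrix (Fin n) (Fin n) ℝ) → ℚ} (h : Detects p H r f)
    (hfg : ∀ L, L.length = r + 1 → f L = g L) : Detects p H r g := by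
  refine ⟨h.1, fun ⟨b, hb, hb0, hgb⟩ => h.2 ⟨b, hb, hb0, fun l hl => ?_⟩⟩
  rw [← hgb l hl]
  exact averagedOn_congr fun L hL _ => hfg L (hL.trans hl)

lemma Detects.step (hp : p ≠ 0) {k : ℕ} (hk : n - 1 - k = m) (hm : 2 ≤ m) (hρ : ρ < m)
    (h : Detects p (unip n p m ρ) (columnDegree n k + ρ)
      (cup (columnDegree n k) (columnProd p k) (columnSum p m ρ))) :
    Detects p (unip n p m (ρ + 1)) (columnDegree n k + (ρ + 1))
      (cup (columnDegree n k) (columnProd p k) (columnSum p m (ρ + 1))) := by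
  have hmn : m < n := by omega
  have hs := step_unip (n := n) hp hm hmn hρ
  refine ⟨hs.van h.1, hs.not_cob h.1 (b := averagedOn _ fun L => (-1) ^ columnDegree n k *
      cup (columnDegree n k) (columnProd p k) (fillSum p m ρ) L) ?_ ?_
    ((-1) ^ columnDegree n k * (-1) ^ (ρ + 1)) (by simp) ?_ h.2⟩
  · refine inv_averagedOn fun u hu L _ => ?_
    replace hu : u.1 ∈ unip n p m ρ := hu
    rw [cup_map, columnProd_map_act hp u.2, fillSum_map_act hp hu hρ hmn, cup]
  · intro l hl
    rw [← averagedOn_d]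
    refine averagedOn_congr fun L hL hG => ?_
    rw [d_smul, d_cup _ _ _ _ (by omega),
      d_columnProd hp k _ (hG.take _) (by rw [List.length_take]; omega),
      d_fillSum hp hρ hmn (hG.drop _), cup]
    have h2 : ((-1 : ℚ) ^ columnDegree n k) * (-1) ^ columnDegree n k = 1 := by
      rw [← mul_pow]; simp
    linear_combination (-(columnProd p k (L.take (columnDegree n k + 1)) *
        columnSum p m (ρ + 1) (L.drop (columnDegree n k)))) * h2
  · intro l hl
    rw [averagedOn_map_mul, averagedOn, averagedOn, ← averaged_sub, averagedOn, ← averaged_smul]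
    refine averaged_congr fun L hL hG => ?_
    have hu : (stepShear n p m ρ)⁻¹ ∈ unip n p m (ρ + 1) := inv_mem stepShear_mem
    obtain ⟨v, hv⟩ := exists_column hu hρ hmn
    have hv1 : v (Fin.last ρ) = -1 := by
      have h1 := (hv (Fin.last ρ)).symm.trans (inv_stepShear_apply hm hmn hρ)
      have h2 : (p : ℤ) ≠ 0 := by exact_mod_cast hp
      exact mul_left_cancel₀ h2 (by linarith)
    have h3 := fillSum_map_act_sub hp hu hρ hmn hv hv1 (hG.drop (columnDegree n k))
    rw [cup_map, columnProd_map_act hp (unip_le_one hm hu), cup, cup]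
    linear_combination ((-1) ^ columnDegree n k *
      columnProd p k (L.take (columnDegree n k + 1))) * h3

lemma detects_columnProd (hp : p ≠ 0) (k : ℕ) (hk : k + 2 ≤ n) :
    Detects p (unip n p (n - 1 - k) 0) (columnDegree n k) (columnProd p k) := by
  induction k with
  | zero =>
    have h0 : (unip n p (n - 1 - 0) 0).subgroupOf (unip n p 1 0) = ⊥ := by
      rw [eq_bot_iff]
      intro u hu
      have hu' : u.1 ∈ unip n p (n - 1 - 0) 0 := hu
      rw [Subgroup.mem_bot]
      refine Subtype.ext (Subtype.ext (Matrix.ext fun a b => ?_))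
      rw [unip_apply hu' (by omega)]
      rfl
    rw [Detects, h0]
    refine ⟨van_bot, fun ⟨b, _, hb0, h⟩ => ?_⟩
    have h1 := h [1] rfl
    rw [averagedOn, columnProd, averaged_const, d_cons, d_nil, hb0] at h1
    norm_num at h1
  | succ k ih =>
    have hm : 2 ≤ n - 1 - k := by omega
    have key : ∀ ρ ≤ n - 1 - k, Detects p (unip n p (n - 1 - k) ρ) (columnDegree n k + ρ)
        (cup (columnDegree n k) (columnProd p k) (columnSum p (n - 1 - k) ρ)) := by
      intro ρ hρ
      induction ρ with
      | zero =>
        refine (ih (by omega)).congr fun L hL => ?_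
        rw [cup, columnSum_zero (by rw [List.length_drop]; omega), mul_one, List.take_of_length_le
          (by omega)]
      | succ ρ ihρ => exact (ihρ (by omega)).step hp rfl hm (by omega)
    have h := key _ le_rfl
    have hle : unip n p (n - 1 - k) (n - 1 - k) = unip n p (n - 1 - (k + 1)) 0 := by
      ext u
      exact and_congr_right fun _ => forall₂_congr fun a b => by
        have : (b ≤ a ∨ (b : ℕ) < n - 1 - k ∨ ((b : ℕ) = n - 1 - k ∧ n - 1 - k ≤ a)) ↔
            (b ≤ a ∨ (b : ℕ) < n - 1 - (k + 1) ∨ ((b : ℕ) = n - 1 - (k + 1) ∧ 0 ≤ (a : ℕ))) := by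
          rw [Fin.le_def]
          omega
        rw [this]
    rw [hle] at h
    exact h

end CodimOne

namespace ListCochain

variable {X Y : Type*}

lemma prism_map (r s : X → Y) (φ : X → X) (ψ : Y → Y) (hr : ∀ x, r (φ x) = ψ (r x))
    (hs : ∀ x, s (φ x) = ψ (s x)) (f : List Y → ℚ) (l : List X) :
    prism r s f (l.map φ) = prism r s (fun l' => f (l'.map ψ)) l := by
  induction l generalizing f with
  | nil => rfl
  | cons a l ih =>
    simp only [List.map_cons, prism, hr, hs, ih, List.map_map]
    congr 3
    simp only [Function.comp_def, hs]

variable {U : Type*} [Group U]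

lemma Cob.add_smul {H : Subgroup U} {r : ℕ} {f g : List U → ℚ} (hf : Cob H r f) (c : ℚ)
    (hg : Cob H r g) : Cob H r (fun l => f l + c * g l) := by
  obtain ⟨b, hb, hb0, hfb⟩ := hf
  obtain ⟨b', hb', hb0', hgb⟩ := hg
  refine ⟨fun l => b l + c * b' l, hb.add (hb'.smul c), by simp [hb0, hb0'], fun l hl => ?_⟩
  beta_reduce
  rw [d_add, d_smul, hfb l hl, hgb l hl]

lemma cob_zero {H : Subgroup U} {r : ℕ} : Cob H r (fun _ => 0) :=
  ⟨fun _ => 0, fun _ _ _ => rfl, rfl, fun _ _ => by rw [d_zero]⟩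

lemma Cob.sum {ι : Type*} {H : Subgroup U} {r : ℕ} (s : Finset ι) (a : ι → ℚ)
    {f : ι → List U → ℚ} (hf : ∀ i ∈ s, Cob H r (f i)) :
    Cob H r (fun l => ∑ i ∈ s, a i * f i l) := by
  classical
  induction s using Finset.induction_on with
  | empty => simpa using cob_zero
  | insert i s hi ih =>
    have := (ih fun j hj => hf j (Finset.mem_insert_of_mem hj)).add_smul (a i)
      (hf i (Finset.mem_insert_self i s))
    simpa only [Finset.sum_insert hi, add_comm] using this

lemma Cob.congr {H : Subgroup U} {r : ℕ} {f g : List U → ℚ} (hf : Cob H r f)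
    (h : ∀ l, l.length = r + 1 → f l = g l) : Cob H r g := by
  obtain ⟨b, hb, hb0, hfb⟩ := hf
  exact ⟨b, hb, hb0, fun l hl => (h l hl).symm.trans (hfb l hl)⟩

end ListCochain

namespace CodimOne

open ListCochain

variable {n : ℕ} [NeZero n] {p N : ℕ}

/-- The cocycle on `SL_n(ℤ)` attached to a translate of the standard flag modulo `p`. -/
noncomputable def flagCocycle (p N : ℕ) (h : SpecialLinearGroup (Fin n) (ZMod p)) :
    List (SpecialLinearGroup (Fin n) ℤ) → ℚ := averaged (flagCochain p N h)

lemma flagCocycle_map_mul (hN : N + 2 = n) (γ : SpecialLinearGroup (Fin n) ℤ)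
    (h : SpecialLinearGroup (Fin n) (ZMod p)) (l : List (SpecialLinearGroup (Fin n) ℤ)) :
    flagCocycle p N h (l.map (γ * ·)) = flagCocycle p N ((red p γ)⁻¹ * h) l := by
  rw [flagCocycle, averaged_map_mul, flagCocycle]
  refine averaged_congr fun L _ _ => ?_
  rw [flagCochain_map_act hN.le (mem_blockSubgroup (fun b hb => absurd b.2 (by omega))
    fun a ha => absurd a.2 (by omega)), map_inv]

lemma d_flagCocycle (hN : N + 2 = n) (h : SpecialLinearGroup (Fin n) (ZMod p))
    {l : List (SpecialLinearGroup (Fin n) ℤ)} (hl : l.length = flagDegree N + 2) :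
    d (flagCocycle p N h) l = 0 := by
  rw [flagCocycle, ← averaged_d, ← averaged_const 0 l]
  exact averaged_congr fun L hL hG => d_flagCochain hN.le h hG (hL.trans hl)

/-- A condition on `h` under which `flagCochain` is trivial or a multiple of `columnProd` over the
unipotent group. -/
def Lower (h : SpecialLinearGroup (Fin n) (ZMod p)) : Prop :=
  ∀ j : Fin n, 2 ≤ (j : ℕ) → (∀ a < j, h.1 a j = 0) ∧ h.1 j j ≠ 0 ∧ h.1 j j ≠ -1

/-- The condition that `h` preserves the plane spanned by the first two basis vectors. -/
def KeepsPlane {R : Type*} [CommRing R] (h : SpecialLinearGroup (Fin n) R) : Prop :=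
  ∀ a b : Fin n, 2 ≤ (a : ℕ) → (b : ℕ) < 2 → h.1 a b = 0

lemma flagCocycle_eq_zero (hN : N + 2 = n) {h : SpecialLinearGroup (Fin n) (ZMod p)}
    (hh : ¬ KeepsPlane h⁻¹) (l : List (unip n p 1 0)) :
    flagCocycle p N h (l.map Subtype.val) = 0 := by
  rw [flagCocycle, ← averaged_const 0 (l.map Subtype.val)]
  refine averaged_congr_deep (by omega) (fun u hu => ?_) fun L _ hG hD => ?_
  · obtain ⟨u, -, rfl⟩ := List.mem_map.1 hu
    have h1 : ∀ b : Fin n, (b : ℕ) < 2 → u.1.1 *ᵥ Pi.single b 1 = Pi.single b 1 := by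
      intro b hb
      funext a
      rw [mulVec_single_one, col_apply, unip_apply u.2 (by omega), Pi.single_apply]
    rw [ofNat_eq (by omega), ofNat_eq (by omega)]
    exact ⟨h1 _ (by simp), h1 _ (by simp)⟩
  · by_contra hne
    rw [ofNat_eq (by omega), ofNat_eq (by omega)] at hD
    have hrv : ∀ b : Fin n, rv p (Pi.single b 1) = Pi.single b 1 := by
      intro b
      funext a
      simp only [rv, Pi.single_apply]
      split_ifs <;> simp
    have hs : ∀ b : Fin n, (b : ℕ) < 2 → ∀ a : Fin n, N + 2 ≤ a →
      (Pi.single b 1 : Fin n → ℤ) a = 0 := fun b _ a ha => absurd a.2 (by omega)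
    obtain ⟨h0, h1⟩ := flagCochain_mismatch hN.le hG.coer hD (hs _ (by simp)) (hs _ (by simp)) hne
    have hn0 : 0 < n := by omega
    have hn1 : 1 < n := by omega
    refine hh fun a b ha hb => ?_
    simp only [hrv, mulVec_single_one, col_apply] at h0 h1
    rcases Nat.lt_succ_iff_lt_or_eq.1 hb with hb' | hb'
    · obtain rfl : b = ⟨0, hn0⟩ := Fin.ext (by simpa using hb')
      exact h0 a ha
    · obtain rfl : b = ⟨1, hn1⟩ := Fin.ext hb'
      exact h1 a ha

lemma columnDegree_eq (hN : N + 2 = n) : columnDegree n N = flagDegree N := by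
  have : ∀ k i, i + k = N → flagDegree i + columnDegree n k = flagDegree N := by
    intro k
    induction k with
    | zero =>
      rintro i rfl
      rfl
    | succ k ih =>
      intro i hi
      rw [← ih (i + 1) (by omega), flagDegree, columnDegree, show n - 1 - k = i + 2 by omega]
      ring
  rw [← this N 0 (by omega), flagDegree, zero_add]

lemma cob_flagCocycle_sub (hp : p ≠ 0) (hN : N + 2 = n) {h : SpecialLinearGroup (Fin n) (ZMod p)}
    (hh : Lower h) : ∃ c : ℚ, (h ∈ blockSubgroup n (ZMod p) 2 → c = 1) ∧
      (h ∉ blockSubgroup n (ZMod p) 2 → c = 0) ∧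
      Cob (⊤ : Subgroup (unip n p 1 0)) (flagDegree N) (fun l =>
        flagCocycle p N h (l.map Subtype.val) -
          c * averagedOn (unip n p 1 0) (columnProd p N) l) := by
  classical
  have hc : ∀ L : List (Matrix (Fin n) (Fin n) ℝ), flagCochain p 0 h L =
    if h ∈ blockSubgroup n (ZMod p) 2 then 1 else 0 := fun L => by
      simp only [flagCochain]
  refine ⟨if h ∈ blockSubgroup n (ZMod p) 2 then 1 else 0, fun h => if_pos h, fun h => if_neg h, ?_⟩
  rcases Nat.eq_zero_or_pos N with rfl | h0
  · refine cob_zero.congr fun l _ => ?_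
    rw [flagCocycle, averagedOn, ← averaged_smul, ← averaged_sub]
    refine (averaged_const 0 (l.map Subtype.val)).symm.trans (averaged_congr fun L _ _ => ?_)
    rw [hc, columnProd]
    ring
  · obtain ⟨B, hB, hE⟩ := (exists_flagCochain_eq hp hh hN N 0 (by omega)).2
    have hd : flagDegree N ≠ 0 := by
      obtain ⟨N, rfl⟩ := Nat.exists_eq_succ_of_ne_zero h0.ne'
      simp [flagDegree]
    refine ⟨trunc (flagDegree N) (averagedOn _ B),
      (inv_averagedOn fun u _ L _ => hB _ u.2 L).trunc _, ?_, fun l hl => ?_⟩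
    · rw [trunc, if_neg (by simpa using hd.symm)]
    · rw [d_trunc _ _ _ hl, ← averagedOn_d, flagCocycle]
      simp only [averagedOn]
      rw [← averaged_smul, ← averaged_sub]
      refine averaged_congr fun L hL hG => ?_
      have hL' : L.length = flagDegree N + 1 := by
        rw [hL, List.length_map, hl]
      rw [hE L hG hL', cup, hc, columnDegree_eq hN, List.take_of_length_le hL'.le]
      ring

lemma not_cob_columnProd (hp : p ≠ 0) (hN : N + 2 = n) :
    ¬ Cob (⊤ : Subgroup (unip n p 1 0)) (flagDegree N)
      (averagedOn (unip n p 1 0) (columnProd p N)) := by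
  have h := (detects_columnProd hp N hN.le).2
  rwa [show n - 1 - N = 1 by omega, Subgroup.subgroupOf_self, columnDegree_eq hN] at h

/-- The cocycles attached to suitably separated translates are independent on the congruence
subgroup. -/
lemma coeff_eq_zero (hp : 2 < p) [Fact p.Prime] (hN : N + 2 = n) {ι : Type*} (s : Finset ι)
    (a : ι → ℚ) (γ : ι → SpecialLinearGroup (Fin n) ℤ) {b : List (congruenceSubgroup n p) → ℚ}
    (hb : Inv ⊤ b) (hb0 : b [] = 0)
    (hab : ∀ l : List (congruenceSubgroup n p), l.length = flagDegree N + 1 →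
      ∑ i ∈ s, a i * flagCocycle p N (red p (γ i)) (l.map Subtype.val) = d b l)
    {j : ι} (hj : j ∈ s) (hs : ∀ i ∈ s, i ≠ j →
      ¬ KeepsPlane ((red p (γ j))⁻¹ * red p (γ i))⁻¹ ∨
      (Lower ((red p (γ j))⁻¹ * red p (γ i)) ∧
        (red p (γ j))⁻¹ * red p (γ i) ∉ blockSubgroup n (ZMod p) 2)) : a j = 0 := by
  have hp0 : p ≠ 0 := by omega
  set U := unip n p 1 0 with hU
  set Φ : List (SpecialLinearGroup (Fin n) ℤ) → ℚ := fun l =>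
    ∑ i ∈ s, a i * flagCocycle p N (red p (γ i)) l with hΦ
  have hΦd : ∀ l : List (SpecialLinearGroup (Fin n) ℤ), l.length = flagDegree N + 2 →
      d Φ l = 0 := by
    intro l hl
    rw [hΦ, d_sum]
    refine Finset.sum_eq_zero fun i _ => ?_
    rw [d_smul, d_flagCocycle hN _ hl, mul_zero]
  have hrU : ∀ u : U, red p (γ j * u.1 * (γ j)⁻¹) = 1 := by
    intro u
    have h1 : red p (γ j * u.1 * (γ j)⁻¹) = red p (γ j) * red p u.1 * red p (γ j)⁻¹ := by
      rw [map_mul, map_mul]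
    rw [h1, red_of_mem_unip u.2, mul_one, map_inv, mul_inv_cancel]
  let r' : U → congruenceSubgroup n p := fun u => ⟨γ j * u.1 * (γ j)⁻¹, hrU u⟩
  let r : U → SpecialLinearGroup (Fin n) ℤ := fun u => (r' u).1
  let t : U → SpecialLinearGroup (Fin n) ℤ := fun u => γ j * u.1
  have hcob : Cob (⊤ : Subgroup U) (flagDegree N) (fun l => Φ (l.map t)) := by
    refine ⟨fun l => prism r t Φ l + b (l.map r'), ?_, by simp [prism, hb0], fun l hl => ?_⟩
    · refine Inv.add (fun u _ l => ?_) fun u _ l => ?_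
      · rw [prism_map r t (u * ·) (r u * ·) (fun x => ?_) fun x => ?_]
        · congr 1
          funext l'
          refine Finset.sum_congr rfl fun i _ => ?_
          rw [flagCocycle_map_mul hN, hrU, inv_one, one_mul]
        · show γ j * (u.1 * x.1) * (γ j)⁻¹ = γ j * u.1 * (γ j)⁻¹ * (γ j * x.1 * (γ j)⁻¹)
          group
        · show γ j * (u.1 * x.1) = γ j * u.1 * (γ j)⁻¹ * (γ j * x.1)
          group
      · refine Eq.trans ?_ (hb (r' u) trivial (l.map r'))
        rw [List.map_map, List.map_map]
        congr 1
        refine List.map_congr_left fun x _ => Subtype.ext ?_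
        show γ j * (u.1 * x.1) * (γ j)⁻¹ = γ j * u.1 * (γ j)⁻¹ * (γ j * x.1 * (γ j)⁻¹)
        group
    · have h1 : d (fun l => b (l.map r')) l = Φ (l.map r) := by
        rw [d_map, ← hab _ (by simpa using hl), hΦ, List.map_map]
        rfl
      have h2 : prism r t (d Φ) l = 0 :=
        (prism_congr r t fun l' hl' => hΦd l' (by omega)).trans (prism_zero r t l)
      rw [d_add, h1, d_prism r t Φ l (by rintro rfl; simp at hl), h2]
      ring
  have hΦt : ∀ l : List U, Φ (l.map t) = ∑ i ∈ s, a i *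
      flagCocycle p N ((red p (γ j))⁻¹ * red p (γ i)) (l.map Subtype.val) := by
    intro l
    refine Finset.sum_congr rfl fun i _ => ?_
    rw [← flagCocycle_map_mul hN, List.map_map]
    rfl
  have hone : Lower (1 : SpecialLinearGroup (Fin n) (ZMod p)) := by
    have : Fact (2 < p) := ⟨hp⟩
    refine fun j _ => ⟨fun a ha => one_apply_ne ha.ne, ?_⟩
    rw [show (1 : SpecialLinearGroup (Fin n) (ZMod p)).1 j j = 1 from one_apply_eq j]
    exact ⟨one_ne_zero, (ZMod.neg_one_ne_one).symm⟩
  classical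
  have key : ∀ i ∈ s, Cob (⊤ : Subgroup U) (flagDegree N) (fun l =>
      flagCocycle p N ((red p (γ j))⁻¹ * red p (γ i)) (l.map Subtype.val) -
        (if i = j then 1 else 0) * averagedOn U (columnProd p N) l) := by
    intro i hi
    by_cases hij : i = j
    · obtain ⟨c, hc, -, h⟩ := cob_flagCocycle_sub hp0 hN hone
      rw [hc (one_mem _)] at h
      rwa [hij, inv_mul_cancel, if_pos rfl]
    · rw [if_neg hij]
      rcases hs i hi hij with h | ⟨h, h'⟩
      · refine cob_zero.congr fun l _ => ?_
        rw [flagCocycle_eq_zero hN h]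
        ring
      · obtain ⟨c, -, hc, h⟩ := cob_flagCocycle_sub hp0 hN h
        rwa [hc h'] at h
  by_contra hne
  refine not_cob_columnProd (n := n) hp0 hN ?_
  have h1 := (cob_zero.add_smul (a j)⁻¹ (hcob.add_smul (-1) (Cob.sum s a key)))
  refine h1.congr fun l _ => ?_
  rw [hΦt]
  simp only [mul_sub, Finset.sum_sub_distrib]
  simp [Finset.sum_ite_eq', hj]
  field_simp
  rfl

end CodimOne

namespace ListCochain

open CategoryTheory

variable {G : Type} [Group G]

lemma d_ofFn {Y : Type*} {k : ℕ} (f : List Y → ℚ) (x : Fin (k + 1) → Y) :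
    d f (List.ofFn x) =
      ∑ j : Fin (k + 1), (-1) ^ (j : ℕ) * f (List.ofFn fun i : Fin k => x (j.succAbove i)) := by
  induction k generalizing f with
  | zero => simp [d_cons]
  | succ k ih =>
    rw [List.ofFn_succ, d_cons, ih, Fin.sum_univ_succ (n := k + 1), sub_eq_add_neg,
      ← Finset.sum_neg_distrib]
    congr 1
    · simp
    · refine Finset.sum_congr rfl fun j _ => ?_
      rw [Fin.val_succ, pow_succ, List.ofFn_succ (f := fun i => x (j.succ.succAbove i))]
      simp only [Fin.succ_succAbove_zero, Fin.succ_succAbove_succ]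
      ring

/-- The inhomogeneous cochain attached to a homogeneous one. -/
def inhomogeneous (k : ℕ) (F : List G → ℚ) (g : Fin k → G) : ℚ := F (List.ofFn (Fin.partialProd g))

lemma map_mul_ofFn {k : ℕ} (a : G) (x : Fin k → G) :
    (List.ofFn x).map (a * ·) = List.ofFn fun i => a * x i := by
  rw [List.map_ofFn]
  rfl

lemma ofFn_eq_map {k : ℕ} (x : Fin (k + 1) → G) :
    List.ofFn x =
      (List.ofFn (Fin.partialProd fun i : Fin k => (x i.castSucc)⁻¹ * x i.succ)).map (x 0 * ·) := by
  rw [map_mul_ofFn]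
  exact congrArg List.ofFn (Fin.partialProd_left_inv x).symm

lemma d_inhomogeneous {k : ℕ} {F : List G → ℚ} (hF : Inv ⊤ F) :
    (inhomogeneousCochains.d (Rep.trivial ℚ G ℚ) k).hom (inhomogeneous k F) =
      inhomogeneous (k + 1) (d F) := by
  funext g
  rw [inhomogeneousCochains.d_hom_apply, inhomogeneous, inhomogeneous, d_ofFn,
    Fin.sum_univ_succ (n := k + 1)]
  congr 1
  · show F _ = _
    rw [Fin.val_zero, pow_zero, one_mul, ← hF (g 0) trivial, map_mul_ofFn]
    congr 2
    funext i
    exact (Fin.partialProd_succ' g i).symm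
  · refine Finset.sum_congr rfl fun j _ => ?_
    rw [inhomogeneous, Fin.partialProd_contractNth, Fin.val_succ]
    rfl

/-- The homogeneous cochain attached to an inhomogeneous one. -/
def homogeneous (k : ℕ) (f : (Fin k → G) → ℚ) (l : List G) : ℚ :=
  if l.length = k + 1 then f fun i => (l.getD i 1)⁻¹ * l.getD (i + 1) 1 else 0

lemma inv_homogeneous (k : ℕ) (f : (Fin k → G) → ℚ) : Inv ⊤ (homogeneous k f) := by
  intro a _ l
  rw [homogeneous, homogeneous, List.length_map]
  split_ifs with h
  · congr 1
    funext i
    have h1 : ∀ m, m < l.length → (l.map (a * ·)).getD m 1 = a * l.getD m 1 := by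
      intro m hm
      simp [List.getD_eq_getElem?_getD, hm]
    rw [h1 _ (by omega), h1 _ (by omega)]
    group
  · rfl

lemma homogeneous_nil (k : ℕ) (f : (Fin k → G) → ℚ) : homogeneous k f [] = 0 := by
  simp [homogeneous]

lemma inhomogeneous_homogeneous (k : ℕ) (f : (Fin k → G) → ℚ) :
    inhomogeneous k (homogeneous k f) = f := by
  funext g
  rw [inhomogeneous, homogeneous, if_pos (List.length_ofFn)]
  congr 1
  funext i
  rw [← Fin.partialProd_right_inv g i]
  have h1 : ∀ m (hm : m < k + 1), (List.ofFn (Fin.partialProd g)).getD m 1 =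
    Fin.partialProd g ⟨m, hm⟩ := by
      intro m hm
      simp [List.getD_eq_getElem?_getD, hm, -List.ofFn_succ]
  rw [h1 _ (by omega), h1 _ (by omega)]
  rfl

lemma eq_of_inhomogeneous_eq {k : ℕ} {F F' : List G → ℚ} (hF : Inv ⊤ F) (hF' : Inv ⊤ F')
    (h : inhomogeneous k F = inhomogeneous k F') {l : List G} (hl : l.length = k + 1) :
    F l = F' l := by
  obtain ⟨x, rfl⟩ : ∃ x : Fin (k + 1) → G, l = List.ofFn x :=
    ⟨fun i => l.get (i.cast hl.symm), by
      refine List.ext_getElem (by simpa using hl) fun i h1 h2 => by simp [-List.ofFn_succ]⟩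
  rw [ofFn_eq_map, hF _ trivial, hF' _ trivial]
  exact congrFun h _

lemma exists_d_eq_of_homologyπ_eq_zero (K : CochainComplex (ModuleCat ℚ) ℕ) {i k : ℕ}
    (hi : (ComplexShape.up ℕ).prev k = i) (z : K.cycles k) (hz : K.homologyπ k z = 0) :
    ∃ w : K.X i, K.d i k w = K.iCycles k z := by
  have h := (ShortComplex.mk _ _ (K.toCycles_comp_homologyπ i k)).exact_of_g_is_cokernel
    (K.homologyIsCokernel i k hi)
  obtain ⟨w, hw⟩ := (ShortComplex.moduleCat_exact_iff _).1 h z hz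
  refine ⟨w, ?_⟩
  rw [← K.toCycles_i]
  exact congrArg (K.iCycles k) hw

/-- A relation among cohomology classes is a coboundary relation among homogeneous cocycles. -/
lemma exists_cob_of_sum_eq_zero {ι : Type*} (s : Finset ι) (a : ι → ℚ) {k : ℕ}
    {F : ι → List G → ℚ} (hF : ∀ i, Inv ⊤ (F i))
    (hd : ∀ i, (inhomogeneousCochains.d (Rep.trivial ℚ G ℚ) k).hom (inhomogeneous k (F i)) = 0)
    (h : ∑ i ∈ s, a i • groupCohomology.π (Rep.trivial ℚ G ℚ) k
      (groupCohomology.cocyclesMk (inhomogeneous k (F i)) (hd i)) = 0) :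
    Cob ⊤ k (fun l => ∑ i ∈ s, a i * F i l) := by
  have hs : Inv ⊤ (fun l => ∑ i ∈ s, a i * F i l) := fun g hg l =>
    Finset.sum_congr rfl fun i _ => by rw [hF i g hg]
  simp only [← map_smul, ← map_sum] at h
  have key : ∀ i, (ComplexShape.up ℕ).prev k = i →
      ∃ w, (groupCohomology.inhomogeneousCochains (Rep.trivial ℚ G ℚ)).d i k w =
        inhomogeneous k (fun l => ∑ i ∈ s, a i * F i l) := by
    intro i hi
    obtain ⟨w, hw⟩ := exists_d_eq_of_homologyπ_eq_zero _ hi _ h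
    refine ⟨w, ?_⟩
    rw [hw, map_sum]
    have h1 : ∀ i ∈ s, groupCohomology.iCocycles (Rep.trivial ℚ G ℚ) k
        (a i • groupCohomology.cocyclesMk (inhomogeneous k (F i)) (hd i)) =
          a i • inhomogeneous k (F i) := by
      intro i _
      rw [map_smul, groupCohomology.iCocycles_mk]
    refine (Finset.sum_congr rfl h1).trans ?_
    funext g
    simp only [inhomogeneous, Finset.sum_apply, Pi.smul_apply, smul_eq_mul]
  rcases k with _ | k
  · obtain ⟨w, hw⟩ := key 0 CochainComplex.prev_nat_zero
    refine cob_zero.congr fun l hl => ?_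
    rw [HomologicalComplex.shape _ _ _ (by simp)] at hw
    exact eq_of_inhomogeneous_eq (k := 0) (F := fun _ => 0) (fun _ _ _ => rfl) hs hw hl
  · obtain ⟨w, hw⟩ := key k (CochainComplex.prev_nat_succ k)
    refine ⟨homogeneous k w, inv_homogeneous k w, homogeneous_nil k w, fun l hl => ?_⟩
    refine eq_of_inhomogeneous_eq hs (inv_homogeneous k w).d ?_ hl
    rw [← d_inhomogeneous (inv_homogeneous k w), inhomogeneous_homogeneous, ← hw,
      groupCohomology.inhomogeneousCochains.d_def]

end ListCochain

namespace CodimOne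

section surjective

variable {n p : ℕ}

lemma transvection_mem_range {i j : Fin n} (hij : i ≠ j) (c : ZMod p) :
    SpecialLinearGroup.transvection hij c ∈ (red (n := n) p).range := by
  obtain ⟨c, rfl⟩ := ZMod.intCast_surjective c
  refine ⟨SpecialLinearGroup.transvection hij c, Subtype.ext (Matrix.ext fun a b => ?_)⟩
  rw [red_apply]
  simp only [SpecialLinearGroup.transvection_coe, Matrix.add_apply, Matrix.one_apply,
    Matrix.single_apply]
  split_ifs <;> simp

lemma mem_range_of_eq {i j : Fin n} [Fact p.Prime] (hij : i ≠ j) {t : ZMod p} (ht : t ≠ 0)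
    {σ : SpecialLinearGroup (Fin n) (ZMod p)}
    (hσ : σ.1 = 1 + single i i (t - 1) + single j j (t⁻¹ - 1)) : σ ∈ (red (n := n) p).range := by
  have h : σ = SpecialLinearGroup.transvection hij t *
      SpecialLinearGroup.transvection hij.symm (-t⁻¹) * SpecialLinearGroup.transvection hij t *
      (SpecialLinearGroup.transvection hij (-1) *
      SpecialLinearGroup.transvection hij.symm 1 * SpecialLinearGroup.transvection hij (-1)) := by
    refine Subtype.ext (hσ.trans ?_)
    show _ = (1 + single i j t) * (1 + single j i (-t⁻¹)) * (1 + single i j t) *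
      ((1 + single i j (-1)) * (1 + single j i 1) * (1 + single i j (-1)))
    simp only [mul_add, add_mul, one_mul, mul_one, single_mul_single_same,
      single_mul_single_of_ne _ _ _ _ hij, single_mul_single_of_ne _ _ _ _ hij.symm]
    ext a b
    simp only [Matrix.add_apply, Matrix.one_apply, Matrix.single_apply, Matrix.zero_apply]
    have := hij.symm
    by_cases h1 : i = a <;> by_cases h2 : j = a <;> by_cases h3 : i = b <;> by_cases h4 : j = b <;>
      subst_vars <;> simp_all
  rw [h]
  exact mul_mem (mul_mem (mul_mem (transvection_mem_range _ _) (transvection_mem_range _ _))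
    (transvection_mem_range _ _)) (mul_mem (mul_mem (transvection_mem_range _ _)
    (transvection_mem_range _ _)) (transvection_mem_range _ _))

lemma diagonal_mem_range [NeZero n] [Fact p.Prime] (S : Finset (Fin n))
    {σ : SpecialLinearGroup (Fin n) (ZMod p)} {D : Fin n → ZMod p} (hσ : σ.1 = diagonal D)
    (hD : ∀ a ∉ S, a ≠ 0 → D a = 1) : σ ∈ (red (n := n) p).range := by
  induction S using Finset.induction_on generalizing σ D with
  | empty =>
    have hdet := σ.2
    rw [hσ, det_diagonal, Finset.prod_eq_single 0 (fun a _ ha => hD a (by simp) ha)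
      (by simp)] at hdet
    have : σ = 1 := by
      refine Subtype.ext ((hσ.trans ?_).trans diagonal_one)
      congr 1
      funext a
      by_cases ha : a = 0
      · rw [ha, hdet]
      · exact hD a (by simp) ha
    rw [this]
    exact one_mem _
  | insert j S hj ih =>
    by_cases hj0 : j = 0
    · exact ih hσ fun a ha ha0 => hD a (by simp [ha, ha0, hj0]) ha0
    have hDj : D j ≠ 0 := by
      have hdet := σ.2
      rw [hσ, det_diagonal] at hdet
      intro h0
      rw [Finset.prod_eq_zero (Finset.mem_univ j) h0] at hdet
      exact zero_ne_one hdet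
    have hone : (1 : Matrix (Fin n) (Fin n) (ZMod p)) + single 0 0 (D j - 1) +
        single j j ((D j)⁻¹ - 1) =
        diagonal (fun a => if a = 0 then D j else if a = j then (D j)⁻¹ else 1) := by
      ext a b
      by_cases hab : a = b
      · subst hab
        by_cases h1 : a = 0 <;> by_cases h2 : a = j <;>
          simp_all [Matrix.single_apply, Matrix.add_apply, eq_comm]
      · have : ∀ c x, single (α := ZMod p) c c x a b = 0 := by
          intro c x
          rw [Matrix.single_apply, if_neg]
          rintro ⟨rfl, rfl⟩
          exact hab rfl
        simp [this, hab]
    have hdet : det ((1 : Matrix (Fin n) (Fin n) (ZMod p)) + single 0 0 (D j - 1) +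
        single j j ((D j)⁻¹ - 1)) = 1 := by
      rw [hone, det_diagonal]
      rw [← Finset.mul_prod_erase _ _ (Finset.mem_univ 0),
        ← Finset.mul_prod_erase _ _ (Finset.mem_erase.2 ⟨hj0, Finset.mem_univ j⟩),
        Finset.prod_eq_one]
      · simp [hj0, hDj]
      · intro a ha
        simp only [Finset.mem_erase] at ha
        simp [ha]
    have hτ := mem_range_of_eq (σ := ⟨_, hdet⟩) (p := p) (Ne.symm hj0) hDj rfl
    refine (Subgroup.mul_mem_cancel_left _ hτ).1 (ih (D := fun a =>
      (if a = 0 then D j else if a = j then (D j)⁻¹ else 1) * D a) ?_ ?_)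
    · show _ * σ.1 = _
      rw [hσ]
      show (1 + single 0 0 (D j - 1) + single j j ((D j)⁻¹ - 1)) * _ = _
      rw [hone, diagonal_mul_diagonal]
    · intro a ha ha0
      by_cases haj : a = j
      · simp [haj, hj0, hDj]
      · simp [haj, ha0, hD a (by simp [ha, haj]) ha0]

lemma red_surjective [NeZero n] [Fact p.Prime] : Function.Surjective (red (n := n) p) := by
  rw [← MonoidHom.range_eq_top, eq_top_iff]
  rintro σ -
  obtain ⟨L, L', D, hD⟩ := Pivot.exists_list_transvec_mul_diagonal_mul_list_transvec σ.1
  have hL : ∀ L : List (TransvectionStruct (Fin n) (ZMod p)),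
      ∃ τ ∈ (red (n := n) p).range, τ.1 = (L.map TransvectionStruct.toMatrix).prod := by
    intro L
    induction L with
    | nil => exact ⟨1, one_mem _, rfl⟩
    | cons t L ih =>
      obtain ⟨τ, hτ, h⟩ := ih
      refine ⟨t.toSpecialLinearGroup * τ, mul_mem (transvection_mem_range _ _) hτ, ?_⟩
      show t.toMatrix * τ.1 = _
      rw [h, List.map_cons, List.prod_cons]
  obtain ⟨τ, hτ, h⟩ := hL L
  obtain ⟨τ', hτ', h'⟩ := hL L'
  rw [← h, ← h'] at hD
  have hdet := congrArg det hD
  rw [det_mul, det_mul, τ.2, τ'.2, one_mul, mul_one, σ.2] at hdet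
  have h1 : σ = τ * ⟨diagonal D, hdet.symm⟩ * τ' := Subtype.ext hD
  rw [h1]
  exact mul_mem (mul_mem hτ (diagonal_mem_range Finset.univ rfl (by simp))) hτ'

end surjective

end CodimOne

namespace CodimOne

section plane

variable {n N : ℕ} {R F : Type*} [CommRing R] [Field F]

lemma blockTriangular_inv {α : Type*} [LinearOrder α] {b : Fin n → α}
    {σ : SpecialLinearGroup (Fin n) R} (h : BlockTriangular σ.1 b) :
    BlockTriangular (σ⁻¹).1 b := by
  have h1 : (σ⁻¹).1 * σ.1 = 1 := congrArg Subtype.val (inv_mul_cancel σ)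
  have h2 : σ.1 * (σ⁻¹).1 = 1 := congrArg Subtype.val (mul_inv_cancel σ)
  let _ : Invertible σ.1 := ⟨(σ⁻¹).1, h1, h2⟩
  rw [← Matrix.inv_eq_left_inv h1]
  exact blockTriangular_inv_of_blockTriangular h

lemma keepsPlane_iff {σ : SpecialLinearGroup (Fin n) R} :
    KeepsPlane σ ↔ BlockTriangular σ.1 (fun a : Fin n => min (a : ℕ) 2 / 2) := by
  constructor
  · intro h a b hab
    have hab' : min (b : ℕ) 2 / 2 < min (a : ℕ) 2 / 2 := hab
    exact h a b (by omega) (by omega)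
  · intro h a b ha hb
    exact h (show min (b : ℕ) 2 / 2 < min (a : ℕ) 2 / 2 by omega)

lemma KeepsPlane.inv {σ : SpecialLinearGroup (Fin n) R} (h : KeepsPlane σ) : KeepsPlane σ⁻¹ :=
  keepsPlane_iff.2 (blockTriangular_inv (keepsPlane_iff.1 h))

lemma KeepsPlane.mul {σ τ : SpecialLinearGroup (Fin n) R} (h : KeepsPlane σ) (h' : KeepsPlane τ) :
    KeepsPlane (σ * τ) :=
  keepsPlane_iff.2 (BlockTriangular.mul (keepsPlane_iff.1 h) (keepsPlane_iff.1 h'))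

/-- The matrix `g` takes the plane spanned by the first two basis vectors to `W`. -/
def MapsPlane (g : SpecialLinearGroup (Fin n) R) (W : Submodule R (Fin n → R)) : Prop :=
  ∀ v, v ∈ W ↔ ∀ a : Fin n, 2 ≤ (a : ℕ) → ((g⁻¹).1 *ᵥ v) a = 0

lemma MapsPlane.le {g g' : SpecialLinearGroup (Fin n) R} {W W' : Submodule R (Fin n → R)}
    (hg : MapsPlane g W) (hg' : MapsPlane g' W') (h : KeepsPlane (g'⁻¹ * g)) : W ≤ W' := by
  intro v hv
  refine (hg' v).2 fun a ha => ?_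
  have h1 : (g'⁻¹).1 = (g'⁻¹ * g).1 * (g⁻¹).1 := by
    have : g'⁻¹ = g'⁻¹ * g * g⁻¹ := by group
    exact congrArg Subtype.val this
  rw [h1, ← mulVec_mulVec, mulVec, dotProduct]
  refine Finset.sum_eq_zero fun b _ => ?_
  by_cases hb : 2 ≤ (b : ℕ)
  · rw [(hg v).1 hv b hb, mul_zero]
  · rw [h a b ha (by omega), zero_mul]

lemma exists_mapsPlane {W : Submodule F (Fin (N + 2) → F)} (hW : Module.finrank F W = 2) :
    ∃ g : SpecialLinearGroup (Fin (N + 2)) F, MapsPlane g W := by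
  classical
  obtain ⟨C, hC⟩ := W.exists_isCompl
  have hCN : Module.finrank F C = N := by
    have := Submodule.finrank_add_eq_of_isCompl hC
    rw [hW, Module.finrank_fin_fun] at this
    omega
  let E := (W.prodEquivOfIsCompl C hC).symm
  let ψ : W ≃ₗ[F] (Fin 2 → F) := LinearEquiv.ofFinrankEq _ _ (by simp [hW])
  let φ : C ≃ₗ[F] (Fin N → F) := LinearEquiv.ofFinrankEq _ _ (by simp [hCN])
  let f : (Fin (N + 2) → F) →ₗ[F] (Fin (N + 2) → F) := LinearMap.pi fun a =>
    if h : (a : ℕ) < 2 then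
      LinearMap.proj ⟨a, h⟩ ∘ₗ ψ.toLinearMap ∘ₗ LinearMap.fst F W C ∘ₗ E.toLinearMap
    else LinearMap.proj ⟨a - 2, by omega⟩ ∘ₗ φ.toLinearMap ∘ₗ LinearMap.snd F W C ∘ₗ E.toLinearMap
  have hf1 : ∀ v (i : Fin 2), f v ⟨i, by omega⟩ = ψ (E v).1 i := by
    intro v i
    simp [f, show (i : ℕ) ≤ 1 by omega]
  have hf2 : ∀ v (i : Fin N), f v ⟨i + 2, by omega⟩ = φ (E v).2 i := by
    intro v i
    simp [f]
  have hfW : ∀ v, v ∈ W ↔ ∀ a : Fin (N + 2), 2 ≤ (a : ℕ) → f v a = 0 := by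
    intro v
    rw [← Submodule.prodEquivOfIsCompl_symm_apply_snd_eq_zero W C hC, ← φ.map_eq_zero_iff]
    constructor
    · intro h a ha
      have := (hf2 v ⟨a - 2, by omega⟩).trans (congrFun h _)
      simpa [Nat.sub_add_cancel ha] using this
    · intro h
      funext i
      exact (hf2 v i).symm.trans (h _ (by simp))
  have hdet : (LinearMap.toMatrix' f).det ≠ 0 := by
    intro h0
    obtain ⟨v, hv, hv0⟩ := Matrix.exists_mulVec_eq_zero_iff.2 h0
    rw [LinearMap.toMatrix'_mulVec] at hv0
    refine hv (E.map_eq_zero_iff.1 (Prod.ext (ψ.map_eq_zero_iff.1 ?_) (φ.map_eq_zero_iff.1 ?_)))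
    · funext i
      exact (hf1 v i).symm.trans (congrFun hv0 _)
    · funext i
      exact (hf2 v i).symm.trans (congrFun hv0 _)
  let M := diagonal (fun a : Fin (N + 2) => if a = 0 then (LinearMap.toMatrix' f).det⁻¹ else 1) *
    LinearMap.toMatrix' f
  have hM : M.det = 1 := by
    rw [det_mul, det_diagonal, Finset.prod_ite_eq' Finset.univ 0, if_pos (Finset.mem_univ _),
      inv_mul_cancel₀ hdet]
  let τ : SpecialLinearGroup (Fin (N + 2)) F := ⟨M, hM⟩
  refine ⟨τ⁻¹, fun v => ?_⟩
  rw [inv_inv τ, hfW]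
  refine forall_congr' fun a => forall_congr' fun ha => ?_
  show _ ↔ (M *ᵥ v) a = 0
  rw [← mulVec_mulVec, LinearMap.toMatrix'_mulVec, mulVec_diagonal, if_neg, one_mul]
  rintro rfl
  simp at ha

end plane

section index

variable {N p : ℕ}

/-- The strictly lower triangular entries and the diagonal entries of a lower triangular matrix. -/
abbrev LowerData (N p m : ℕ) : Type := ((Σ a : Fin N, Fin a) → ZMod p) × (Fin N → Fin m)

lemma card_lowerData (N m : ℕ) [NeZero p] :
    Fintype.card (LowerData N p m) = p ^ N.choose 2 * m ^ N := by
  rw [Fintype.card_prod, Fintype.card_fun, Fintype.card_fun, Fintype.card_sigma, ZMod.card]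
  simp only [Fintype.card_fin]
  rw [Fin.sum_univ_eq_sum_range (fun i => i), Finset.sum_range_id, Nat.choose_two_right]

/-- The last diagonal entries of `lowerMatrix`. -/
def diagEntry {m : ℕ} (x : LowerData N p m) (i : Fin N) : ZMod p := ((x.2 i : ℕ) + 1 : ℕ)

/-- The lower triangular matrix of determinant one with given entries in its last columns. -/
def lowerMatrix {m : ℕ} (x : LowerData N p m) : Matrix (Fin (N + 2)) (Fin (N + 2)) (ZMod p) :=
  fun a b => if a = b then
      (Fin.cons (∏ i, diagEntry x i)⁻¹ (Fin.cons 1 (diagEntry x)) : Fin (N + 2) → ZMod p) a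
    else if h : 2 ≤ (b : ℕ) ∧ b < a then
      x.1 ⟨⟨a - 2, by omega⟩, ⟨b - 2, by
        have := h.2
        rw [Fin.lt_def] at this
        show (b : ℕ) - 2 < a - 2
        omega⟩⟩
    else 0

variable {m : ℕ}

lemma diagEntry_injective {x y : LowerData N p m} (hm : m < p) {i : Fin N}
    (h : diagEntry x i = diagEntry y i) : x.2 i = y.2 i := by
  rw [diagEntry, diagEntry, ZMod.natCast_eq_natCast_iff', Nat.mod_eq_of_lt (by omega),
    Nat.mod_eq_of_lt (by omega)] at h
  exact Fin.ext (by omega)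

lemma diagEntry_ne_zero (hm : m < p) (x : LowerData N p m) (i : Fin N) : diagEntry x i ≠ 0 := by
  rw [diagEntry, Ne, ZMod.natCast_eq_zero_iff]
  exact Nat.not_dvd_of_pos_of_lt (by omega) (by omega)

lemma diagEntry_add_ne_zero (hm : 2 * m < p) (x y : LowerData N p m) (i : Fin N) :
    diagEntry x i + diagEntry y i ≠ 0 := by
  rw [diagEntry, diagEntry, ← Nat.cast_add, Ne, ZMod.natCast_eq_zero_iff]
  exact Nat.not_dvd_of_pos_of_lt (by omega) (by omega)

lemma isLowerTriangular_lowerMatrix (x : LowerData N p m) :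
    (lowerMatrix x).BlockTriangular OrderDual.toDual := by
  intro a b hab
  have hab' : a < b := hab
  rw [lowerMatrix, if_neg hab'.ne, dif_neg fun h => absurd h.2 hab'.asymm]

lemma det_lowerMatrix [Fact p.Prime] (hm : m < p) (x : LowerData N p m) :
    (lowerMatrix x).det = 1 := by
  rw [det_of_isLowerTriangular _ (isLowerTriangular_lowerMatrix x)]
  simp only [lowerMatrix, if_true]
  rw [Fin.prod_univ_succ, Fin.prod_univ_succ]
  simp only [Fin.cons_zero, Fin.cons_succ, one_mul]
  exact inv_mul_cancel₀ (Finset.prod_ne_zero_iff.2 fun i _ => diagEntry_ne_zero hm x i)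

/-- `lowerMatrix` as an element of the special linear group. -/
def lowerElement [Fact p.Prime] (hm : m < p) (x : LowerData N p m) :
    SpecialLinearGroup (Fin (N + 2)) (ZMod p) := ⟨lowerMatrix x, det_lowerMatrix hm x⟩

lemma lowerMatrix_diag (x : LowerData N p m) (i : Fin N) :
    lowerMatrix x i.succ.succ i.succ.succ = diagEntry x i := by
  simp [lowerMatrix]

lemma lowerMatrix_lower (x : LowerData N p m) (i : Fin N) (j : Fin i) :
    lowerMatrix x i.succ.succ ⟨j + 2, by omega⟩ = x.1 ⟨i, j⟩ := by
  rw [lowerMatrix, if_neg, dif_pos]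
  · rfl
  · refine ⟨by simp, ?_⟩
    rw [Fin.lt_def]
    simp
  · rw [Fin.ext_iff]
    simp
    omega

variable [Fact p.Prime]

lemma keepsPlane_lowerElement (hm : m < p) (x : LowerData N p m) :
    KeepsPlane (lowerElement hm x) := by
  intro a b ha hb
  show lowerMatrix x a b = 0
  rw [lowerMatrix, if_neg (by rintro rfl; omega), dif_neg (by omega)]

lemma eq_of_mem_blockSubgroup (hm : m < p) {x y : LowerData N p m}
    (h : (lowerElement hm x)⁻¹ * lowerElement hm y ∈ blockSubgroup (N + 2) (ZMod p) 2) : x = y := by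
  have hcol : ∀ a b : Fin (N + 2), 2 ≤ (b : ℕ) → lowerMatrix y a b = lowerMatrix x a b := by
    intro a b hb
    have h1 : lowerMatrix x * ((lowerElement hm x)⁻¹ * lowerElement hm y).1 = lowerMatrix y :=
      congrArg Subtype.val (mul_inv_cancel_left (lowerElement hm x) (lowerElement hm y))
    have h2 : lowerMatrix y *ᵥ Pi.single b 1 = lowerMatrix x *ᵥ Pi.single b 1 := by
      rw [← h1, ← mulVec_mulVec, (h b hb).1]
    simpa only [mulVec_single_one, col_apply] using congrFun h2 a
  refine Prod.ext ?_ ?_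
  · funext ⟨i, j⟩
    rw [← lowerMatrix_lower, ← lowerMatrix_lower, hcol _ _ (by simp)]
  · funext i
    refine diagEntry_injective hm ?_
    rw [← lowerMatrix_diag, ← lowerMatrix_diag, hcol _ _ (by simp)]

lemma lower_inv_mul (hm : m < p) (hm2 : 2 * m < p) (x y : LowerData N p m) :
    Lower ((lowerElement hm x)⁻¹ * lowerElement hm y) := by
  set h := (lowerElement hm x)⁻¹ * lowerElement hm y with hh
  have htri : BlockTriangular h.1 OrderDual.toDual :=
    (blockTriangular_inv (σ := lowerElement hm x) (isLowerTriangular_lowerMatrix x)).mul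
      (isLowerTriangular_lowerMatrix y)
  intro j hj
  obtain ⟨i, rfl⟩ : ∃ i : Fin N, j = i.succ.succ := ⟨⟨j - 2, by omega⟩, Fin.ext (by simp; omega)⟩
  have hd : diagEntry x i * h.1 i.succ.succ i.succ.succ = diagEntry y i := by
    have h2 : lowerMatrix x * h.1 = lowerMatrix y :=
      congrArg Subtype.val (mul_inv_cancel_left (lowerElement hm x) (lowerElement hm y))
    have h3 := congrFun (congrFun h2 i.succ.succ) i.succ.succ
    rw [mul_apply, Finset.sum_eq_single i.succ.succ] at h3
    · rwa [lowerMatrix_diag, lowerMatrix_diag] at h3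
    · intro c _ hc
      rcases lt_or_gt_of_ne hc with hc | hc
      · exact mul_eq_zero_of_right _ (htri hc)
      · exact mul_eq_zero_of_left (isLowerTriangular_lowerMatrix x hc) _
    · simp
  refine ⟨fun a ha => htri ha, fun h0 => ?_, fun h0 => ?_⟩
  · rw [h0, mul_zero] at hd
    exact diagEntry_ne_zero hm y i hd.symm
  · rw [h0, mul_neg_one] at hd
    exact diagEntry_add_ne_zero hm2 x y i (by rw [← hd, add_neg_cancel])

end index

end CodimOne

namespace CodimOne

open ListCochain

variable {N p : ℕ}

lemma flagDegree_eq (N : ℕ) : (N + 2) * (N + 2 - 1) / 2 - 1 = flagDegree N := by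
  have : (N + 2) * (N + 2 - 1) = 2 * (flagDegree N + 1) := by
    rw [show N + 2 - 1 = N + 1 by omega]
    induction N with
    | zero => rfl
    | succ N ih =>
      rw [flagDegree]
      linarith
  omega

/-- The restriction of `flagCocycle` to the congruence subgroup. -/
noncomputable def restrictedCocycle (h : SpecialLinearGroup (Fin (N + 2)) (ZMod p))
    (l : List (congruenceSubgroup (N + 2) p)) : ℚ := flagCocycle p N h (l.map Subtype.val)

lemma inv_restrictedCocycle (h : SpecialLinearGroup (Fin (N + 2)) (ZMod p)) :
    Inv ⊤ (restrictedCocycle h) := by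
  intro γ _ l
  have hγ : red p γ.1 = 1 := γ.2
  have h1 := flagCocycle_map_mul rfl γ.1 h (l.map Subtype.val)
  rw [hγ, inv_one, one_mul, List.map_map] at h1
  rw [restrictedCocycle, restrictedCocycle, ← h1, List.map_map]
  rfl

lemma d_inhomogeneous_restrictedCocycle (h : SpecialLinearGroup (Fin (N + 2)) (ZMod p)) :
    (inhomogeneousCochains.d (Rep.trivial ℚ (congruenceSubgroup (N + 2) p) ℚ) (flagDegree N)).hom
      (inhomogeneous (flagDegree N) (restrictedCocycle h)) = 0 := by
  rw [d_inhomogeneous (inv_restrictedCocycle h)]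
  funext g
  show d (fun l => flagCocycle p N h (l.map Subtype.val)) _ = 0
  rw [d_map]
  exact d_flagCocycle rfl h (by simp)

/-- The cohomology class of `restrictedCocycle`. -/
noncomputable def flagClass (h : SpecialLinearGroup (Fin (N + 2)) (ZMod p)) :
    groupCohomology (Rep.trivial ℚ (congruenceSubgroup (N + 2) p) ℚ) (flagDegree N) :=
  groupCohomology.π _ _ (groupCohomology.cocyclesMk _ (d_inhomogeneous_restrictedCocycle h))

/-- Classes of suitably separated translates are linearly independent. -/
lemma linearIndependent_flagClass (hp : 2 < p) [Fact p.Prime] {ι : Type*}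
    (h : ι → SpecialLinearGroup (Fin (N + 2)) (ZMod p))
    (hs : ∀ i j, i ≠ j → ¬ KeepsPlane ((h j)⁻¹ * h i)⁻¹ ∨
      (Lower ((h j)⁻¹ * h i) ∧ (h j)⁻¹ * h i ∉ blockSubgroup (N + 2) (ZMod p) 2)) :
    LinearIndependent ℚ fun i => flagClass (h i) := by
  choose γ hγ using fun i => red_surjective (h i)
  rw [linearIndependent_iff']
  intro s a hsum j hj
  obtain ⟨b, hb, hb0, hab⟩ := exists_cob_of_sum_eq_zero s a
    (fun i => inv_restrictedCocycle (h i)) (fun i => d_inhomogeneous_restrictedCocycle (h i)) hsum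
  refine coeff_eq_zero hp rfl s a γ hb hb0 (fun l hl => ?_) hj fun i _ hij => ?_
  · rw [← hab l hl]
    refine Finset.sum_congr rfl fun i _ => ?_
    rw [hγ, restrictedCocycle]
  · rw [hγ, hγ]
    exact hs i j hij

lemma separated_of_ne {m : ℕ} [Fact p.Prime] (hm : m < p) (hm2 : 2 * m < p)
    {S : Type*} {W : S → Submodule (ZMod p) (Fin (N + 2) → ZMod p)} (hW : W.Injective)
    {g : S → SpecialLinearGroup (Fin (N + 2)) (ZMod p)} (hg : ∀ s, MapsPlane (g s) (W s))
    (hdim : ∀ s, Module.finrank (ZMod p) (W s) = 2)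
    {i j : S × LowerData N p m} (hij : i ≠ j) :
    ¬ KeepsPlane ((g j.1 * lowerElement hm j.2)⁻¹ * (g i.1 * lowerElement hm i.2))⁻¹ ∨
      (Lower ((g j.1 * lowerElement hm j.2)⁻¹ * (g i.1 * lowerElement hm i.2)) ∧
        (g j.1 * lowerElement hm j.2)⁻¹ * (g i.1 * lowerElement hm i.2) ∉
          blockSubgroup (N + 2) (ZMod p) 2) := by
  by_cases h1 : i.1 = j.1
  · right
    have h2 : (g j.1 * lowerElement hm j.2)⁻¹ * (g i.1 * lowerElement hm i.2) =
        (lowerElement hm j.2)⁻¹ * lowerElement hm i.2 := by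
      rw [h1]
      group
    rw [h2]
    exact ⟨lower_inv_mul hm hm2 _ _,
      fun h => hij (Prod.ext h1 (eq_of_mem_blockSubgroup hm h).symm)⟩
  · left
    intro h
    refine h1 (hW ?_)
    have h2 : (g i.1)⁻¹ * g j.1 = lowerElement hm i.2 *
        ((g j.1 * lowerElement hm j.2)⁻¹ * (g i.1 * lowerElement hm i.2))⁻¹ *
          (lowerElement hm j.2)⁻¹ := by
      group
    refine (Submodule.eq_of_le_of_finrank_eq ((hg j.1).le (hg i.1) ?_)
      ((hdim _).trans (hdim _).symm)).symm
    rw [h2]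
    exact ((keepsPlane_lowerElement hm _).mul h).mul (keepsPlane_lowerElement hm _).inv

end CodimOne

open CodimOne

/-- **Theorem C**. For `p = 3` or `5` and `n ≥ 2`, the `ℚ`-dimension of the
codimension-one rational cohomology `H^{n(n-1)/2 - 1}(Γ_n(p); ℚ)` is at least
`p^{(n-2 choose 2)} · |Gr_2(𝔽_p^n)| · ((p-1)/2)^{n-2}`. -/
theorem codim_one_cohomology_congruence_lower_bound (p n : ℕ)
    (hp : p = 3 ∨ p = 5) (hn : 2 ≤ n) :
    ((p ^ Nat.choose (n - 2) 2 *
        Nat.card {W : Submodule (ZMod p) (Fin n → ZMod p) // Module.finrank (ZMod p) ↥W = 2} *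
        ((p - 1) / 2) ^ (n - 2) : ℕ) : Cardinal) ≤
      Module.rank ℚ
        (groupCohomology (Rep.trivial ℚ ↥(congruenceSubgroup n p) ℚ)
          (n * (n - 1) / 2 - 1)) := by
  obtain ⟨N, rfl⟩ := Nat.exists_eq_add_of_le' hn
  have : Fact p.Prime := ⟨by rcases hp with rfl | rfl <;> norm_num⟩
  have hp2 : 2 < p := by omega
  have hm : (p - 1) / 2 < p := by omega
  have hm2 : 2 * ((p - 1) / 2) < p := by omega
  rw [flagDegree_eq, Nat.add_sub_cancel]
  choose g hg using fun W : {W : Submodule (ZMod p) (Fin (N + 2) → ZMod p) //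
    Module.finrank (ZMod p) ↥W = 2} => exists_mapsPlane W.2
  have hli := linearIndependent_flagClass (ι := _ × LowerData N p ((p - 1) / 2)) hp2
    (fun i => g i.1 * lowerElement hm i.2)
    fun i j hij => separated_of_ne hm hm2 Subtype.val_injective hg (fun W => W.2) hij
  refine le_trans (le_of_eq ?_) hli.cardinal_le_rank
  rw [← Nat.cast_card, Nat.card_prod, Nat.card_eq_fintype_card (α := LowerData _ _ _),
    card_lowerData]
  congr 1
  ring
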